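/- (Proposition 3.8, part i) Assume 0<h<2 with 2/h∉ℤ, h small and L large; set λ=⌊2/h⌋+1. Let C∈𝒞 and let η be a trap for which there exist k≥1 pairwise non-interacting rectangles R_{ℓ_1,m_1},…,R_{ℓ_k,m_k} with 2≤ℓ_i≤m_i≤L−2, such that η equals +1̲ on the union ℜ of their interiors and equals C on Λ∖ℜ. If ℓ_i<λ for all i, then ℙ_η(τ_𝒞<τ_{+1̲})→1 as β→∞ and, with ℓ:=max{ℓ_1,…,ℓ_k}, for every ε>0, ℙ_η( exp{2βh(ℓ−1)−βε} < τ_𝒞 < exp{2βh(ℓ−1)+βε} )→1. If ℓ_j≥λ for some j, then ℙ_η(τ_{+1̲}<τ_𝒞)→1 and for every ε>0, ℙ_η( exp{2β(2−h)−βε} < τ_{+1̲} < exp{2β(2−h)+βε} )→1. -/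

import Mathlib

open scoped BigOperators Classical
open Filter

namespace PCA

/-- Sites of the two-dimensional discrete torus of side `L`. -/
abbrev Site (L : ℕ) := ZMod L × ZMod L

/-- Spin configurations: `true` codes the spin `+1`, `false` codes `-1`. -/
abbrev Config (L : ℕ) := Site L → Bool

noncomputable section

/-- The real value of a spin. -/
def spin (b : Bool) : ℝ := if b then 1 else -1

def east (L : ℕ) : Site L := (1, 0)
def north (L : ℕ) : Site L := (0, 1)

variable {L : ℕ}

/-- `S_σ(x)`: the sum of the spins of the four nearest neighbours of `x`. -/
def nnS (σ : Config L) (x : Site L) : ℝ :=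
  spin (σ (x + east L)) + spin (σ (x - east L)) +
    spin (σ (x + north L)) + spin (σ (x - north L))

/-- Single-site heat-bath probability `p_x(a|σ)`. -/
def flipP (β h : ℝ) (σ : Config L) (x : Site L) (a : Bool) : ℝ :=
  1 / (1 + Real.exp (-2 * β * spin a * (nnS σ x + h)))

/-- The PCA transition matrix `P(σ,η) = ∏_x p_x(η(x)|σ)`. -/
def Pmat (β h : ℝ) [NeZero L] (σ η : Config L) : ℝ :=
  ∏ x : Site L, flipP β h σ x (η x)

/-- The four-body Hamiltonian `H_β`. -/
def Ham (β h : ℝ) [NeZero L] (σ : Config L) : ℝ :=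
  -(β * h) * ∑ x : Site L, spin (σ x)
    - ∑ x : Site L, Real.log (Real.cosh (β * (nnS σ x + h)))

/-- The zero-temperature energy `E`. -/
def En (h : ℝ) [NeZero L] (σ : Config L) : ℝ :=
  -h * ∑ x : Site L, spin (σ x) - ∑ x : Site L, |nnS σ x + h|

/-- The zero-temperature drift map `T`. -/
def T (h : ℝ) (σ : Config L) : Config L :=
  fun x => if 0 < nnS σ x + h then true else false

def plusC (L : ℕ) : Config L := fun _ => true
def minusC (L : ℕ) : Config L := fun _ => false

/-- The even chessboard `C_e(x) = (-1)^(x₁+x₂)` (`true` at even-parity sites). -/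
def chessE (L : ℕ) : Config L := fun x => decide ((x.1 + x.2).val % 2 = 0)
def chessO (L : ℕ) : Config L := fun x => !(chessE L x)
def chessSet (L : ℕ) : Set (Config L) := {chessE L, chessO L}

def IsChessCfg {L : ℕ} (C : Config L) : Prop := C = chessE L ∨ C = chessO L

/-- A trap: a stable configuration or an element of a stable pair. -/
def IsTrap (h : ℝ) (σ : Config L) : Prop := T h σ = σ ∨ T h (T h σ) = σ

/-- The trap `σ̂` reached by the downhill path started at `σ`. -/
def hatTrap (h : ℝ) (σ : Config L) : Config L :=
  (T h)^[sInf {n | IsTrap h ((T h)^[n] σ)}] σ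

/-- The basin of attraction `𝔅(ζ)` of a trap `ζ`. -/
def basin (h : ℝ) (ζ : Config L) : Set (Config L) := {σ | hatTrap h σ = ζ}

/-- The interior of a rectangle on the dual lattice: an `a × b` block of sites
with lower-left corner `c`. -/
def rect (c : Site L) (a b : ℕ) : Set (Site L) :=
  { y | ∃ i j : ℕ, i < a ∧ j < b ∧ y = c + ((i : ZMod L), (j : ZMod L)) }

/-- The configuration equal to `ζ` inside the given rectangle and to `bg` outside. -/
def rectCfg (bg ζ : Config L) (c : Site L) (a b : ℕ) : Config L :=
  fun x => if x ∈ rect c a b then ζ x else bg x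

/-- Differences between sites at euclidean distance at most `2` on the torus. -/
def closeDiff (d : Site L) : Prop :=
  ∃ u v : ℤ, u ^ 2 + v ^ 2 ≤ 4 ∧ d = ((u : ZMod L), (v : ZMod L))

/-- Two sets of sites are non-interacting iff all pairs of sites are at
euclidean distance `> 2` (equivalently `≥ √5`). -/
def NonInteracting (A B : Set (Site L)) : Prop :=
  ∀ x ∈ A, ∀ y ∈ B, ¬ closeDiff (y - x)

/-- Nearest-neighbour adjacency on the torus. -/
def Adj (x y : Site L) : Prop :=
  y = x + east L ∨ y = x - east L ∨ y = x + north L ∨ y = x - north L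

def stepSet : Set (ℤ × ℤ) := {(1, 0), (-1, 0), (0, 1), (0, -1)}

/-- `X` contains a nearest-neighbour loop winding around the torus
(a percolating, torus-wrapping, cluster is a cluster containing such a loop). -/
def Wrapping (X : Set (Site L)) : Prop :=
  ∃ (n : ℕ) (f : ℕ → Site L) (d : ℕ → ℤ × ℤ),
    0 < n ∧ f n = f 0 ∧ (∑ i ∈ Finset.range n, d i) ≠ 0 ∧
    ∀ i < n, d i ∈ stepSet ∧
      f (i + 1) = f i + (((d i).1 : ZMod L), ((d i).2 : ZMod L)) ∧ f i ∈ X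

/-- `σ` has a well defined sea of the homogeneous phase `α`. -/
def SeaHom (h : ℝ) (α σ : Config L) : Prop :=
  ∃ X : Set (Site L), Wrapping X ∧ (∀ x ∈ X, σ x = α x) ∧
    ∀ n : ℕ, 1 ≤ n → ∀ x ∈ X, (T h)^[n] σ x = α x

/-- `σ` has a well defined sea of the chessboard `C`. -/
def SeaChess (h : ℝ) (C σ : Config L) : Prop :=
  ∃ X : Set (Site L), Wrapping X ∧ (∀ x ∈ X, σ x = C x) ∧
    ∀ n : ℕ, 1 ≤ n → ∀ x ∈ X, (T h)^[2 * n] σ x = C x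

def SeaMinus (h : ℝ) (σ : Config L) : Prop := SeaHom h (minusC L) σ
def SeaPlus (h : ℝ) (σ : Config L) : Prop := SeaHom h (plusC L) σ
def SeaChessAny (h : ℝ) (σ : Config L) : Prop :=
  SeaChess h (chessE L) σ ∨ SeaChess h (chessO L) σ

/-- Communication height `H(σ,η) = H(σ) - log P(σ,η)`. -/
def commH (β h : ℝ) [NeZero L] (σ η : Config L) : ℝ :=
  Ham β h σ - Real.log (Pmat β h σ η)

/-- Minimal height (minmax) `Φ(σ,η)` over all paths from `σ` to `η`. -/
def Phi (β h : ℝ) [NeZero L] (σ η : Config L) : ℝ :=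
  sInf { v | ∃ (n : ℕ) (f : ℕ → Config L), 0 < n ∧ f 0 = σ ∧ f n = η ∧
    v = sSup { w | ∃ i < n, w = commH β h (f i) (f (i + 1)) } }

/-- The barrier `Υ(η) = min_{ζ ∉ 𝔅(η)} Φ(η,ζ)` to exit the basin of the trap `η`. -/
def Ups (β h : ℝ) [NeZero L] (η : Config L) : ℝ :=
  sInf { v | ∃ ζ : Config L, ζ ∉ basin h η ∧ v = Phi β h η ζ }

/-- Probability, starting from `σ0`, that the first visit to `E` happens
at time `n` and at a state of `F`. -/
def firstHitP (β h : ℝ) [NeZero L] (σ0 : Config L) (E F : Set (Config L)) (n : ℕ) : ℝ :=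
  ∑ f : Fin (n + 1) → Config L,
    if f 0 = σ0 ∧ (∀ i : Fin (n + 1), (i : ℕ) < n → f i ∉ E) ∧ f (Fin.last n) ∈ E ∩ F
    then ∏ i : Fin n, Pmat β h (f i.castSucc) (f i.succ) else 0

/-- `ℙ_{σ0}(τ_A < τ_B)`. -/
def probHitBefore (β h : ℝ) [NeZero L] (σ0 : Config L) (A B : Set (Config L)) : ℝ :=
  ∑' n : ℕ, firstHitP β h σ0 (A ∪ B) (A \ B) n

/-- `ℙ_{σ0}(τ_D ∈ I)` (for `τ_D < ∞`). -/
def probTauIn (β h : ℝ) [NeZero L] (σ0 : Config L) (D : Set (Config L)) (I : Set ℝ) : ℝ :=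
  ∑' n : ℕ, if (n : ℝ) ∈ I then firstHitP β h σ0 D Set.univ n else 0

/-- `ℙ_{σ0}(τ_D > t)` (including the event that `D` is never visited). -/
def probTauGT (β h : ℝ) [NeZero L] (σ0 : Config L) (D : Set (Config L)) (t : ℝ) : ℝ :=
  1 - probTauIn β h σ0 D (Set.Iic t)

/-- `ℙ_{σ0}(σ_{τ_E} ∈ F)`. -/
def probFirstHitIn (β h : ℝ) [NeZero L] (σ0 : Config L) (E F : Set (Config L)) : ℝ :=
  ∑' n : ℕ, firstHitP β h σ0 E F n

/-- The critical length `λ = ⌊2/h⌋ + 1`. -/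
def lam (h : ℝ) : ℕ := Nat.floor (2 / h) + 1

/-- The protocritical height `Γ = -2hλ² + 2λ(4+h) - 2h`. -/
def Gam (h : ℝ) : ℝ :=
  -2 * h * (lam h : ℝ) ^ 2 + 2 * (lam h : ℝ) * (4 + h) - 2 * h

/-- The geometric conditions of Proposition 3.3 (iii) for a trap in the sea of
minuses, with `s` chessboard rectangles (indices `< s`) and `k - s` plus
rectangles (indices `≥ s`). -/
def MinusMultiSpec (h : ℝ) (σ : Config L) (s : ℕ) {k : ℕ}
    (c : Fin k → Site L) (a b : Fin k → ℕ) : Prop :=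
  1 ≤ k ∧ s ≤ k ∧
  (∀ i, 2 ≤ min (a i) (b i) ∧ max (a i) (b i) ≤ L - 2) ∧
  (∀ i j, i ≠ j → Disjoint (rect (c i) (a i) (b i)) (rect (c j) (a j) (b j))) ∧
  (∀ j i : Fin k, (j : ℕ) < s → s ≤ (i : ℕ) →
    NonInteracting (rect (c j) (a j) (b j)) (rect (c i) (a i) (b i))) ∧
  (∀ i j : Fin k, s ≤ (i : ℕ) → s ≤ (j : ℕ) → i ≠ j →
    NonInteracting (rect (c i) (a i) (b i)) (rect (c j) (a j) (b j))) ∧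
  (∀ x, (∀ i, x ∉ rect (c i) (a i) (b i)) → σ x = false) ∧
  (∀ i : Fin k, s ≤ (i : ℕ) → ∀ x ∈ rect (c i) (a i) (b i), σ x = true) ∧
  ∃ Cp : Fin k → Config L,
    (∀ j : Fin k, (j : ℕ) < s → IsChessCfg (Cp j) ∧
      ∃ (k' : ℕ) (c' : Fin k' → Site L) (a' b' : Fin k' → ℕ),
        (∀ i, rect (c' i) (a' i) (b' i) ⊆ rect (c j) (a j) (b j)) ∧
        (∀ i i', i ≠ i' →
          NonInteracting (rect (c' i) (a' i) (b' i)) (rect (c' i') (a' i') (b' i'))) ∧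
        (∀ i, ∀ x ∈ rect (c' i) (a' i) (b' i), σ x = true) ∧
        (∀ x ∈ rect (c j) (a j) (b j),
          (∀ i, x ∉ rect (c' i) (a' i) (b' i)) → σ x = Cp j x)) ∧
    (∀ i j : Fin k, (i : ℕ) < s → (j : ℕ) < s → i ≠ j → Cp i = Cp j →
      NonInteracting (rect (c i) (a i) (b i)) (rect (c j) (a j) (b j)))

/-- `η ∈ 𝒪_{-1}` (a `(λ-1) × λ` chessboard droplet in the sea of minuses) and
`ζ ∈ π_{-1}(η)` is one of its protocritical droplets. -/
def ProtoRel (h : ℝ) (η ζ : Config L) : Prop :=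
  ∃ (c : Site L) (a b : ℕ) (C : Config L) (y z : Site L),
    IsChessCfg C ∧
    ((a = lam h - 1 ∧ b = lam h) ∨ (a = lam h ∧ b = lam h - 1)) ∧
    (∀ x ∈ rect c a b, η x = C x) ∧ (∀ x ∉ rect c a b, η x = false) ∧
    y ∉ rect c a b ∧ z ∈ rect c a b ∧ Adj y z ∧ C z = true ∧
    (∀ x ∈ rect c a b, ζ x = !(C x)) ∧ ζ y = true ∧
    (∀ x, x ∉ rect c a b → x ≠ y → ζ x = false)

/-- The set `𝒪_{-1}` of `(λ-1) × λ` chessboard droplets in the sea of minuses. -/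
def OSet (h : ℝ) (L : ℕ) : Set (Config L) :=
  { η | ∃ (c : Site L) (a b : ℕ) (C : Config L),
      IsChessCfg C ∧ ((a = lam h - 1 ∧ b = lam h) ∨ (a = lam h ∧ b = lam h - 1)) ∧
      (∀ x ∈ rect c a b, η x = C x) ∧ (∀ x ∉ rect c a b, η x = false) }

/-- The set `𝒫_{-1}` of protocritical droplets. -/
def ProtoSet (h : ℝ) (L : ℕ) : Set (Config L) := { ζ | ∃ η, ProtoRel h η ζ }

end

section Chain

variable {α : Type*} [Fintype α]

/-- A row-stochastic kernel on a finite type. -/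
structure IsStoch (P : α → α → ℝ) : Prop where
  nonneg : ∀ σ ζ, 0 ≤ P σ ζ
  sum_one : ∀ σ, ∑ ζ, P σ ζ = 1

/-- Probability of visiting `D` within `n` steps, all earlier states lying in `G`. -/
noncomputable def reach (P : α → α → ℝ) (G D : Set α) : ℕ → α → ℝ
  | 0, σ => if σ ∈ D then 1 else 0
  | n + 1, σ => if σ ∈ D then 1 else if σ ∈ G then ∑ ζ, P σ ζ * reach P G D n ζ else 0

/-- Probability that the states at times `0, …, n` all lie in `A`. -/
noncomputable def stay (P : α → α → ℝ) (A : Set α) : ℕ → α → ℝ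
  | 0, σ => if σ ∈ A then 1 else 0
  | n + 1, σ => if σ ∈ A then ∑ ζ, P σ ζ * stay P A n ζ else 0

variable {P : α → α → ℝ}

lemma IsStoch.sum_mul_le (hP : IsStoch P) {f : α → ℝ} {c : ℝ} (h : ∀ ζ, f ζ ≤ c) (σ : α) :
    ∑ ζ, P σ ζ * f ζ ≤ c := by
  calc ∑ ζ, P σ ζ * f ζ ≤ ∑ ζ, P σ ζ * c :=
        Finset.sum_le_sum fun ζ _ => mul_le_mul_of_nonneg_left (h ζ) (hP.nonneg σ ζ)
    _ = c := by rw [← Finset.sum_mul, hP.sum_one, one_mul]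

lemma IsStoch.sum_mul_nonneg (hP : IsStoch P) {f : α → ℝ} (h : ∀ ζ, 0 ≤ f ζ) (σ : α) :
    0 ≤ ∑ ζ, P σ ζ * f ζ :=
  Finset.sum_nonneg fun ζ _ => mul_nonneg (hP.nonneg σ ζ) (h ζ)

lemma IsStoch.sum_mul_mono (hP : IsStoch P) {f g : α → ℝ} (h : ∀ ζ, f ζ ≤ g ζ) (σ : α) :
    ∑ ζ, P σ ζ * f ζ ≤ ∑ ζ, P σ ζ * g ζ :=
  Finset.sum_le_sum fun ζ _ => mul_le_mul_of_nonneg_left (h ζ) (hP.nonneg σ ζ)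

lemma reach_nonneg (hP : IsStoch P) (G D : Set α) (n : ℕ) (σ : α) : 0 ≤ reach P G D n σ := by
  induction n generalizing σ with
  | zero => unfold reach; split_ifs <;> norm_num
  | succ n ih =>
    unfold reach; split_ifs
    · norm_num
    · exact hP.sum_mul_nonneg ih σ
    · exact le_rfl

lemma reach_le_one (hP : IsStoch P) (G D : Set α) (n : ℕ) (σ : α) : reach P G D n σ ≤ 1 := by
  induction n generalizing σ with
  | zero => unfold reach; split_ifs <;> norm_num
  | succ n ih =>
    unfold reach; split_ifs
    · norm_num
    · exact hP.sum_mul_le ih σ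
    · norm_num

lemma reach_of_mem {G D : Set α} {σ : α} (h : σ ∈ D) (n : ℕ) : reach P G D n σ = 1 := by
  cases n <;> simp [reach, h]

lemma reach_mono (hP : IsStoch P) {G G' D : Set α} (hG : G ⊆ G' ∪ D) (n : ℕ) (σ : α) :
    reach P G D n σ ≤ reach P G' D n σ := by
  induction n generalizing σ with
  | zero => exact le_rfl
  | succ n ih =>
    by_cases hD : σ ∈ D
    · simp [reach, hD]
    by_cases h : σ ∈ G
    · have h' : σ ∈ G' := (hG h).resolve_right hD
      simp only [reach, hD, h, h', if_true, if_false]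
      exact hP.sum_mul_mono ih σ
    · rw [reach, if_neg hD, if_neg h]
      exact reach_nonneg hP _ _ _ _

lemma reach_le_succ (hP : IsStoch P) (G D : Set α) (n : ℕ) (σ : α) :
    reach P G D n σ ≤ reach P G D (n + 1) σ := by
  induction n generalizing σ with
  | zero =>
    by_cases hD : σ ∈ D
    · simp [reach, hD]
    · rw [reach, if_neg hD]
      exact reach_nonneg hP _ _ _ _
  | succ n ih =>
    rw [reach, reach]
    split_ifs
    · exact le_rfl
    · exact hP.sum_mul_mono ih σ
    · exact le_rfl

lemma reach_mono_time (hP : IsStoch P) (G D : Set α) (σ : α) :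
    Monotone fun n => reach P G D n σ :=
  monotone_nat_of_le_succ fun n => reach_le_succ hP G D n σ

/-- Strong Markov property at the hitting time of `D`. -/
lemma reach_comp (hP : IsStoch P) {G D E : Set α} {m : ℕ} {q : ℝ} (hq1 : q ≤ 1)
    (h : ∀ ζ ∈ D, q ≤ reach P G E m ζ) (n : ℕ) (σ : α) :
    q * reach P G D n σ ≤ reach P G E (n + m) σ := by
  induction n generalizing σ with
  | zero =>
    by_cases hD : σ ∈ D
    · simpa [reach, hD] using h σ hD
    · simpa [reach, hD] using reach_nonneg hP _ _ _ _
  | succ n ih =>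
    by_cases hD : σ ∈ D
    · rw [reach_of_mem hD, mul_one]
      exact (h σ hD).trans (reach_mono_time hP G E σ (by omega))
    by_cases hE : σ ∈ E
    · rw [reach_of_mem hE]
      exact mul_le_one₀ hq1 (reach_nonneg hP _ _ _ _) (reach_le_one hP _ _ _ _)
    rw [show n + 1 + m = (n + m) + 1 by omega]
    by_cases hG : σ ∈ G
    · simp only [reach, hD, hE, hG, if_true, if_false]
      rw [Finset.mul_sum]
      refine Finset.sum_le_sum fun ζ _ => ?_
      rw [mul_left_comm]
      exact mul_le_mul_of_nonneg_left (ih ζ) (hP.nonneg σ ζ)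
    · simp [reach, hD, hE, hG]

lemma mul_reach_le_reach_succ (hP : IsStoch P) {G D : Set α} {σ : α} (hσ : σ ∈ G) (ζ : α) (n : ℕ)
    (hle : P σ ζ ≤ 1) : P σ ζ * reach P G D n ζ ≤ reach P G D (n + 1) σ := by
  by_cases hD : σ ∈ D
  · rw [reach_of_mem hD]
    exact mul_le_one₀ hle (reach_nonneg hP _ _ _ _) (reach_le_one hP _ _ _ _)
  · simp only [reach, hD, hσ, if_true, if_false]
    exact Finset.single_le_sum (f := fun ζ => P σ ζ * reach P G D n ζ)
      (fun ζ _ => mul_nonneg (hP.nonneg σ ζ) (reach_nonneg hP _ _ _ _)) (Finset.mem_univ ζ)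

lemma stay_nonneg (hP : IsStoch P) (A : Set α) (n : ℕ) (σ : α) : 0 ≤ stay P A n σ := by
  induction n generalizing σ with
  | zero => unfold stay; split_ifs <;> norm_num
  | succ n ih =>
    unfold stay; split_ifs
    · exact hP.sum_mul_nonneg ih σ
    · exact le_rfl

lemma stay_le_one (hP : IsStoch P) (A : Set α) (n : ℕ) (σ : α) : stay P A n σ ≤ 1 := by
  induction n generalizing σ with
  | zero => unfold stay; split_ifs <;> norm_num
  | succ n ih =>
    unfold stay; split_ifs
    · exact hP.sum_mul_le ih σ
    · norm_num

lemma stay_of_notMem {A : Set α} {σ : α} (h : σ ∉ A) (n : ℕ) : stay P A n σ = 0 := by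
  cases n <;> simp [stay, h]

lemma stay_inter (hP : IsStoch P) (A B : Set α) (n : ℕ) (σ : α) :
    stay P A n σ + stay P B n σ - 1 ≤ stay P (A ∩ B) n σ := by
  induction n generalizing σ with
  | zero =>
    simp only [stay, Set.mem_inter_iff]
    by_cases hA : σ ∈ A <;> by_cases hB : σ ∈ B <;> simp [hA, hB]
  | succ n ih =>
    by_cases hA : σ ∈ A
    swap
    · rw [stay_of_notMem hA]
      have := stay_le_one hP B (n + 1) σ
      have := stay_nonneg hP (A ∩ B) (n + 1) σ
      linarith
    by_cases hB : σ ∈ B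
    swap
    · rw [stay_of_notMem hB]
      have := stay_le_one hP A (n + 1) σ
      have := stay_nonneg hP (A ∩ B) (n + 1) σ
      linarith
    simp only [stay, Set.mem_inter_iff, hA, hB, and_self, if_true]
    refine le_trans (le_of_eq ?_) (hP.sum_mul_mono ih σ)
    simp only [mul_sub, mul_add, Finset.sum_sub_distrib, Finset.sum_add_distrib, mul_one,
      hP.sum_one]

/-- If one step leaves `A` with probability at most `δ`, then `n` steps do so with
probability at most `n * δ`. -/
lemma one_sub_le_stay (hP : IsStoch P) {A : Set α} {δ : ℝ} (hδ : 0 ≤ δ)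
    (h : ∀ σ ∈ A, ∑ ζ, P σ ζ * (if ζ ∈ A then 0 else 1) ≤ δ) (n : ℕ) {σ : α} (hσ : σ ∈ A) :
    1 - n * δ ≤ stay P A n σ := by
  induction n generalizing σ with
  | zero => simp [stay, hσ]
  | succ n ih =>
    simp only [stay, hσ, if_true]
    have key : ∀ ζ, (1 - n * δ) - (if ζ ∈ A then 0 else 1) ≤ stay P A n ζ := by
      intro ζ
      split_ifs with hζ
      · simpa using ih hζ
      · rw [stay_of_notMem hζ]
        have : 0 ≤ (n : ℝ) * δ := by positivity
        linarith
    refine le_trans ?_ (hP.sum_mul_mono key σ)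
    have := h σ hσ
    simp only [mul_sub, Finset.sum_sub_distrib, ← Finset.sum_mul, hP.sum_one]
    push_cast
    linarith

lemma reach_le_one_sub_stay (hP : IsStoch P) {A D G : Set α} (h : Disjoint A D) (n : ℕ) (σ : α) :
    reach P G D n σ ≤ 1 - stay P A n σ := by
  induction n generalizing σ with
  | zero =>
    by_cases hD : σ ∈ D
    · have hA : σ ∉ A := fun hA => Set.disjoint_left.1 h hA hD
      simp [reach, stay, hD, hA]
    · have := stay_le_one hP A 0 σ
      rw [reach, if_neg hD]; linarith
  | succ n ih =>
    by_cases hD : σ ∈ D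
    · have hA : σ ∉ A := fun hA => Set.disjoint_left.1 h hA hD
      simp [reach, stay, hD, hA]
    by_cases hA : σ ∈ A
    swap
    · rw [stay_of_notMem hA]
      simpa using reach_le_one hP _ _ _ _
    by_cases hG : σ ∈ G
    · simp only [reach, stay, hD, hA, hG, if_true, if_false]
      refine (hP.sum_mul_mono ih σ).trans (le_of_eq ?_)
      simp only [mul_sub, Finset.sum_sub_distrib, mul_one, hP.sum_one]
    · have := stay_le_one hP A (n + 1) σ
      rw [reach, if_neg hD, if_neg hG]; linarith

lemma stay_le_reach_add (hP : IsStoch P) (A D : Set α) (n : ℕ) (σ : α) :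
    stay P A n σ ≤ reach P A D n σ + stay P (A \ D) n σ := by
  induction n generalizing σ with
  | zero =>
    by_cases hA : σ ∈ A <;> by_cases hD : σ ∈ D <;> simp [stay, reach, hA, hD]
  | succ n ih =>
    by_cases hD : σ ∈ D
    · have := stay_le_one hP A (n + 1) σ
      have := stay_nonneg hP (A \ D) (n + 1) σ
      rw [reach_of_mem hD]; linarith
    by_cases hA : σ ∈ A
    · simp only [reach, stay, Set.mem_sdiff, hD, hA, if_true, if_false, not_false_eq_true, and_self]
      refine (hP.sum_mul_mono ih σ).trans (le_of_eq ?_)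
      simp only [mul_add, Finset.sum_add_distrib]
    · rw [stay_of_notMem hA]
      have := reach_nonneg hP A D (n + 1) σ
      have := stay_nonneg hP (A \ D) (n + 1) σ
      linarith

lemma stay_add_le (hP : IsStoch P) {B : Set α} {m : ℕ} {q : ℝ}
    (h : ∀ σ ∈ B, stay P B m σ ≤ q) (n : ℕ) (σ : α) :
    stay P B (n + m) σ ≤ q * stay P B n σ := by
  induction n generalizing σ with
  | zero =>
    by_cases hB : σ ∈ B
    · simpa [stay, hB] using h σ hB
    · simp [stay_of_notMem hB]
  | succ n ih =>
    by_cases hB : σ ∈ B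
    · rw [show n + 1 + m = (n + m) + 1 by omega]
      simp only [stay, hB, if_true]
      rw [Finset.mul_sum]
      refine Finset.sum_le_sum fun ζ _ => ?_
      rw [mul_left_comm]
      exact mul_le_mul_of_nonneg_left (ih ζ) (hP.nonneg σ ζ)
    · simp [stay_of_notMem hB]

lemma stay_mul_le_pow (hP : IsStoch P) {B : Set α} {m : ℕ} {q : ℝ} (hq : 0 ≤ q)
    (h : ∀ σ ∈ B, stay P B m σ ≤ q) (K : ℕ) (σ : α) :
    stay P B (m * K) σ ≤ q ^ K := by
  induction K with
  | zero => simpa using stay_le_one hP B 0 σ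
  | succ K ih =>
    rw [Nat.mul_succ, pow_succ']
    exact (stay_add_le hP h _ σ).trans (mul_le_mul_of_nonneg_left ih hq)

/-- Repeated trials: if every state of `A` reaches `D` within `m` steps with probability at
least `p`, then `D` is missed for `m * K` steps with probability at most `(1 - p) ^ K`, apart
from the event of leaving `A`. -/
lemma stay_sub_pow_le_reach (hP : IsStoch P) {A D : Set α} {m : ℕ} {p : ℝ} (hp : p ≤ 1)
    (h : ∀ σ ∈ A, p ≤ reach P A D m σ) (K : ℕ) (σ : α) :
    stay P A (m * K) σ - (1 - p) ^ K ≤ reach P A D (m * K) σ := by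
  have h1 : ∀ σ ∈ A \ D, stay P (A \ D) m σ ≤ 1 - p := by
    intro σ hσ
    have := reach_le_one_sub_stay hP (G := A) (Set.disjoint_sdiff_left (s := D) (t := A)) m σ
    have := h σ hσ.1
    linarith
  have h2 := stay_mul_le_pow hP (by linarith) h1 K σ
  have h3 := stay_le_reach_add hP A D (m * K) σ
  linarith

/-- For a reversible kernel, the exit time from `A` started from the reversible measure. -/
lemma sum_mul_one_sub_stay_le (hP : ∀ σ ζ, 0 ≤ P σ ζ) (hP1 : ∀ σ, ∑ ζ, P σ ζ = 1) {μ : α → ℝ}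
    (hμ : ∀ σ, 0 ≤ μ σ) (hrev : ∀ σ ζ, μ σ * P σ ζ = μ ζ * P ζ σ) (A : Set α) (n : ℕ) :
    ∑ σ, (if σ ∈ A then μ σ * (1 - stay P A n σ) else 0) ≤
      n * ∑ σ, ∑ ζ, (if σ ∈ A ∧ ζ ∉ A then μ σ * P σ ζ else 0) := by
  have hS : IsStoch P := ⟨hP, hP1⟩
  induction n with
  | zero =>
    simp only [Nat.cast_zero, zero_mul]
    refine le_of_eq (Finset.sum_eq_zero fun σ _ => ?_)
    split_ifs with h <;> simp [stay, h]
  | succ n ih =>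
    have e1 : ∀ σ, (if σ ∈ A then μ σ * (1 - stay P A (n + 1) σ) else 0) =
        (∑ ζ, if σ ∈ A ∧ ζ ∉ A then μ σ * P σ ζ else 0) +
        ∑ ζ, if σ ∈ A ∧ ζ ∈ A then μ σ * P σ ζ * (1 - stay P A n ζ) else 0 := by
      intro σ
      by_cases hσ : σ ∈ A
      · simp only [hσ, if_true, stay, true_and]
        rw [← Finset.sum_add_distrib]
        have : (1 : ℝ) - ∑ ζ, P σ ζ * stay P A n ζ = ∑ ζ, P σ ζ * (1 - stay P A n ζ) := by
          simp only [mul_sub, Finset.sum_sub_distrib, mul_one, hP1]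
        rw [this, Finset.mul_sum]
        refine Finset.sum_congr rfl fun ζ _ => ?_
        by_cases hζ : ζ ∈ A
        · simp [hζ, mul_assoc]
        · simp [hζ, stay_of_notMem hζ]
      · simp [hσ]
    simp only [e1, Finset.sum_add_distrib]
    have e2 : (∑ σ, ∑ ζ, if σ ∈ A ∧ ζ ∈ A then μ σ * P σ ζ * (1 - stay P A n ζ) else 0) ≤
        ∑ ζ, (if ζ ∈ A then μ ζ * (1 - stay P A n ζ) else 0) := by
      rw [Finset.sum_comm]
      refine Finset.sum_le_sum fun ζ _ => ?_
      by_cases hζ : ζ ∈ A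
      · simp only [hζ, and_true, if_true]
        have h0 : 0 ≤ 1 - stay P A n ζ := by linarith [stay_le_one hS A n ζ]
        calc (∑ σ, if σ ∈ A then μ σ * P σ ζ * (1 - stay P A n ζ) else 0)
            ≤ ∑ σ, P ζ σ * (μ ζ * (1 - stay P A n ζ)) := by
              refine Finset.sum_le_sum fun σ _ => ?_
              split_ifs
              · rw [hrev]; linarith
              · exact mul_nonneg (hP _ _) (mul_nonneg (hμ _) h0)
          _ = _ := by rw [← Finset.sum_mul, hP1, one_mul]
      · simp [hζ]
    push_cast
    linarith

end Chain

section Asymptotics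

variable {α : Type*} [Fintype α] {P : ℝ → α → α → ℝ}

lemma tendsto_exp_mul_atTop {a : ℝ} (ha : 0 < a) :
    Tendsto (fun β : ℝ => Real.exp (β * a)) atTop atTop :=
  Real.tendsto_exp_atTop.comp (tendsto_id.atTop_mul_const ha)

lemma tendsto_exp_mul_zero {a : ℝ} (ha : a < 0) :
    Tendsto (fun β : ℝ => Real.exp (β * a)) atTop (nhds 0) :=
  Real.tendsto_exp_atBot.comp (tendsto_id.atTop_mul_const_of_neg ha)

lemma floor_exp_mul_exp_le (β θ s : ℝ) :
    (⌊Real.exp (β * θ)⌋₊ : ℝ) * Real.exp (-β * s) ≤ Real.exp (β * (θ - s)) := by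
  calc (⌊Real.exp (β * θ)⌋₊ : ℝ) * Real.exp (-β * s)
      ≤ Real.exp (β * θ) * Real.exp (-β * s) :=
        mul_le_mul_of_nonneg_right (Nat.floor_le (Real.exp_pos _).le) (Real.exp_pos _).le
    _ = _ := by rw [← Real.exp_add]; ring_nf

/-- Over times of order `exp (β θ)`, events of probability `O(exp (-β s))` per step with `θ < s`
do not occur. -/
lemma eventually_exit_small {θ s C : ℝ} (hs : θ < s) (hC : 0 ≤ C) (m : ℕ) {κ : ℝ} (hκ : 0 < κ) :
    ∀ᶠ β : ℝ in atTop,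
      ((m * ⌊Real.exp (β * θ)⌋₊ : ℕ) : ℝ) * (C * Real.exp (-β * s)) ≤ κ := by
  have h := (tendsto_exp_mul_zero (a := θ - s) (by linarith)).const_mul (m * C)
  rw [mul_zero] at h
  filter_upwards [h.eventually (gt_mem_nhds hκ)] with β hβ
  refine le_trans ?_ hβ.le
  have := mul_le_mul_of_nonneg_left (floor_exp_mul_exp_le β θ s)
    (show (0 : ℝ) ≤ m * C by positivity)
  push_cast
  linarith

/-- Repeated trials of success probability `c * exp (-β r)` succeed within times of order
`exp (β θ)`, `θ > r`, provided the chain stays in `A`. -/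
lemma eventually_reach_of_trial (hP : ∀ β, IsStoch (P β)) {A A₀ D : Set α} {m : ℕ} {c r θ : ℝ}
    (hc : 0 < c) (hc1 : c ≤ 1) (hr : 0 ≤ r) (hθ : r < θ)
    (htrial : ∀ β, 0 < β → ∀ σ ∈ A, c * Real.exp (-β * r) ≤ reach (P β) A D m σ)
    (hstay : ∀ κ, 0 < κ → ∀ᶠ β in atTop, ∀ σ ∈ A₀,
      1 - κ ≤ stay (P β) A (m * ⌊Real.exp (β * θ)⌋₊) σ) {κ : ℝ} (hκ : 0 < κ) :
    ∀ᶠ β in atTop, ∀ σ ∈ A₀, 1 - κ ≤ reach (P β) A D (m * ⌊Real.exp (β * θ)⌋₊) σ := by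
  have h1 : Tendsto (fun β : ℝ => Real.exp (-(c * (Real.exp (β * (θ - r)) - 1)))) atTop
      (nhds 0) := by
    refine Real.tendsto_exp_atBot.comp (tendsto_neg_atTop_atBot.comp ?_)
    exact Tendsto.const_mul_atTop hc
      (tendsto_atTop_add_const_right _ (-1) (tendsto_exp_mul_atTop (by linarith)))
  filter_upwards [hstay (κ / 2) (by linarith), eventually_gt_atTop 0,
    h1.eventually (gt_mem_nhds (show (0 : ℝ) < κ / 2 by linarith))] with β h2 hβ h3 σ hσ
  have e1 : Real.exp (-β * r) ≤ 1 := Real.exp_le_one_iff.2 (by nlinarith)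
  have hp1 : c * Real.exp (-β * r) ≤ 1 := mul_le_one₀ hc1 (Real.exp_pos _).le e1
  have h4 := stay_sub_pow_le_reach (hP β) hp1 (htrial β hβ) ⌊Real.exp (β * θ)⌋₊ σ
  have h5 : (1 - c * Real.exp (-β * r)) ^ ⌊Real.exp (β * θ)⌋₊ ≤
      Real.exp (-(c * (Real.exp (β * (θ - r)) - 1))) := by
    calc (1 - c * Real.exp (-β * r)) ^ ⌊Real.exp (β * θ)⌋₊
        ≤ Real.exp (-(c * Real.exp (-β * r))) ^ ⌊Real.exp (β * θ)⌋₊ :=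
          pow_le_pow_left₀ (by linarith) (Real.one_sub_le_exp_neg _) _
      _ = Real.exp (⌊Real.exp (β * θ)⌋₊ * -(c * Real.exp (-β * r))) := by
          rw [← Real.exp_nat_mul]
      _ ≤ _ := by
          apply Real.exp_le_exp.2
          have h6 : Real.exp (β * θ) - 1 ≤ (⌊Real.exp (β * θ)⌋₊ : ℝ) := by
            linarith [Nat.lt_floor_add_one (Real.exp (β * θ))]
          have h7 := mul_le_mul_of_nonneg_left h6
            (mul_nonneg hc.le (Real.exp_pos (-β * r)).le)
          have h8 : Real.exp (-β * r) * Real.exp (β * θ) = Real.exp (β * (θ - r)) := by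
            rw [← Real.exp_add]; ring_nf
          have h9 := mul_le_mul_of_nonneg_left e1 hc.le
          have h10 : c * Real.exp (-β * r) * (Real.exp (β * θ) - 1) =
              c * Real.exp (β * (θ - r)) - c * Real.exp (-β * r) := by
            rw [← h8]; ring
          linarith
  have h6 := h2 σ hσ
  linarith

/-- From every state of `A`, with probability tending to one the chain reaches `D` through `G`
within a time of order `exp (β θ)`. -/
def Reaches (P : ℝ → α → α → ℝ) (G A D : Set α) (θ : ℝ) : Prop :=
  ∃ m : ℕ, ∀ κ, 0 < κ → ∀ᶠ β in atTop, ∀ σ ∈ A,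
    1 - κ ≤ reach (P β) G D (m * ⌊Real.exp (β * θ)⌋₊) σ

lemma Reaches.of_subset {G A D : Set α} {θ : ℝ} (h : A ⊆ D) : Reaches P G A D θ :=
  ⟨0, fun κ hκ => Eventually.of_forall fun β σ hσ => by
    rw [reach_of_mem (h hσ)]; linarith⟩

lemma Reaches.trans (hP : ∀ β, IsStoch (P β)) {G A D E : Set α} {θ : ℝ}
    (h₁ : Reaches P G A D θ) (h₂ : Reaches P G D E θ) : Reaches P G A E θ := by
  obtain ⟨m₁, h₁⟩ := h₁
  obtain ⟨m₂, h₂⟩ := h₂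
  refine ⟨m₁ + m₂, fun κ hκ => ?_⟩
  set κ' := min (κ / 2) 1 with hκ'
  have k0 : 0 < κ' := lt_min (by linarith) one_pos
  have k1 : κ' ≤ κ / 2 := min_le_left _ _
  have k2 : κ' ≤ 1 := min_le_right _ _
  filter_upwards [h₁ κ' k0, h₂ κ' k0] with β hβ₁ hβ₂ σ hσ
  have := reach_comp (hP β) (by linarith) hβ₂ (m₁ * ⌊Real.exp (β * θ)⌋₊) σ
  rw [← add_mul] at this
  refine le_trans ?_ this
  have h3 := mul_le_mul_of_nonneg_left (hβ₁ σ hσ) (show 0 ≤ 1 - κ' by linarith)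
  nlinarith [sq_nonneg κ']

lemma Reaches.mono (hP : ∀ β, IsStoch (P β)) {G G' A A' D : Set α} {θ : ℝ}
    (h : Reaches P G A D θ) (hG : G ⊆ G' ∪ D) (hA : A' ⊆ A) : Reaches P G' A' D θ := by
  obtain ⟨m, h⟩ := h
  refine ⟨m, fun κ hκ => ?_⟩
  filter_upwards [h κ hκ] with β hβ σ hσ
  exact (hβ σ (hA hσ)).trans (reach_mono (hP β) hG _ _)

lemma Reaches.of_trial (hP : ∀ β, IsStoch (P β)) {A A₀ D : Set α} {m : ℕ} {c r θ : ℝ}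
    (hc : 0 < c) (hc1 : c ≤ 1) (hr : 0 ≤ r) (hθ : r < θ)
    (htrial : ∀ β, 0 < β → ∀ σ ∈ A, c * Real.exp (-β * r) ≤ reach (P β) A D m σ)
    (hstay : ∀ κ, 0 < κ → ∀ᶠ β in atTop, ∀ σ ∈ A₀,
      1 - κ ≤ stay (P β) A (m * ⌊Real.exp (β * θ)⌋₊) σ) : Reaches P A A₀ D θ :=
  ⟨m, fun _ hκ => eventually_reach_of_trial hP hc hc1 hr hθ htrial hstay hκ⟩

end Asymptotics

section FirstHit

variable {L : ℕ} [NeZero L]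

lemma firstHitP_zero (β h : ℝ) (σ : Config L) (E F : Set (Config L)) :
    firstHitP β h σ E F 0 = if σ ∈ E ∩ F then 1 else 0 := by
  unfold firstHitP
  rw [← (Equiv.funUnique (Fin 1) (Config L)).symm.sum_comp]
  by_cases hσ : σ ∈ E ∩ F
  · rw [Finset.sum_eq_single σ]
    · simp
    · intro b _ hb
      rw [if_neg]
      rintro ⟨h1, -⟩
      exact hb (by simpa using h1)
    · simp
  · rw [if_neg hσ]
    refine Finset.sum_eq_zero fun τ _ => if_neg ?_
    rintro ⟨h1, -, h2⟩
    refine hσ ?_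
    rw [← h1]
    simpa using h2

lemma firstHitP_succ (β h : ℝ) (σ : Config L) (E F : Set (Config L)) (n : ℕ) :
    firstHitP β h σ E F (n + 1) =
      if σ ∈ E then 0 else ∑ ζ, Pmat β h σ ζ * firstHitP β h ζ E F n := by
  have key : firstHitP β h σ E F (n + 1) =
      ∑ g : Fin (n + 1) → Config L, if σ ∈ E then 0 else
        Pmat β h σ (g 0) * (if (∀ i : Fin (n + 1), (i : ℕ) < n → g i ∉ E) ∧
          g (Fin.last n) ∈ E ∩ F then ∏ i : Fin n, Pmat β h (g i.castSucc) (g i.succ) else 0) := by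
    rw [firstHitP, ← (Fin.consEquiv (fun _ : Fin (n + 2) => Config L)).sum_comp,
      Fintype.sum_prod_type, Finset.sum_eq_single σ]
    · refine Finset.sum_congr rfl fun g _ => ?_
      simp only [Fin.consEquiv, Equiv.coe_fn_mk, Fin.cons_zero, true_and, Fin.forall_fin_succ
        (P := fun i : Fin (n + 2) => (i : ℕ) < n + 1 → _), ← Fin.succ_last, Fin.cons_succ,
        Fin.prod_univ_succ, Fin.castSucc_zero, Fin.val_zero, Fin.val_succ, Fin.castSucc_succ]
      by_cases hE : σ ∈ E
      · simp [hE]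
      · simp only [hE, not_false_eq_true, if_false, Nat.succ_pos, true_implies, true_and,
          Nat.add_lt_add_iff_right, mul_ite, mul_zero]
    · intro τ _ hτ
      refine Finset.sum_eq_zero fun g _ => if_neg ?_
      rintro ⟨h1, -⟩
      exact hτ (by simpa [Fin.consEquiv] using h1)
    · simp
  rw [key]
  by_cases hE : σ ∈ E
  · simp [hE]
  simp only [hE, if_false, firstHitP, Finset.mul_sum]
  rw [Finset.sum_comm]
  refine Finset.sum_congr rfl fun g _ => ?_
  rw [Finset.sum_eq_single (g 0)]
  · simp
  · intro ζ _ hζ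
    rw [if_neg, mul_zero]
    rintro ⟨h1, -⟩
    exact hζ h1.symm
  · simp

lemma sum_firstHitP (β h : ℝ) (E F : Set (Config L)) (n : ℕ) (σ : Config L) :
    ∑ m ∈ Finset.range (n + 1), firstHitP β h σ E F m =
      reach (Pmat β h) Eᶜ (E ∩ F) n σ := by
  induction n generalizing σ with
  | zero =>
    simp only [zero_add, Finset.sum_range_one, firstHitP_zero, reach]
    split_ifs <;> rfl
  | succ n ih =>
    rw [Finset.sum_range_succ', firstHitP_zero]
    simp only [firstHitP_succ, reach]
    by_cases hE : σ ∈ E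
    · by_cases hF : σ ∈ F <;> simp [hE, hF]
    · simp only [hE, if_false, Set.mem_inter_iff, false_and, Set.mem_compl_iff, not_false_eq_true,
        if_true, add_zero]
      rw [Finset.sum_comm]
      refine Finset.sum_congr rfl fun ζ _ => ?_
      rw [← ih ζ, Finset.mul_sum]

end FirstHit

section SingleSite

variable {L : ℕ}

lemma flipP_pos (β h : ℝ) (σ : Config L) (x : Site L) (a : Bool) : 0 < flipP β h σ x a := by
  unfold flipP; positivity

lemma flipP_le_one (β h : ℝ) (σ : Config L) (x : Site L) (a : Bool) : flipP β h σ x a ≤ 1 := by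
  unfold flipP
  rw [div_le_one (by positivity)]
  linarith [Real.exp_pos (-2 * β * spin a * (nnS σ x + h))]

lemma flipP_add (β h : ℝ) (σ : Config L) (x : Site L) :
    flipP β h σ x true + flipP β h σ x false = 1 := by
  unfold flipP spin
  have e : Real.exp (-2 * β * (if false = true then 1 else -1) * (nnS σ x + h)) =
      (Real.exp (-2 * β * (if true = true then 1 else -1) * (nnS σ x + h)))⁻¹ := by
    rw [← Real.exp_neg]; simp
  rw [e]
  have := Real.exp_pos (-2 * β * (if true = true then 1 else -1) * (nnS σ x + h))
  field_simp
  ring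

lemma sum_flipP (β h : ℝ) (σ : Config L) (x : Site L) : ∑ a, flipP β h σ x a = 1 := by
  rw [Fintype.sum_bool, flipP_add]

lemma flipP_le_exp (β h : ℝ) (σ : Config L) (x : Site L) (a : Bool) :
    flipP β h σ x a ≤ Real.exp (2 * β * (spin a * (nnS σ x + h))) := by
  unfold flipP
  rw [div_le_iff₀ (by positivity), mul_add, ← Real.exp_add,
    show 2 * β * (spin a * (nnS σ x + h)) + -2 * β * spin a * (nnS σ x + h) = 0 by ring,
    Real.exp_zero]
  linarith [Real.exp_pos (2 * β * (spin a * (nnS σ x + h)))]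

lemma le_flipP {β h κ : ℝ} (hβ : 0 < β) (hκ : 0 ≤ κ) {σ : Config L} {x : Site L} {a : Bool}
    (hx : -κ ≤ spin a * (nnS σ x + h)) :
    1 / 2 * Real.exp (-β * (2 * κ)) ≤ flipP β h σ x a := by
  unfold flipP
  have h1 : Real.exp (-2 * β * spin a * (nnS σ x + h)) ≤ Real.exp (β * (2 * κ)) :=
    Real.exp_le_exp.2 (by nlinarith)
  have h2 : 1 ≤ Real.exp (β * (2 * κ)) := Real.one_le_exp (by positivity)
  rw [neg_mul, Real.exp_neg, le_div_iff₀ (by positivity)]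
  rw [mul_assoc, ← div_eq_inv_mul, mul_div_assoc', div_le_one (by positivity)]
  linarith

lemma spin_T_mul_nonneg (h : ℝ) (σ : Config L) (x : Site L) :
    0 ≤ spin (T h σ x) * (nnS σ x + h) := by
  unfold T spin
  by_cases hx : 0 < nnS σ x + h <;> simp [hx]
  · exact hx.le
  · linarith

lemma half_le_flipP_T {β h : ℝ} (hβ : 0 < β) (σ : Config L) (x : Site L) :
    1 / 2 ≤ flipP β h σ x (T h σ x) := by
  simpa using le_flipP (κ := 0) hβ le_rfl (by simpa using spin_T_mul_nonneg h σ x)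

end SingleSite

section Kernel

variable {L : ℕ} [NeZero L]

lemma isStoch_Pmat (β h : ℝ) : IsStoch (Pmat β h (L := L)) := by
  refine ⟨fun σ ζ => Finset.prod_nonneg fun _ _ => (flipP_pos ..).le, fun σ => ?_⟩
  unfold Pmat
  have := Finset.prod_univ_sum (κ := fun _ : Site L => Bool) (fun _ => Finset.univ)
    (fun x b => flipP β h σ x b)
  rw [Fintype.piFinset_univ] at this
  rw [← this]
  exact Finset.prod_eq_one fun _ _ => sum_flipP ..

lemma Pmat_le_one (β h : ℝ) (σ ζ : Config L) : Pmat β h σ ζ ≤ 1 :=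
  Finset.prod_le_one (fun _ _ => (flipP_pos ..).le) fun _ _ => flipP_le_one ..

lemma sum_Pmat_marginal (β h : ℝ) (σ : Config L) (x : Site L) (b : Bool) :
    ∑ ζ, Pmat β h σ ζ * (if ζ x = b then 1 else 0) = flipP β h σ x b := by
  have := Finset.prod_univ_sum (κ := fun _ : Site L => Bool) (fun _ => Finset.univ)
    (fun y a => flipP β h σ y a * (if y = x then (if a = b then 1 else 0) else 1))
  rw [Fintype.piFinset_univ] at this
  simp only [Finset.prod_mul_distrib, Finset.prod_ite_eq', Finset.mem_univ, if_true] at this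
  unfold Pmat
  rw [← this, Finset.prod_eq_single x]
  · cases b <;> simp
  · intro y _ hy
    simp only [hy, if_false, mul_one]
    exact sum_flipP ..
  · simp

/-- One step leaves `A` with probability at most `|Λ| δ` if this requires a deviation of
probability at most `δ` at some site. -/
lemma exit_le {β h δ : ℝ} (hδ : 0 ≤ δ) {σ : Config L} {A : Set (Config L)} (t : Config L)
    (X : Site L → Prop) (hA : ∀ ζ : Config L, (∀ x, X x → ζ x = t x) → ζ ∈ A)
    (hX : ∀ x, X x → flipP β h σ x (!(t x)) ≤ δ) :
    ∑ ζ, Pmat β h σ ζ * (if ζ ∈ A then 0 else 1) ≤ Fintype.card (Site L) * δ := by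
  have h1 : ∀ ζ : Config L, (if ζ ∈ A then (0 : ℝ) else 1) ≤
      ∑ x : Site L, if X x then (if ζ x = !(t x) then 1 else 0) else 0 := by
    intro ζ
    split_ifs with hζ
    · exact Finset.sum_nonneg fun x _ => by split_ifs <;> norm_num
    · have : ∃ x, X x ∧ ζ x ≠ t x := by
        by_contra hne
        push Not at hne
        exact hζ (hA ζ hne)
      obtain ⟨x, hx, hne⟩ := this
      have h2 := Finset.single_le_sum
        (f := fun x : Site L => if X x then (if ζ x = !(t x) then (1 : ℝ) else 0) else 0)
        (fun x _ => by split_ifs <;> norm_num) (Finset.mem_univ x)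
      have h3 : ζ x = !(t x) := by
        cases h4 : ζ x <;> cases h5 : t x <;> simp_all
      simpa [hx, h3] using h2
  refine ((isStoch_Pmat β h).sum_mul_mono h1 σ).trans ?_
  simp only [Finset.mul_sum]
  rw [Finset.sum_comm]
  calc _ ≤ ∑ x : Site L, δ := by
        refine Finset.sum_le_sum fun x _ => ?_
        by_cases hx : X x
        · simp only [hx, if_true]
          rw [sum_Pmat_marginal]
          exact hX x hx
        · simpa [hx] using hδ
    _ = _ := by simp

lemma le_Pmat_T {β h : ℝ} (hβ : 0 < β) (σ : Config L) :
    (1 / 2 : ℝ) ^ Fintype.card (Site L) ≤ Pmat β h σ (T h σ) := by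
  unfold Pmat
  rw [← Finset.card_univ, ← Finset.prod_const]
  exact Finset.prod_le_prod (fun _ _ => by norm_num) fun x _ => half_le_flipP_T hβ σ x

lemma le_Pmat_update {β h κ : ℝ} (hβ : 0 < β) (hκ : 0 ≤ κ) {σ : Config L} {x : Site L} {a : Bool}
    (hx : -κ ≤ spin a * (nnS σ x + h)) :
    (1 / 2 : ℝ) ^ Fintype.card (Site L) * Real.exp (-β * (2 * κ)) ≤
      Pmat β h σ (Function.update (T h σ) x a) := by
  unfold Pmat
  have e : (1 / 2 : ℝ) ^ Fintype.card (Site L) * Real.exp (-β * (2 * κ)) =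
      ∏ y : Site L, 1 / 2 * (if y = x then Real.exp (-β * (2 * κ)) else 1) := by
    rw [Finset.prod_mul_distrib, Finset.prod_const, Finset.card_univ, Finset.prod_ite_eq']
    simp
  rw [e]
  refine Finset.prod_le_prod (fun y _ => by positivity) fun y _ => ?_
  by_cases hy : y = x
  · subst hy
    simpa using le_flipP hβ hκ hx
  · simpa [hy] using half_le_flipP_T hβ σ y

end Kernel

section HittingProbabilities

variable {L : ℕ} [NeZero L]

lemma firstHitP_nonneg (β h : ℝ) (σ : Config L) (E F : Set (Config L)) (n : ℕ) :
    0 ≤ firstHitP β h σ E F n := by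
  refine Finset.sum_nonneg fun f _ => ?_
  split_ifs
  · exact Finset.prod_nonneg fun i _ => (isStoch_Pmat β h).nonneg _ _
  · exact le_rfl

lemma sum_range_firstHitP_le_one (β h : ℝ) (σ : Config L) (E F : Set (Config L)) (n : ℕ) :
    ∑ m ∈ Finset.range n, firstHitP β h σ E F m ≤ 1 := by
  cases n with
  | zero => simp
  | succ n => rw [sum_firstHitP]; exact reach_le_one (isStoch_Pmat β h) _ _ _ _

lemma summable_firstHitP (β h : ℝ) (σ : Config L) (E F : Set (Config L)) :
    Summable (firstHitP β h σ E F) :=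
  summable_of_sum_range_le (firstHitP_nonneg β h σ E F) (sum_range_firstHitP_le_one β h σ E F)

lemma probHitBefore_le_one (β h : ℝ) (σ : Config L) (A B : Set (Config L)) :
    probHitBefore β h σ A B ≤ 1 :=
  Real.tsum_le_of_sum_range_le (firstHitP_nonneg β h σ _ _) (sum_range_firstHitP_le_one β h σ _ _)

lemma reach_le_probHitBefore (β h : ℝ) (σ : Config L) {A B : Set (Config L)} (hAB : Disjoint A B)
    (n : ℕ) : reach (Pmat β h) Bᶜ A n σ ≤ probHitBefore β h σ A B := by
  have e : (A ∪ B) ∩ (A \ B) = A := by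
    rw [hAB.sdiff_eq_left]; exact Set.inter_eq_right.2 Set.subset_union_left
  have h1 : reach (Pmat β h) Bᶜ A n σ ≤ reach (Pmat β h) (A ∪ B)ᶜ ((A ∪ B) ∩ (A \ B)) n σ := by
    rw [e]
    refine reach_mono (isStoch_Pmat β h) (fun ζ hζ => ?_) n σ
    by_cases h : ζ ∈ A
    · exact Or.inr h
    · exact Or.inl fun h' => h'.elim h hζ
  refine h1.trans ?_
  rw [← sum_firstHitP]
  exact (summable_firstHitP β h σ _ _).sum_le_tsum _ fun m _ => firstHitP_nonneg ..

lemma probTauIn_le_one (β h : ℝ) (σ : Config L) (D : Set (Config L)) (I : Set ℝ) :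
    probTauIn β h σ D I ≤ 1 := by
  refine Real.tsum_le_of_sum_range_le (fun n => ?_) fun n => ?_
  · split_ifs
    · exact firstHitP_nonneg ..
    · exact le_rfl
  · refine le_trans (Finset.sum_le_sum fun m _ => ?_)
      (sum_range_firstHitP_le_one β h σ D Set.univ n)
    split_ifs
    · exact le_rfl
    · exact firstHitP_nonneg ..

lemma reach_sub_reach_le_probTauIn (β h : ℝ) (σ : Config L) (D : Set (Config L)) {I : Set ℝ}
    {n m : ℕ} (hI : ∀ i : ℕ, n < i → i ≤ m → (i : ℝ) ∈ I) :
    reach (Pmat β h) Dᶜ D m σ - reach (Pmat β h) Dᶜ D n σ ≤ probTauIn β h σ D I := by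
  have hnn : ∀ i : ℕ, 0 ≤ if (i : ℝ) ∈ I then firstHitP β h σ D Set.univ i else 0 := by
    intro i
    split_ifs
    · exact firstHitP_nonneg ..
    · exact le_rfl
  have hs : Summable fun i : ℕ => if (i : ℝ) ∈ I then firstHitP β h σ D Set.univ i else 0 := by
    refine (summable_firstHitP β h σ D Set.univ).of_nonneg_of_le hnn fun i => ?_
    split_ifs
    · exact le_rfl
    · exact firstHitP_nonneg ..
  rcases le_total m n with hmn | hmn
  · have := reach_mono_time (isStoch_Pmat β h) Dᶜ D σ hmn
    have h2 : 0 ≤ probTauIn β h σ D I := tsum_nonneg hnn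
    dsimp only at this
    linarith
  have e : ∀ i, reach (Pmat β h) Dᶜ D i σ =
      ∑ j ∈ Finset.range (i + 1), firstHitP β h σ D Set.univ j := by
    intro i
    rw [sum_firstHitP, Set.inter_univ]
  rw [e, e, ← Finset.sum_Ico_eq_sub _ (by omega)]
  refine le_trans (le_of_eq (Finset.sum_congr rfl fun i hi => ?_))
    (hs.sum_le_tsum (Finset.Ico (n + 1) (m + 1)) fun i _ => hnn i)
  rw [Finset.mem_Ico] at hi
  rw [if_pos (hI i (by omega) (by omega))]

/-- A two-sided estimate on a hitting time in terms of `reach`. -/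
lemma tendsto_probTauIn {h r : ℝ} {σ : Config L} {D : Set (Config L)}
    (hupper : ∀ ε, 0 < ε → ∃ θ, θ < r + ε ∧ Reaches (fun β => Pmat β h) Dᶜ {σ} D θ)
    (hlower : ∀ ε, 0 < ε → ∀ κ, 0 < κ → ∀ᶠ β : ℝ in atTop,
      reach (Pmat β h) Dᶜ D ⌊Real.exp (β * (r - ε))⌋₊ σ ≤ κ) {ε : ℝ} (hε : 0 < ε) :
    Tendsto (fun β : ℝ => probTauIn β h σ D
      (Set.Ioo (Real.exp (β * (r - ε))) (Real.exp (β * (r + ε))))) atTop (nhds 1) := by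
  obtain ⟨θ, hθ, m, hm⟩ := hupper ε hε
  refine tendsto_order.2 ⟨fun q hq => ?_, fun q hq => Eventually.of_forall fun β =>
    (probTauIn_le_one ..).trans_lt hq⟩
  have hs := eventually_exit_small (θ := θ) (s := r + ε) hθ zero_le_one m
    (show (0 : ℝ) < 1 / 2 by norm_num)
  filter_upwards [hm ((1 - q) / 3) (by linarith), hlower ε hε ((1 - q) / 3) (by linarith), hs]
    with β h1 h2 h3
  have h4 := reach_sub_reach_le_probTauIn β h σ D
    (I := Set.Ioo (Real.exp (β * (r - ε))) (Real.exp (β * (r + ε))))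
    (n := ⌊Real.exp (β * (r - ε))⌋₊) (m := m * ⌊Real.exp (β * θ)⌋₊) (fun i hi hi' => ⟨?_, ?_⟩)
  · have := h1 σ rfl
    linarith
  · exact (Nat.floor_lt (Real.exp_pos _).le).1 hi
  · have h5 : (i : ℝ) ≤ ((m * ⌊Real.exp (β * θ)⌋₊ : ℕ) : ℝ) := by exact_mod_cast hi'
    rw [one_mul, neg_mul, Real.exp_neg, ← div_eq_mul_inv, div_le_iff₀ (Real.exp_pos _)] at h3
    linarith [Real.exp_pos (β * (r + ε))]

lemma tendsto_probHitBefore {h θ : ℝ} {σ : Config L} {A B : Set (Config L)} (hAB : Disjoint A B)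
    (hr : Reaches (fun β => Pmat β h) Bᶜ {σ} A θ) :
    Tendsto (fun β : ℝ => probHitBefore β h σ A B) atTop (nhds 1) := by
  obtain ⟨m, hm⟩ := hr
  refine tendsto_order.2 ⟨fun q hq => ?_, fun q hq => Eventually.of_forall fun β =>
    (probHitBefore_le_one ..).trans_lt hq⟩
  filter_upwards [hm ((1 - q) / 2) (by linarith)] with β h1
  have := h1 σ rfl
  have := reach_le_probHitBefore β h σ hAB (m * ⌊Real.exp (β * θ)⌋₊)
  linarith

end HittingProbabilities

section Lattice

variable {L : ℕ}

/-- The pairs of lattice directions `(east, north)` and `(north, east)`. -/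
def IsAxes (v w : Site L) : Prop :=
  (v = east L ∧ w = north L) ∨ (v = north L ∧ w = east L)

lemma IsAxes.nnS_eq {v w : Site L} (hvw : IsAxes v w) (σ : Config L) (x : Site L) :
    nnS σ x = spin (σ (x + v)) + spin (σ (x - v)) + (spin (σ (x + w)) + spin (σ (x - w))) := by
  rcases hvw with ⟨rfl, rfl⟩ | ⟨rfl, rfl⟩ <;> unfold nnS <;> ring

lemma isAxes_en : IsAxes (east L) (north L) := Or.inl ⟨rfl, rfl⟩

lemma isAxes_ne : IsAxes (north L) (east L) := Or.inr ⟨rfl, rfl⟩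

lemma IsAxes.adj {v w : Site L} (hvw : IsAxes v w) (x : Site L) :
    Adj x (x + v) ∧ Adj x (x - v) ∧ Adj x (x + w) ∧ Adj x (x - w) := by
  rcases hvw with ⟨rfl, rfl⟩ | ⟨rfl, rfl⟩ <;> simp [Adj]

lemma Adj.exists_intCast {x y : Site L} (hxy : Adj x y) :
    ∃ u v : ℤ, u ^ 2 + v ^ 2 = 1 ∧ y = x + ((u : ZMod L), (v : ZMod L)) := by
  rcases hxy with rfl | rfl | rfl | rfl
  · exact ⟨1, 0, by norm_num, by ext <;> simp [east]⟩
  · exact ⟨-1, 0, by norm_num, by ext <;> simp [east, sub_eq_add_neg]⟩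
  · exact ⟨0, 1, by norm_num, by ext <;> simp [north]⟩
  · exact ⟨0, -1, by norm_num, by ext <;> simp [north, sub_eq_add_neg]⟩

lemma Adj.closeDiff {x y : Site L} (hxy : Adj x y) : closeDiff (y - x) := by
  obtain ⟨u, v, huv, rfl⟩ := hxy.exists_intCast
  exact ⟨u, v, by omega, by simp⟩

lemma Adj.closeDiff_of_adj {x y z : Site L} (hxy : Adj x y) (hxz : Adj x z) :
    PCA.closeDiff (z - y) := by
  obtain ⟨u, v, huv, rfl⟩ := hxy.exists_intCast
  obtain ⟨u', v', huv', rfl⟩ := hxz.exists_intCast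
  refine ⟨u' - u, v' - v, ?_, ?_⟩
  · nlinarith [sq_nonneg (u + u'), sq_nonneg (v + v')]
  · ext <;> simp

lemma spin_mono {a b : Bool} (hab : a = true → b = true) : spin a ≤ spin b := by
  unfold spin
  cases a <;> cases b <;> simp_all

lemma neg_one_le_spin (a : Bool) : -1 ≤ spin a := by unfold spin; split_ifs <;> norm_num

lemma spin_le_one (a : Bool) : spin a ≤ 1 := by unfold spin; split_ifs <;> norm_num

@[simp] lemma spin_true : spin true = 1 := rfl

@[simp] lemma spin_false : spin false = -1 := by simp [spin]

/-- The pointwise order on configurations. -/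
def Below (σ τ : Config L) : Prop := ∀ x, σ x = true → τ x = true

lemma Below.trans {σ τ ζ : Config L} (h₁ : Below σ τ) (h₂ : Below τ ζ) : Below σ ζ :=
  fun x hx => h₂ x (h₁ x hx)

lemma Below.nnS_le {σ τ : Config L} (hστ : Below σ τ) (x : Site L) : nnS σ x ≤ nnS τ x := by
  unfold nnS
  linarith [spin_mono (hστ (x + east L)), spin_mono (hστ (x - east L)),
    spin_mono (hστ (x + north L)), spin_mono (hστ (x - north L))]

lemma T_eq_true_iff {h : ℝ} {σ : Config L} {x : Site L} : T h σ x = true ↔ 0 < nnS σ x + h := by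
  simp [T]

lemma T_eq_true {h : ℝ} (h0 : 0 < h) {σ : Config L} {x : Site L} (hx : 0 ≤ nnS σ x) :
    T h σ x = true := T_eq_true_iff.2 (by linarith)

lemma T_eq_false {h : ℝ} (h2 : h < 2) {σ : Config L} {x : Site L} (hx : nnS σ x ≤ -2) :
    T h σ x = false := by
  rw [← Bool.not_eq_true, T_eq_true_iff]; linarith

lemma Below.drift {h : ℝ} {σ τ : Config L} (hστ : Below σ τ) : Below (T h σ) (T h τ) := by
  intro x hx
  rw [T_eq_true_iff] at hx ⊢
  linarith [hστ.nnS_le x]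

lemma IsAxes.nnS_nonneg {v w : Site L} (hvw : IsAxes v w) {σ : Config L} {x : Site L}
    (hv : σ (x + v) = true ∨ σ (x - v) = true) (hw : σ (x + w) = true ∨ σ (x - w) = true) :
    0 ≤ nnS σ x := by
  rw [hvw.nnS_eq]
  have h1 := neg_one_le_spin (σ (x + v))
  have h2 := neg_one_le_spin (σ (x - v))
  have h3 := neg_one_le_spin (σ (x + w))
  have h4 := neg_one_le_spin (σ (x - w))
  rcases hv with hv | hv <;> rcases hw with hw | hw <;> rw [hv, hw] at * <;>
    simp only [spin_true] at * <;> linarith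

lemma nnS_eq_four {σ : Config L} {x : Site L} (hx : ∀ y, Adj x y → σ y = true) :
    nnS σ x = 4 := by
  obtain ⟨h1, h2, h3, h4⟩ := isAxes_en.adj x
  rw [isAxes_en.nnS_eq, hx _ h1, hx _ h2, hx _ h3, hx _ h4]
  norm_num

lemma IsChessCfg.not {D : Config L} (hD : IsChessCfg D) : IsChessCfg fun x => !D x := by
  rcases hD with rfl | rfl
  · exact Or.inr rfl
  · left; ext x; simp [chessO]

lemma isChessCfg_iff {D : Config L} : IsChessCfg D ↔ D ∈ chessSet L := by
  simp [IsChessCfg, chessSet]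

lemma rect_mono {c : Site L} {a b a' b' : ℕ} (ha : a' ≤ a) (hb : b' ≤ b) :
    rect c a' b' ⊆ rect c a b := by
  rintro x ⟨i, j, hi, hj, rfl⟩
  exact ⟨i, j, by omega, by omega, rfl⟩

end Lattice

section Chess

variable {L : ℕ} [NeZero L]

lemma chessE_eq (hL : Even L) (x : Site L) :
    chessE L x = decide (ZMod.castHom hL.two_dvd (ZMod 2) (x.1 + x.2) = 0) := by
  unfold chessE
  congr 1
  rw [ZMod.castHom_apply, ← ZMod.natCast_val, ZMod.natCast_eq_zero_iff, Nat.dvd_iff_mod_eq_zero]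

lemma chessE_of_adj (hL : Even L) {x y : Site L} (hxy : Adj x y) :
    chessE L y = !chessE L x := by
  have key : ∀ t : ZMod 2, decide (t + 1 = 0) = !decide (t = 0) := by decide
  have key' : ∀ t : ZMod 2, decide (t - 1 = 0) = !decide (t = 0) := by decide
  rw [chessE_eq hL, chessE_eq hL]
  set φ := ZMod.castHom hL.two_dvd (ZMod 2)
  rcases hxy with rfl | rfl | rfl | rfl
  · rw [← key, ← map_one φ, ← map_add]
    simp only [east, Prod.fst_add, Prod.snd_add, add_zero, add_right_comm]
  · rw [← key', ← map_one φ, ← map_sub]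
    simp only [east, Prod.fst_sub, Prod.snd_sub, sub_zero, sub_add_eq_add_sub]
  · rw [← key, ← map_one φ, ← map_add]
    simp only [north, Prod.fst_add, Prod.snd_add, add_zero, add_assoc]
  · rw [← key', ← map_one φ, ← map_sub]
    simp only [north, Prod.fst_sub, Prod.snd_sub, sub_zero, add_sub_assoc]

lemma IsChessCfg.of_adj (hL : Even L) {D : Config L} (hD : IsChessCfg D) {x y : Site L}
    (hxy : Adj x y) : D y = !D x := by
  rcases hD with rfl | rfl
  · exact chessE_of_adj hL hxy
  · simp [chessO, chessE_of_adj hL hxy]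

end Chess

section Rectangles

variable {L : ℕ} [NeZero L]

lemma mem_rect_iff {c x : Site L} {a b : ℕ} (ha : a ≤ L) (hb : b ≤ L) :
    x ∈ rect c a b ↔ (x - c).1.val < a ∧ (x - c).2.val < b := by
  constructor
  · rintro ⟨i, j, hi, hj, rfl⟩
    simp only [add_sub_cancel_left]
    rw [ZMod.val_cast_of_lt (by omega), ZMod.val_cast_of_lt (by omega)]
    exact ⟨hi, hj⟩
  · rintro ⟨h1, h2⟩
    refine ⟨_, _, h1, h2, ?_⟩
    ext <;> simp

lemma val_lt_of_val_add_sub {d : ZMod L} {a : ℕ} (ha : a + 2 ≤ L) (h1 : (d + 1).val < a)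
    (h2 : (d - 1).val < a) : d.val < a := by
  have hL : 1 < L := by omega
  have : Fact (1 < L) := ⟨hL⟩
  by_contra hd
  have e1 := ZMod.val_add d 1
  rw [ZMod.val_one] at e1
  have hlt := ZMod.val_lt d
  by_cases h : d.val + 1 < L
  · rw [Nat.mod_eq_of_lt h] at e1; omega
  · have e2 : (d - 1).val = d.val - 1 := by
      rw [ZMod.val_sub, ZMod.val_one]
      rw [ZMod.val_one]; omega
    omega

/-- A site outside a rectangle has at most one neighbour inside. -/
lemma adj_unique_of_notMem_rect {c x y z : Site L} {a b : ℕ} (ha : a + 2 ≤ L) (hb : b + 2 ≤ L)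
    (hx : x ∉ rect c a b) (hxy : Adj x y) (hxz : Adj x z) (hy : y ∈ rect c a b)
    (hz : z ∈ rect c a b) : y = z := by
  rw [mem_rect_iff (by omega) (by omega)] at hx hy hz
  have key := fun h => val_lt_of_val_add_sub (d := (x - c).1) ha h
  have key' := fun h => val_lt_of_val_add_sub (d := (x - c).2) hb h
  rcases hxy with rfl | rfl | rfl | rfl <;> rcases hxz with rfl | rfl | rfl | rfl <;>
    first
    | rfl
    | (exfalso
       simp only [east, north, Prod.fst_sub, Prod.snd_sub, Prod.fst_add, Prod.snd_add, add_zero,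
        sub_zero, add_sub_right_comm, sub_right_comm _ (1 : ZMod L)] at *
       tauto)

end Rectangles

section Regions

variable {L : ℕ}

/-- Sites outside `ℜ` have at most one neighbour in `ℜ`. -/
def Sparse (ℜ : Set (Site L)) : Prop :=
  ∀ x, x ∉ ℜ → ∀ y z, Adj x y → Adj x z → y ∈ ℜ → z ∈ ℜ → y = z

variable {k : ℕ} {c : Fin k → Site L} {a b a' b' : Fin k → ℕ}

lemma notMem_iUnion_rect (hNI : ∀ i j, i ≠ j →
      NonInteracting (rect (c i) (a i) (b i)) (rect (c j) (a j) (b j)))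
    (ha : ∀ i, a' i ≤ a i) (hb : ∀ i, b' i ≤ b i) {x y : Site L} {i : Fin k}
    (hx : x ∈ rect (c i) (a' i) (b' i)) (hxy : Adj x y) (hy : y ∉ rect (c i) (a' i) (b' i)) :
    y ∉ ⋃ j, rect (c j) (a' j) (b' j) := by
  rw [Set.mem_iUnion]
  rintro ⟨j, hj⟩
  by_cases hij : i = j
  · subst hij; exact hy hj
  · exact hNI i j hij x (rect_mono (ha i) (hb i) hx) y (rect_mono (ha j) (hb j) hj) hxy.closeDiff

lemma sparse_iUnion_rect [NeZero L] (hNI : ∀ i j, i ≠ j →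
      NonInteracting (rect (c i) (a i) (b i)) (rect (c j) (a j) (b j)))
    (ha : ∀ i, a' i ≤ a i) (hb : ∀ i, b' i ≤ b i) (hL : ∀ i, a i + 2 ≤ L ∧ b i + 2 ≤ L) :
    Sparse (⋃ j, rect (c j) (a' j) (b' j)) := by
  intro x hx y z hxy hxz hy hz
  rw [Set.mem_iUnion] at hy hz
  obtain ⟨i, hi⟩ := hy
  obtain ⟨j, hj⟩ := hz
  by_cases hij : i = j
  · subst hij
    have h1 := ha i
    have h2 := hb i
    have h3 := hL i
    exact adj_unique_of_notMem_rect (by omega) (by omega)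
      (fun h => hx (Set.mem_iUnion_of_mem _ h)) hxy hxz hi hj
  · exact absurd (hxy.closeDiff_of_adj hxz)
      (hNI i j hij y (rect_mono (ha i) (hb i) hi) z (rect_mono (ha j) (hb j) hj))

end Regions

section Upper

variable {L : ℕ}

lemma nnS_le_neg_two (hL : 2 < L) {σ : Config L} {x : Site L}
    (hx : ∀ y z, Adj x y → Adj x z → σ y = true → σ z = true → y = z) : nnS σ x ≤ -2 := by
  have : Fact (1 < L) := ⟨by omega⟩
  have h2 : (1 : ZMod L) + 1 ≠ 0 := by
    have : ((2 : ℕ) : ZMod L) ≠ 0 := by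
      rw [Ne, ZMod.natCast_eq_zero_iff]
      exact fun hd => absurd (Nat.le_of_dvd (by norm_num) hd) (by omega)
    intro h
    apply this
    push_cast
    rw [← h]; norm_num
  obtain ⟨a1, a2, a3, a4⟩ := isAxes_en.adj x
  have d12 : x + east L ≠ x - east L := by
    simp [sub_eq_add_neg, east, eq_neg_iff_add_eq_zero, h2]
  have d34 : x + north L ≠ x - north L := by
    simp [sub_eq_add_neg, north, eq_neg_iff_add_eq_zero, h2]
  have d13 : x + east L ≠ x + north L := by simp [east, north]
  have d14 : x + east L ≠ x - north L := by simp [sub_eq_add_neg, east, north]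
  have d23 : x - east L ≠ x + north L := by simp [sub_eq_add_neg, east, north]
  have d24 : x - east L ≠ x - north L := by simp [sub_eq_add_neg, east, north]
  have b12 := hx _ _ a1 a2
  have b13 := hx _ _ a1 a3
  have b14 := hx _ _ a1 a4
  have b23 := hx _ _ a2 a3
  have b24 := hx _ _ a2 a4
  have b34 := hx _ _ a3 a4
  rw [isAxes_en.nnS_eq]
  cases h1 : σ (x + east L) <;> cases h2 : σ (x - east L) <;> cases h3 : σ (x + north L) <;>
    cases h4 : σ (x - north L) <;> simp_all <;> norm_num

lemma nnS_le_zero_of_axes {v w x : Site L} (hvw : IsAxes v w) {σ : Config L}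
    (h1 : σ (x - v) = false) (h2 : σ (x + w) = false) : nnS σ x ≤ 0 := by
  rw [hvw.nnS_eq, h1, h2, spin_false]
  linarith [spin_le_one (σ (x + v)), spin_le_one (σ (x - w))]

lemma nnS_le_neg_two_of_axes {v w x : Site L} (hvw : IsAxes v w) {σ : Config L}
    (h1 : σ (x - v) = false) (h2 : σ (x + w) = false) (h3 : σ (x + v) = false) :
    nnS σ x ≤ -2 := by
  rw [hvw.nnS_eq, h1, h2, h3, spin_false]
  linarith [spin_le_one (σ (x - w))]

/-- `σ` dominates the chessboard `D`, with equality outside `ℜ`. -/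
def UpperAt (ℜ : Set (Site L)) (D σ : Config L) : Prop :=
  ∀ x, D x = true ∨ x ∉ ℜ → σ x = D x

/-- The configurations that dominate some chessboard, with equality outside `ℜ`. -/
def Upper (ℜ : Set (Site L)) : Set (Config L) := {σ | ∃ D, IsChessCfg D ∧ UpperAt ℜ D σ}

lemma Upper_empty : Upper (∅ : Set (Site L)) = chessSet L := by
  ext σ
  rw [← isChessCfg_iff]
  constructor
  · rintro ⟨D, hD, hσ⟩
    rwa [show σ = D from funext fun x => hσ x (Or.inr (Set.notMem_empty x))]
  · exact fun hσ => ⟨σ, hσ, fun x _ => rfl⟩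

variable [NeZero L] {ℜ : Set (Site L)} {D σ : Config L} {h β : ℝ}

lemma UpperAt.nnS_eq_four (hL : Even L) (hD : IsChessCfg D) (hσ : UpperAt ℜ D σ) {x : Site L}
    (hx : D x = false) : nnS σ x = 4 := by
  refine PCA.nnS_eq_four fun y hy => ?_
  have : D y = true := by rw [hD.of_adj hL hy, hx]; rfl
  rw [hσ y (Or.inl this), this]

lemma UpperAt.nnS_le (hL : Even L) (hL2 : 2 < L) (hD : IsChessCfg D) (hσ : UpperAt ℜ D σ)
    (hS : Sparse ℜ) {x : Site L} (hx : D x = true) (hxR : x ∉ ℜ) : nnS σ x ≤ -2 := by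
  have key : ∀ y, Adj x y → σ y = true → y ∈ ℜ := by
    intro y hy hσy
    by_contra hyR
    have := hσ y (Or.inr hyR)
    rw [hD.of_adj hL hy, hx, hσy] at this
    exact absurd this (by simp)
  exact nnS_le_neg_two hL2 fun y z hy hz hσy hσz =>
    hS x hxR y z hy hz (key y hy hσy) (key z hz hσz)

lemma UpperAt.drift (hL : Even L) (hL2 : 2 < L) (h0 : 0 < h) (h2 : h < 2) (hD : IsChessCfg D)
    (hσ : UpperAt ℜ D σ) (hS : Sparse ℜ) : UpperAt ℜ (fun x => !D x) (T h σ) := by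
  intro x hx
  cases hDx : D x
  · rw [T_eq_true h0 (by rw [hσ.nnS_eq_four hL hD hDx]; norm_num)]
    exact (congrArg not hDx).symm
  · rw [T_eq_false h2 (hσ.nnS_le hL hL2 hD hS hDx (by simpa [hDx] using hx))]
    exact (congrArg not hDx).symm

/-- Leaving `Upper ℜ` needs a spin to disagree with at least three of its neighbours. -/
lemma Upper_exit_le (hL : Even L) (hL2 : 2 < L) (h0 : 0 < h) (hβ : 0 < β) (hS : Sparse ℜ)
    (hσ : σ ∈ Upper ℜ) :
    ∑ ζ, Pmat β h σ ζ * (if ζ ∈ Upper ℜ then 0 else 1) ≤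
      Fintype.card (Site L) * Real.exp (-β * (2 * (2 - h))) := by
  obtain ⟨D, hD, hσ⟩ := hσ
  refine exit_le (Real.exp_pos _).le (fun x => !D x) (fun x => (!D x) = true ∨ x ∉ ℜ)
    (fun ζ hζ => ⟨_, hD.not, hζ⟩) fun x hx => (flipP_le_exp ..).trans (Real.exp_le_exp.2 ?_)
  cases hDx : D x
  · rw [hσ.nnS_eq_four hL hD hDx]
    simp
    nlinarith
  · have := hσ.nnS_le hL hL2 hD hS hDx (by simpa [hDx] using hx)
    simp
    nlinarith

lemma Upper_univ_exit_le (hL : Even L) (hσ : σ ∈ Upper Set.univ) :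
    ∑ ζ, Pmat β h σ ζ * (if ζ ∈ Upper Set.univ then 0 else 1) ≤
      Fintype.card (Site L) * Real.exp (-β * (2 * (4 + h))) := by
  obtain ⟨D, hD, hσ⟩ := hσ
  refine exit_le (Real.exp_pos _).le (fun x => !D x) (fun x => (!D x) = true ∨ x ∉ Set.univ)
    (fun ζ hζ => ⟨_, hD.not, hζ⟩) fun x hx => (flipP_le_exp ..).trans (Real.exp_le_exp.2 ?_)
  have hDx : D x = false := by simpa using hx
  rw [hσ.nnS_eq_four hL hD hDx]
  simp [hDx]
  nlinarith

lemma one_sub_le_stay_Upper (hL : Even L) (hL2 : 2 < L) (h0 : 0 < h) (hS : Sparse ℜ) {θ : ℝ}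
    (hθ : θ < 2 * (2 - h)) (m : ℕ) {κ : ℝ} (hκ : 0 < κ) :
    ∀ᶠ β : ℝ in atTop, ∀ σ ∈ Upper ℜ,
      1 - κ ≤ stay (Pmat β h) (Upper ℜ) (m * ⌊Real.exp (β * θ)⌋₊) σ := by
  filter_upwards [eventually_exit_small hθ (Nat.cast_nonneg (Fintype.card (Site L))) m hκ,
    eventually_gt_atTop 0] with β h1 hβ σ hσ
  have := one_sub_le_stay (isStoch_Pmat β h)
    (δ := Fintype.card (Site L) * Real.exp (-β * (2 * (2 - h)))) (by positivity)
    (fun σ hσ => Upper_exit_le hL hL2 h0 hβ hS hσ) (m * ⌊Real.exp (β * θ)⌋₊) hσ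
  linarith

lemma one_sub_le_stay_Upper_univ (hL : Even L) {θ : ℝ} (hθ : θ < 2 * (4 + h)) (m : ℕ) {κ : ℝ}
    (hκ : 0 < κ) :
    ∀ᶠ β : ℝ in atTop, ∀ σ ∈ Upper (Set.univ : Set (Site L)),
      1 - κ ≤ stay (Pmat β h) (Upper Set.univ) (m * ⌊Real.exp (β * θ)⌋₊) σ := by
  filter_upwards [eventually_exit_small hθ (Nat.cast_nonneg (Fintype.card (Site L))) m hκ]
    with β h1 σ hσ
  have := one_sub_le_stay (isStoch_Pmat β h)
    (δ := Fintype.card (Site L) * Real.exp (-β * (2 * (4 + h)))) (by positivity)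
    (fun σ hσ => Upper_univ_exit_le hL hσ) (m * ⌊Real.exp (β * θ)⌋₊) hσ
  linarith

lemma plusC_notMem_Upper (hL : Even L) (hL2 : 2 < L) (hS : Sparse ℜ) (hR : ∃ x, x ∉ ℜ) :
    plusC L ∉ Upper ℜ := by
  rintro ⟨D, hD, hσ⟩
  obtain ⟨x, hx⟩ := hR
  cases hDx : D x
  · exact absurd (hσ x (Or.inr hx)) (by rw [hDx]; simp [plusC])
  · have := hσ.nnS_le hL hL2 hD hS hDx hx
    rw [nnS_eq_four (σ := plusC L) fun _ _ => rfl] at this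
    norm_num at this

end Upper

section Shrinking

variable {L : ℕ} {ℜ : Set (Site L)} {h β : ℝ}

/-- The data of a side `p, p + v, …, p + (n - 1) v` of a droplet in `ℜ`, with `w` pointing out of
the droplet. -/
structure IsSide (ℜ : Set (Site L)) (p v w : Site L) (n : ℕ) : Prop where
  axes : IsAxes v w
  out : ∀ i < n, p + i • v + w ∉ ℜ
  left : p - v ∉ ℜ
  right : p + n • v ∉ ℜ

/-- The pluses of the side sitting on minuses of `D` have been removed before position `s`. -/
def Peeled (ℜ : Set (Site L)) (p v : Site L) (s : ℕ) (D σ : Config L) : Prop :=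
  IsChessCfg D ∧ UpperAt ℜ D σ ∧ ∀ i < s, D (p + i • v) = false → σ (p + i • v) = false

variable {p v w : Site L} {n : ℕ}

lemma Peeled.upper {D σ : Config L} (hP : Peeled ℜ p v n D σ) :
    σ ∈ Upper (ℜ \ {x | ∃ i < n, x = p + i • v}) := by
  refine ⟨D, hP.1, fun x hx => ?_⟩
  by_cases hDx : D x = true
  · exact hP.2.1 x (Or.inl hDx)
  by_cases hxR : x ∈ ℜ
  · obtain ⟨i, hi, rfl⟩ : ∃ i < n, x = p + i • v := by
      by_contra hne
      exact (hx.resolve_left hDx) ⟨hxR, hne⟩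
    rw [Bool.not_eq_true] at hDx
    rw [hDx]
    exact hP.2.2 i hi hDx
  · exact hP.2.1 x (Or.inr hxR)

lemma Peeled.update {D σ : Config L} {s : ℕ} (hP : Peeled ℜ p v s D σ)
    (hD : D (p + s • v) = false) :
    Peeled ℜ p v (s + 1) D (Function.update σ (p + s • v) false) := by
  refine ⟨hP.1, fun x hx => ?_, fun i hi hDi => ?_⟩
  · by_cases hxs : x = p + s • v
    · rw [hxs, Function.update_self, hD]
    · rw [Function.update_of_ne hxs]; exact hP.2.1 x hx
  · by_cases hxs : p + i • v = p + s • v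
    · rw [hxs, Function.update_self]
    · rw [Function.update_of_ne hxs]
      refine hP.2.2 i (lt_of_le_of_ne (Nat.lt_succ_iff.1 hi) ?_) hDi
      rintro rfl
      exact hxs rfl

variable [NeZero L]

lemma Peeled.prev (hL : Even L) (hside : IsSide ℜ p v w n) {D σ : Config L} {s i : ℕ}
    (hP : Peeled ℜ p v s D σ) (his : i ≤ s) (hD : D (p + i • v) = true) :
    σ (p + i • v - v) = false := by
  have hDv : D (p + i • v - v) = false := by
    rw [hP.1.of_adj hL (hside.axes.adj _).2.1, hD]; rfl
  cases i with
  | zero =>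
    rw [zero_smul, add_zero] at hDv ⊢
    rw [hP.2.1 _ (Or.inr hside.left), hDv]
  | succ i =>
    rw [succ_nsmul, ← add_assoc, add_sub_cancel_right] at hDv ⊢
    exact hP.2.2 i (by omega) hDv

lemma Peeled.outer (hL : Even L) (hside : IsSide ℜ p v w n) {D σ : Config L} {s i : ℕ}
    (hP : Peeled ℜ p v s D σ) (hi : i < n) (hD : D (p + i • v) = true) :
    σ (p + i • v + w) = false := by
  rw [hP.2.1 _ (Or.inr (hside.out i hi)), hP.1.of_adj hL (hside.axes.adj _).2.2.1, hD]; rfl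

lemma Peeled.drift (hL : Even L) (hL2 : 2 < L) (h0 : 0 < h) (h2 : h < 2) (hS : Sparse ℜ)
    (hside : IsSide ℜ p v w n) {D σ : Config L} {s : ℕ} (hP : Peeled ℜ p v s D σ) (hsn : s ≤ n)
    (hD : D (p + s • v) = true) : Peeled ℜ p v s (fun x => !D x) (T h σ) := by
  refine ⟨hP.1.not, hP.2.1.drift hL hL2 h0 h2 hP.1 hS, fun i hi hDi => ?_⟩
  have hDi : D (p + i • v) = true := by simpa using hDi
  refine T_eq_false h2 (nnS_le_neg_two_of_axes hside.axes (hP.prev hL hside hi.le hDi)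
    (hP.outer hL hside (by omega) hDi) ?_)
  have hDv : D (p + i • v + v) = false := by
    rw [hP.1.of_adj hL (hside.axes.adj _).1, hDi]; rfl
  rw [add_assoc, ← succ_nsmul] at hDv ⊢
  refine hP.2.2 (i + 1) (lt_of_le_of_ne hi ?_) hDv
  rintro rfl
  rw [hDv] at hD
  exact absurd hD (by simp)

/-- Peeling off a side of length `n` costs `n - 1` unfavourable flips. -/
lemma Peeled.le_reach (hL : Even L) (hL2 : 2 < L) (h0 : 0 < h) (h2 : h < 2) (hβ : 0 < β)
    (hS : Sparse ℜ) (hside : IsSide ℜ p v w n) (t : ℕ) :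
    ∀ (s : ℕ) (D σ : Config L), s + (t + 1) = n → Peeled ℜ p v s D σ → D (p + s • v) = true →
      ((1 / 2 : ℝ) ^ Fintype.card (Site L)) ^ (t + 1) * Real.exp (-β * (2 * h * t)) ≤
        reach (Pmat β h) (Upper ℜ) (Upper (ℜ \ {x | ∃ i < n, x = p + i • v})) (t + 1) σ := by
  induction t with
  | zero =>
    intro s D σ hs hP hD
    have hT := (hP.drift hL hL2 h0 h2 hS hside (by omega) hD).update (congrArg not hD)
    have hz : T h σ (p + s • v) = false := by
      refine T_eq_false h2 (nnS_le_neg_two_of_axes hside.axes (hP.prev hL hside le_rfl hD)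
        (hP.outer hL hside (by omega) hD) ?_)
      rw [add_assoc, ← succ_nsmul]
      have hr := hside.right
      rw [← hs] at hr
      rw [hP.2.1 _ (Or.inr hr), zero_add, succ_nsmul, ← add_assoc,
        hP.1.of_adj hL (hside.axes.adj _).1, hD]
      rfl
    rw [← hz, Function.update_eq_self, show s + 1 = n by omega] at hT
    refine le_trans ?_ (mul_reach_le_reach_succ (isStoch_Pmat β h) (G := Upper ℜ)
      ⟨D, hP.1, hP.2.1⟩ (T h σ) 0
      (Pmat_le_one ..))
    rw [reach_of_mem hT.upper]
    simpa using le_Pmat_T (h := h) hβ σ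
  | succ t ih =>
    intro s D σ hs hP hD
    have hT := (hP.drift hL hL2 h0 h2 hS hside (by omega) hD).update (congrArg not hD)
    have hD' : (!D (p + (s + 1) • v)) = true := by
      rw [succ_nsmul, ← add_assoc, hP.1.of_adj hL (hside.axes.adj _).1, hD]; rfl
    refine le_trans ?_ (mul_reach_le_reach_succ (isStoch_Pmat β h) (G := Upper ℜ) ⟨D, hP.1, hP.2.1⟩
      (Function.update (T h σ) (p + s • v) false) (t + 1)
      (Pmat_le_one ..))
    have h3 := ih (s + 1) _ _ (by omega) hT hD'
    have h4 := le_Pmat_update (h := h) (a := false) (x := p + s • v) (σ := σ) hβ h0.le (by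
      have := nnS_le_zero_of_axes hside.axes (hP.prev hL hside le_rfl hD)
        (hP.outer hL hside (by omega) hD)
      rw [spin_false]; linarith)
    refine le_trans (le_of_eq ?_) (mul_le_mul h4 h3 (by positivity)
      ((isStoch_Pmat β h).nonneg _ _))
    have e : Real.exp (-β * (2 * h * ((t + 1 : ℕ) : ℝ))) =
        Real.exp (-β * (2 * h)) * Real.exp (-β * (2 * h * t)) := by
      rw [← Real.exp_add]; push_cast; ring_nf
    rw [e]; ring

lemma le_reach_peel (hL : Even L) (hL2 : 2 < L) (h0 : 0 < h) (h2 : h < 2) (hβ : 0 < β)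
    (hS : Sparse ℜ) {t : ℕ} (hside : IsSide ℜ p v w (t + 1)) {σ : Config L} (hσ : σ ∈ Upper ℜ) :
    ((1 / 2 : ℝ) ^ Fintype.card (Site L)) ^ (t + 2) * Real.exp (-β * (2 * h * t)) ≤
      reach (Pmat β h) (Upper ℜ) (Upper (ℜ \ {x | ∃ i < t + 1, x = p + i • v})) (t + 2) σ := by
  obtain ⟨D, hD, hσ⟩ := hσ
  have q1 : (1 / 2 : ℝ) ^ Fintype.card (Site L) ≤ 1 := pow_le_one₀ (by norm_num) (by norm_num)
  cases hDp : D p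
  · have h3 := Peeled.le_reach (β := β) hL hL2 h0 h2 hβ hS hside t 0 _ _ (by omega)
      ⟨hD.not, hσ.drift hL hL2 h0 h2 hD hS, fun i hi => absurd hi (by omega)⟩ (by simpa using hDp)
    refine le_trans ?_ (mul_reach_le_reach_succ (isStoch_Pmat β h) (G := Upper ℜ)
      ⟨D, hD, hσ⟩ (T h σ) (t + 1)
      (Pmat_le_one ..))
    refine le_trans (le_of_eq ?_) (mul_le_mul (le_Pmat_T (h := h) hβ σ) h3 (by positivity)
      ((isStoch_Pmat β h).nonneg _ _))
    ring
  · have h3 := Peeled.le_reach (β := β) hL hL2 h0 h2 hβ hS hside t 0 D σ (by omega)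
      ⟨hD, hσ, fun i hi => absurd hi (by omega)⟩ (by simpa using hDp)
    refine le_trans (le_trans ?_ h3) (reach_le_succ (isStoch_Pmat β h) _ _ _ _)
    exact mul_le_mul_of_nonneg_right (pow_le_pow_of_le_one (by positivity) q1 (by omega))
      (Real.exp_pos _).le

lemma reaches_peel (hL : Even L) (hL2 : 2 < L) (h0 : 0 < h) (h2 : h < 2) (hS : Sparse ℜ) {t : ℕ}
    (hside : IsSide ℜ p v w (t + 1)) {θ : ℝ} (hθ : 2 * h * t < θ) (hθ' : θ < 2 * (2 - h)) :
    Reaches (fun β => Pmat β h) (Upper ℜ) (Upper ℜ)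
      (Upper (ℜ \ {x | ∃ i < t + 1, x = p + i • v})) θ :=
  Reaches.of_trial (isStoch_Pmat · h) (by positivity)
    (pow_le_one₀ (by positivity) (pow_le_one₀ (by norm_num) (by norm_num))) (by positivity) hθ
    (fun _ hβ _ hσ => le_reach_peel hL hL2 h0 h2 hβ hS hside hσ)
    fun _ hκ => one_sub_le_stay_Upper hL hL2 h0 hS hθ' _ hκ

end Shrinking

section Removal

variable {L : ℕ}

lemma isSide_of_subset {ℜ R : Set (Site L)} {p v w : Site L} {n : ℕ} (hvw : IsAxes v w)
    (hn : 0 < n) (hR : ∀ x ∈ R, ∀ y, Adj x y → y ∉ R → y ∉ ℜ) (hmem : ∀ i < n, p + i • v ∈ R)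
    (hout : ∀ i < n, p + i • v + w ∉ R) (hleft : p - v ∉ R) (hright : p + n • v ∉ R) :
    IsSide ℜ p v w n where
  axes := hvw
  out i hi := hR _ (hmem i hi) _ (hvw.adj _).2.2.1 (hout i hi)
  left := hR _ (by simpa using hmem 0 hn) _ (hvw.adj _).2.1 hleft
  right := by
    obtain ⟨m, rfl⟩ : ∃ m, n = m + 1 := ⟨n - 1, by omega⟩
    refine hR _ (hmem m (by omega)) _ ?_ hright
    rw [succ_nsmul, ← add_assoc]
    exact (hvw.adj _).1

lemma val_neg_one_ge [NeZero L] {a : ℕ} (ha : a + 2 ≤ L) : ¬ (-1 : ZMod L).val < a := by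
  have h1 : (-1 : ZMod L) = ((L - 1 : ℕ) : ZMod L) := by
    rw [Nat.cast_sub (by omega)]; simp
  rw [h1, ZMod.val_cast_of_lt (by omega)]
  omega

lemma isSide_row [NeZero L] {ℜ : Set (Site L)} {c : Site L} {a b : ℕ} (ha : a + 2 ≤ L)
    (hb : b + 3 ≤ L) (ha0 : 0 < a)
    (hR : ∀ x ∈ rect c a (b + 1), ∀ y, Adj x y → y ∉ rect c a (b + 1) → y ∉ ℜ) :
    IsSide ℜ (c + (0, (b : ZMod L))) (east L) (north L) a := by
  refine isSide_of_subset isAxes_en ha0 hR (fun i hi => ⟨i, b, hi, by omega, ?_⟩)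
    (fun i hi hm => ?_) (fun hm => ?_) fun hm => ?_
  · ext <;> simp [east]
  · rw [mem_rect_iff (by omega) (by omega)] at hm
    have h2 : (c + (0, (b : ZMod L)) + i • east L + north L - c).2 = ((b + 1 : ℕ) : ZMod L) := by
      simp [east, north]; ring
    rw [h2, ZMod.val_cast_of_lt (by omega)] at hm
    omega
  · rw [mem_rect_iff (by omega) (by omega)] at hm
    have h2 : (c + (0, (b : ZMod L)) - east L - c).1 = -1 := by simp [east]
    rw [h2] at hm
    exact val_neg_one_ge ha hm.1
  · rw [mem_rect_iff (by omega) (by omega)] at hm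
    have h2 : (c + (0, (b : ZMod L)) + a • east L - c).1 = (a : ZMod L) := by simp [east]
    rw [h2, ZMod.val_cast_of_lt (by omega)] at hm
    omega

lemma isSide_col [NeZero L] {ℜ : Set (Site L)} {c : Site L} {a b : ℕ} (ha : a + 3 ≤ L)
    (hb : b + 2 ≤ L) (hb0 : 0 < b)
    (hR : ∀ x ∈ rect c (a + 1) b, ∀ y, Adj x y → y ∉ rect c (a + 1) b → y ∉ ℜ) :
    IsSide ℜ (c + ((a : ZMod L), 0)) (north L) (east L) b := by
  refine isSide_of_subset isAxes_ne hb0 hR (fun i hi => ⟨a, i, by omega, hi, ?_⟩)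
    (fun i hi hm => ?_) (fun hm => ?_) fun hm => ?_
  · ext <;> simp [north]
  · rw [mem_rect_iff (by omega) (by omega)] at hm
    have h2 : (c + ((a : ZMod L), 0) + i • north L + east L - c).1 = ((a + 1 : ℕ) : ZMod L) := by
      simp [east, north]; ring
    rw [h2, ZMod.val_cast_of_lt (by omega)] at hm
    omega
  · rw [mem_rect_iff (by omega) (by omega)] at hm
    have h2 : (c + ((a : ZMod L), 0) - north L - c).2 = -1 := by simp [north]
    rw [h2] at hm
    exact val_neg_one_ge hb hm.2
  · rw [mem_rect_iff (by omega) (by omega)] at hm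
    have h2 : (c + ((a : ZMod L), 0) + b • north L - c).2 = (b : ZMod L) := by simp [north]
    rw [h2, ZMod.val_cast_of_lt (by omega)] at hm
    omega

lemma Upper_mono {ℜ ℜ' : Set (Site L)} (hR : ℜ ⊆ ℜ') : Upper ℜ ⊆ Upper ℜ' := by
  rintro σ ⟨D, hD, hσ⟩
  exact ⟨D, hD, fun x hx => hσ x (hx.imp id fun h h' => h (hR h'))⟩

lemma rect_sdiff_row (c : Site L) (a b : ℕ) :
    rect c a (b + 1) \ {x | ∃ i < a, x = c + (0, (b : ZMod L)) + i • east L} ⊆ rect c a b := by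
  rintro x ⟨⟨i, j, hi, hj, rfl⟩, hx⟩
  refine ⟨i, j, hi, lt_of_le_of_ne (Nat.lt_succ_iff.1 hj) ?_, rfl⟩
  rintro rfl
  exact hx ⟨i, hi, by ext <;> simp [east]⟩

lemma rect_sdiff_col (c : Site L) (a b : ℕ) :
    rect c (a + 1) b \ {x | ∃ i < b, x = c + ((a : ZMod L), 0) + i • north L} ⊆ rect c a b := by
  rintro x ⟨⟨i, j, hi, hj, rfl⟩, hx⟩
  refine ⟨i, j, lt_of_le_of_ne (Nat.lt_succ_iff.1 hi) ?_, hj, rfl⟩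
  rintro rfl
  exact hx ⟨j, hj, by ext <;> simp [north]⟩

lemma iUnion_rect_sdiff_subset {k : ℕ} {c : Fin k → Site L} {a b a' b' : Fin k → ℕ} {i : Fin k}
    {S : Set (Site L)} (hi : rect (c i) (a i) (b i) \ S ⊆ rect (c i) (a' i) (b' i))
    (hne : ∀ j, j ≠ i → a' j = a j ∧ b' j = b j) :
    (⋃ j, rect (c j) (a j) (b j)) \ S ⊆ ⋃ j, rect (c j) (a' j) (b' j) := by
  rintro x ⟨hx, hxS⟩
  rw [Set.mem_iUnion] at hx ⊢
  obtain ⟨j, hj⟩ := hx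
  by_cases hij : j = i
  · subst hij; exact ⟨j, hi ⟨hj, hxS⟩⟩
  · refine ⟨j, ?_⟩
    rwa [(hne j hij).1, (hne j hij).2]

variable [NeZero L] {h θ : ℝ} {k : ℕ} {c : Fin k → Site L} {a b : Fin k → ℕ}

/-- Plus droplets of minimal side at most `ℓ` in a chessboard sea are eroded. -/
lemma reaches_chessSet (hL : Even L) (hL2 : 2 < L) (h0 : 0 < h) (h2 : h < 2)
    (hNI : ∀ i j, i ≠ j → NonInteracting (rect (c i) (a i) (b i)) (rect (c j) (a j) (b j)))
    (hab : ∀ i, a i + 2 ≤ L ∧ b i + 2 ≤ L) {ℓ : ℕ} (hℓ : ∀ i, min (a i) (b i) ≤ ℓ)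
    (hθ : 2 * h * ((ℓ : ℝ) - 1) < θ) (hθ' : θ < 2 * (2 - h)) :
    Reaches (fun β => Pmat β h) (Upper (⋃ i, rect (c i) (a i) (b i)))
      (Upper (⋃ i, rect (c i) (a i) (b i))) (chessSet L) θ := by
  suffices H : ∀ (N : ℕ) (a' b' : Fin k → ℕ), ∑ i, a' i * b' i = N → (∀ i, a' i ≤ a i) →
      (∀ i, b' i ≤ b i) → Reaches (fun β => Pmat β h) (Upper (⋃ i, rect (c i) (a i) (b i)))
        (Upper (⋃ i, rect (c i) (a' i) (b' i))) (chessSet L) θ from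
    H _ a b rfl (fun _ => le_rfl) fun _ => le_rfl
  intro N
  induction N using Nat.strong_induction_on with
  | _ N ih =>
  intro a' b' hN ha hb
  have hS := sparse_iUnion_rect (a' := a') (b' := b') hNI ha hb hab
  have hsub : Upper (⋃ i, rect (c i) (a' i) (b' i)) ⊆ Upper (⋃ i, rect (c i) (a i) (b i)) :=
    Upper_mono (Set.iUnion_mono fun i => rect_mono (ha i) (hb i))
  by_cases hz : ∀ i, a' i * b' i = 0
  · refine Reaches.of_subset ?_
    rw [← Upper_empty]
    refine Upper_mono ?_
    rw [Set.subset_empty_iff, Set.iUnion_eq_empty]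
    refine fun i => Set.eq_empty_of_forall_notMem ?_
    rintro x ⟨p, q, hp, hq, -⟩
    rcases Nat.mul_eq_zero.1 (hz i) with h | h <;> omega
  push Not at hz
  obtain ⟨i, hi⟩ := hz
  have hai : 0 < a' i := Nat.pos_of_ne_zero (left_ne_zero_of_mul hi)
  have hbi : 0 < b' i := Nat.pos_of_ne_zero (right_ne_zero_of_mul hi)
  have hR : ∀ x ∈ rect (c i) (a' i) (b' i), ∀ y, Adj x y → y ∉ rect (c i) (a' i) (b' i) →
      y ∉ ⋃ j, rect (c j) (a' j) (b' j) :=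
    fun x hx y hxy hy => notMem_iUnion_rect hNI ha hb hx hxy hy
  have hcost : ∀ t : ℕ, t + 1 ≤ ℓ → 2 * h * t < θ := by
    intro t ht
    have : (t : ℝ) + 1 ≤ ℓ := by exact_mod_cast ht
    nlinarith
  have e1 := ha i
  have e2 := hb i
  have e3 := hab i
  have e4 := hℓ i
  have step : ∀ (t : ℕ) (p v w : Site L) (a'' b'' : Fin k → ℕ), t + 1 ≤ ℓ →
      IsSide (⋃ j, rect (c j) (a' j) (b' j)) p v w (t + 1) →
      rect (c i) (a' i) (b' i) \ {x | ∃ i < t + 1, x = p + i • v} ⊆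
        rect (c i) (a'' i) (b'' i) → (∀ j, j ≠ i → a'' j = a' j ∧ b'' j = b' j) →
      a'' i ≤ a' i → b'' i ≤ b' i → a'' i * b'' i < a' i * b' i →
      Reaches (fun β => Pmat β h) (Upper (⋃ i, rect (c i) (a i) (b i)))
        (Upper (⋃ i, rect (c i) (a' i) (b' i))) (chessSet L) θ := by
    intro t p v w a'' b'' ht hside hs hne ha'' hb'' hlt
    have h1 := (reaches_peel hL hL2 h0 h2 hS hside (hcost t ht) hθ').mono (isStoch_Pmat · h)
      (hsub.trans Set.subset_union_left) subset_rfl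
    refine h1.trans (isStoch_Pmat · h) (Reaches.mono (isStoch_Pmat · h)
      (ih _ ?_ a'' b'' rfl (fun j => ?_) fun j => ?_) Set.subset_union_left
      (Upper_mono (iUnion_rect_sdiff_subset hs hne)))
    · rw [← hN]
      refine Finset.sum_lt_sum (fun j _ => ?_) ⟨i, Finset.mem_univ i, hlt⟩
      by_cases hji : j = i
      · subst hji; exact hlt.le
      · rw [(hne j hji).1, (hne j hji).2]
    · by_cases hji : j = i
      · subst hji; omega
      · rw [(hne j hji).1]; exact ha j
    · by_cases hji : j = i
      · subst hji; omega
      · rw [(hne j hji).2]; exact hb j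
  obtain ⟨a₁, ha₁⟩ : ∃ a₁, a' i = a₁ + 1 := ⟨a' i - 1, by omega⟩
  obtain ⟨b₁, hb₁⟩ : ∃ b₁, b' i = b₁ + 1 := ⟨b' i - 1, by omega⟩
  rcases le_total (a' i) (b' i) with hle | hle
  · have hside := isSide_row (ℜ := ⋃ j, rect (c j) (a' j) (b' j)) (c := c i) (a := a' i) (b := b₁)
      (by omega) (by omega) hai (by rwa [← hb₁])
    rw [ha₁] at hside
    refine step a₁ _ _ _ a' (Function.update b' i b₁) (by omega) hside ?_ ?_ ?_ ?_ ?_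
    · rw [← ha₁, hb₁, Function.update_self]; exact rect_sdiff_row ..
    · intro j hj; simp [hj]
    · exact le_rfl
    · rw [Function.update_self]; omega
    · rw [Function.update_self]; exact Nat.mul_lt_mul_of_pos_left (by omega) hai
  · have hside := isSide_col (ℜ := ⋃ j, rect (c j) (a' j) (b' j)) (c := c i) (a := a₁) (b := b' i)
      (by omega) (by omega) hbi (by rwa [← ha₁])
    rw [hb₁] at hside
    refine step b₁ _ _ _ (Function.update a' i a₁) b' (by omega) hside ?_ ?_ ?_ ?_ ?_
    · rw [← hb₁, ha₁, Function.update_self]; exact rect_sdiff_col ..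
    · intro j hj; simp [hj]
    · rw [Function.update_self]; omega
    · exact le_rfl
    · rw [Function.update_self]; exact Nat.mul_lt_mul_of_pos_right (by omega) hbi

end Removal

section Monotone

variable {ι : Type*} [Fintype ι] [DecidableEq ι]

/-- Stochastic monotonicity of product Bernoulli measures. -/
lemma sum_prod_mul_le_of_monotone {p q : ι → Bool → ℝ} (hp : ∀ x b, 0 ≤ p x b)
    (hq : ∀ x b, 0 ≤ q x b) (hp1 : ∀ x, p x true + p x false = 1)
    (hq1 : ∀ x, q x true + q x false = 1) (hpq : ∀ x, p x true ≤ q x true)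
    {f : (ι → Bool) → ℝ} (hf : ∀ σ τ, (∀ x, σ x = true → τ x = true) → f σ ≤ f τ) :
    ∑ σ, (∏ x, p x (σ x)) * f σ ≤ ∑ σ, (∏ x, q x (σ x)) * f σ := by
  set k : ι → Bool → Bool → ℝ := fun x a b =>
    if a then (if b then p x true else 0) else (if b then q x true - p x true else q x false)
    with hk
  have k0 : ∀ x a b, 0 ≤ k x a b := by
    intro x a b
    have := hpq x
    cases a <;> cases b <;> simp [hk, hp, hq, this]
  have expand : ∀ g : ι → Bool → ℝ, ∑ σ : ι → Bool, ∏ x, g x (σ x) = ∏ x, ∑ b, g x b := by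
    intro g
    have := Finset.prod_univ_sum (κ := fun _ : ι => Bool) (fun _ => Finset.univ) g
    rwa [Fintype.piFinset_univ, eq_comm] at this
  have e1 : ∀ σ : ι → Bool, ∏ x, p x (σ x) = ∑ τ : ι → Bool, ∏ x, k x (σ x) (τ x) := by
    intro σ
    rw [expand fun x b => k x (σ x) b]
    refine Finset.prod_congr rfl fun x _ => ?_
    rw [Fintype.sum_bool]
    have h1 := hp1 x
    have h2 := hq1 x
    cases σ x <;> simp [hk]
    linarith
  have e2 : ∀ τ : ι → Bool, ∏ x, q x (τ x) = ∑ σ : ι → Bool, ∏ x, k x (σ x) (τ x) := by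
    intro τ
    rw [expand fun x a => k x a (τ x)]
    refine Finset.prod_congr rfl fun x _ => ?_
    rw [Fintype.sum_bool]
    cases τ x <;> simp [hk]
  simp only [e1, e2, Finset.sum_mul]
  conv_rhs => rw [Finset.sum_comm]
  refine Finset.sum_le_sum fun σ _ => Finset.sum_le_sum fun τ _ => ?_
  by_cases h : ∀ x, σ x = true → τ x = true
  · exact mul_le_mul_of_nonneg_left (hf σ τ h) (Finset.prod_nonneg fun x _ => k0 _ _ _)
  · push Not at h
    obtain ⟨x, hx, hx'⟩ := h
    have : ∏ x, k x (σ x) (τ x) = 0 :=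
      Finset.prod_eq_zero (Finset.mem_univ x) (by simp [hk, hx, hx'])
    simp [this]

end Monotone

section LowerProcess

variable {L : ℕ}

/-- The configuration with pluses exactly on `R`. -/
noncomputable def ind (R : Set (Site L)) : Config L := fun x => decide (x ∈ R)

lemma ind_apply_true {R : Set (Site L)} {x : Site L} (hx : x ∈ R) : ind R x = true := by
  simpa [ind] using hx

lemma ind_apply_false {R : Set (Site L)} {x : Site L} (hx : x ∉ R) : ind R x = false := by
  simpa [ind] using hx

lemma Below.eq_false {R : Set (Site L)} {y : Config L} (hy : Below y (ind R)) {x : Site L}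
    (hx : x ∉ R) : y x = false := by
  by_contra h
  rw [Bool.not_eq_false] at h
  have := hy x h
  rw [ind_apply_false hx] at this
  exact absurd this (by simp)

/-- Single-site law of the dynamics in which the spins outside `R` are forced to be minus. -/
noncomputable def lowerP (β h : ℝ) (R : Set (Site L)) (y : Config L) (x : Site L) (b : Bool) : ℝ :=
  if x ∈ R then flipP β h y x b else if b then 0 else 1

/-- Zero-temperature map of the dynamics with minuses outside `R`. -/
noncomputable def lowerT (h : ℝ) (R : Set (Site L)) (y : Config L) : Config L :=
  fun x => if x ∈ R then T h y x else false

lemma lowerT_below (h : ℝ) (R : Set (Site L)) (y : Config L) : Below (lowerT h R y) (ind R) := by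
  intro x hx
  by_cases hxR : x ∈ R
  · exact ind_apply_true hxR
  · simp [lowerT, hxR] at hx

lemma lowerT_below_T {h : ℝ} {R : Set (Site L)} {y σ : Config L} (hy : Below y σ) :
    Below (lowerT h R y) (T h σ) := by
  intro x hx
  by_cases hxR : x ∈ R
  · simp only [lowerT, hxR, if_true] at hx
    exact hy.drift x hx
  · simp [lowerT, hxR] at hx

lemma lowerT_iterate_below_T {h : ℝ} {R : Set (Site L)} {y σ : Config L} (hy : Below y σ)
    (n : ℕ) : Below ((lowerT h R)^[n] y) ((T h)^[n] σ) := by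
  induction n with
  | zero => exact hy
  | succ n ih =>
    rw [Function.iterate_succ_apply', Function.iterate_succ_apply']
    exact lowerT_below_T ih

lemma flipP_true_mono {β h : ℝ} (hβ : 0 < β) {σ τ : Config L} (hστ : Below σ τ) (x : Site L) :
    flipP β h σ x true ≤ flipP β h τ x true := by
  unfold flipP
  refine one_div_le_one_div_of_le (by positivity) ?_
  have := hστ.nnS_le x
  gcongr 1 + Real.exp ?_
  rw [spin_true]
  nlinarith

lemma lowerP_nonneg (β h : ℝ) (R : Set (Site L)) (y : Config L) (x : Site L) (b : Bool) :
    0 ≤ lowerP β h R y x b := by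
  unfold lowerP
  split_ifs
  exacts [(flipP_pos ..).le, le_rfl, zero_le_one]

lemma lowerP_add (β h : ℝ) (R : Set (Site L)) (y : Config L) (x : Site L) :
    lowerP β h R y x true + lowerP β h R y x false = 1 := by
  unfold lowerP
  split_ifs <;> simp_all [flipP_add]

variable [NeZero L]

/-- Transition matrix of the dynamics with minuses outside `R`. -/
noncomputable def lowerK (β h : ℝ) (R : Set (Site L)) (y ζ : Config L) : ℝ :=
  ∏ x, lowerP β h R y x (ζ x)

lemma isStoch_lowerK (β h : ℝ) (R : Set (Site L)) : IsStoch (lowerK β h R) := by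
  refine ⟨fun σ ζ => Finset.prod_nonneg fun _ _ => lowerP_nonneg .., fun σ => ?_⟩
  unfold lowerK
  have := Finset.prod_univ_sum (κ := fun _ : Site L => Bool) (fun _ => Finset.univ)
    (fun x b => lowerP β h R σ x b)
  rw [Fintype.piFinset_univ] at this
  rw [← this]
  exact Finset.prod_eq_one fun _ _ => by rw [Fintype.sum_bool, lowerP_add]

lemma lowerK_le_one (β h : ℝ) (R : Set (Site L)) (y ζ : Config L) : lowerK β h R y ζ ≤ 1 := by
  have h1 := isStoch_lowerK β h R
  rw [← h1.sum_one y]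
  exact Finset.single_le_sum (f := fun ζ => lowerK β h R y ζ) (fun ζ _ => h1.nonneg y ζ)
    (Finset.mem_univ ζ)

/-- Configurations dominating some element of `A`. -/
def Above (A : Set (Config L)) : Set (Config L) := {σ | ∃ y ∈ A, Below y σ}

lemma stay_Above_mono {β h : ℝ} (hβ : 0 < β) (A : Set (Config L)) (n : ℕ) {σ τ : Config L}
    (hστ : Below σ τ) : stay (Pmat β h) (Above A) n σ ≤ stay (Pmat β h) (Above A) n τ := by
  induction n generalizing σ τ with
  | zero =>
    by_cases hσ : σ ∈ Above A
    · obtain ⟨y, hy, hyσ⟩ := id hσ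
      have hτ : τ ∈ Above A := ⟨y, hy, hyσ.trans hστ⟩
      simp [stay, hσ, hτ]
    · rw [stay_of_notMem hσ]; exact stay_nonneg (isStoch_Pmat β h) _ _ _
  | succ n ih =>
    by_cases hσ : σ ∈ Above A
    · obtain ⟨y, hy, hyσ⟩ := id hσ
      have hτ : τ ∈ Above A := ⟨y, hy, hyσ.trans hστ⟩
      simp only [stay, hσ, hτ, if_true]
      exact sum_prod_mul_le_of_monotone (p := fun x b => flipP β h σ x b)
        (q := fun x b => flipP β h τ x b) (fun x b => (flipP_pos β h σ x b).le)
        (fun x b => (flipP_pos β h τ x b).le) (flipP_add β h σ) (flipP_add β h τ)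
        (flipP_true_mono hβ hστ) fun _ _ => ih
    · rw [stay_of_notMem hσ]; exact stay_nonneg (isStoch_Pmat β h) _ _ _

/-- The original dynamics dominates the one with minuses outside `R`. -/
lemma stay_lowerK_le {β h : ℝ} (hβ : 0 < β) (R : Set (Site L)) (A : Set (Config L)) (n : ℕ)
    {y σ : Config L} (hyσ : Below y σ) :
    stay (lowerK β h R) A n y ≤ stay (Pmat β h) (Above A) n σ := by
  induction n generalizing y σ with
  | zero =>
    by_cases hy : y ∈ A
    · have hσ : σ ∈ Above A := ⟨y, hy, hyσ⟩
      simp [stay, hy, hσ]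
    · rw [stay_of_notMem hy]; exact stay_nonneg (isStoch_Pmat β h) _ _ _
  | succ n ih =>
    by_cases hy : y ∈ A
    · have hσ : σ ∈ Above A := ⟨y, hy, hyσ⟩
      simp only [stay, hy, hσ, if_true]
      refine ((isStoch_lowerK β h R).sum_mul_mono (fun ζ => ih (fun _ => id)) y).trans ?_
      refine sum_prod_mul_le_of_monotone (p := fun x b => lowerP β h R y x b)
        (q := fun x b => flipP β h σ x b) (lowerP_nonneg β h R y)
        (fun x b => (flipP_pos β h σ x b).le) (lowerP_add β h R y) (flipP_add β h σ) (fun x => ?_)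
        fun _ _ => stay_Above_mono hβ A n
      by_cases hx : x ∈ R
      · simpa [lowerP, hx] using flipP_true_mono hβ hyσ x
      · simpa [lowerP, hx] using (flipP_pos β h σ x true).le
    · rw [stay_of_notMem hy]; exact stay_nonneg (isStoch_Pmat β h) _ _ _

end LowerProcess

section Reversible

variable {L : ℕ} [NeZero L]

/-- The symmetric two-time interaction. -/
noncomputable def pairQ (h : ℝ) (y ζ : Config L) : ℝ :=
  h * ∑ x, spin (y x) + ∑ x, spin (ζ x) * (nnS y x + h)

lemma sum_spin_mul_nnS_comm (y ζ : Config L) :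
    ∑ x, spin (ζ x) * nnS y x = ∑ x, spin (y x) * nnS ζ x := by
  have key : ∀ (v : Site L) (y ζ : Config L), ∑ x, spin (ζ x) * spin (y (x + v)) =
      ∑ x, spin (y x) * spin (ζ (x - v)) := by
    intro v y ζ
    rw [← (Equiv.subRight v).sum_comp]
    exact Finset.sum_congr rfl fun x _ => by simp [mul_comm]
  simp only [nnS, mul_add, Finset.sum_add_distrib]
  have h1 := key (east L) y ζ
  have h2 := key (east L) ζ y
  have h3 := key (north L) y ζ
  have h4 := key (north L) ζ y
  linarith

lemma pairQ_comm (h : ℝ) (y ζ : Config L) : pairQ h y ζ = pairQ h ζ y := by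
  unfold pairQ
  simp only [mul_add, Finset.sum_add_distrib, sum_spin_mul_nnS_comm y ζ, ← Finset.sum_mul]
  ring

/-- Reversible measure of `lowerK`. -/
noncomputable def lowerMu (β h : ℝ) (R : Set (Site L)) (y : Config L) : ℝ :=
  if Below y (ind R) then Real.exp (β * (h * ∑ x, spin (y x))) *
    ∏ x, (if x ∈ R then Real.exp (β * (nnS y x + h)) + Real.exp (-(β * (nnS y x + h)))
      else Real.exp (-(β * (nnS y x + h)))) else 0

lemma lowerMu_nonneg (β h : ℝ) (R : Set (Site L)) (y : Config L) : 0 ≤ lowerMu β h R y := by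
  unfold lowerMu
  split_ifs
  · refine mul_nonneg (Real.exp_pos _).le (Finset.prod_nonneg fun x _ => ?_)
    split_ifs <;> positivity
  · exact le_rfl

lemma lowerMu_mul_lowerK {β h : ℝ} {R : Set (Site L)} {y ζ : Config L} :
    lowerMu β h R y * lowerK β h R y ζ =
      if Below y (ind R) ∧ Below ζ (ind R) then Real.exp (β * pairQ h y ζ) else 0 := by
  by_cases hy : Below y (ind R)
  swap
  · simp [lowerMu, hy]
  by_cases hζ : Below ζ (ind R)
  swap
  · have hζ' := hζ
    unfold Below at hζ'
    push Not at hζ'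
    obtain ⟨x, hx, hxR⟩ := hζ'
    have : lowerK β h R y ζ = 0 := by
      refine Finset.prod_eq_zero (Finset.mem_univ x) ?_
      have : x ∉ R := fun h => hxR (ind_apply_true h)
      simp [lowerP, this, hx]
    simp [this, hζ]
  rw [if_pos ⟨hy, hζ⟩, lowerMu, if_pos hy, lowerK, mul_assoc, ← Finset.prod_mul_distrib, pairQ,
    mul_add, Real.exp_add, Finset.mul_sum (f := fun x => spin (ζ x) * (nnS y x + h)),
    Real.exp_sum]
  congr 1
  refine Finset.prod_congr rfl fun x _ => ?_
  by_cases hx : x ∈ R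
  · simp only [hx, if_true, lowerP, flipP]
    have e : ∀ u : ℝ, (Real.exp (β * u) + Real.exp (-(β * u))) *
        (1 / (1 + Real.exp (-2 * β * spin (ζ x) * u))) = Real.exp (β * (spin (ζ x) * u)) := by
      intro u
      rw [mul_one_div, div_eq_iff (by positivity), mul_add, ← Real.exp_add, mul_one]
      cases ζ x
      · rw [spin_false]; ring_nf
      · rw [spin_true]; ring_nf
    exact e _
  · rw [if_neg hx, hζ.eq_false hx]
    simp only [lowerP, hx, if_false, spin_false, Bool.false_eq_true, mul_one]
    ring_nf

lemma lowerMu_reversible (β h : ℝ) (R : Set (Site L)) (y ζ : Config L) :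
    lowerMu β h R y * lowerK β h R y ζ = lowerMu β h R ζ * lowerK β h R ζ y := by
  rw [lowerMu_mul_lowerK, lowerMu_mul_lowerK, pairQ_comm]
  congr 1
  exact propext and_comm

/-- Exponential control of the exit from `A` when every exit step costs at least `Γ` relative to
the maximal interaction. -/
lemma one_sub_le_stay_lowerK {β h Γ : ℝ} (hβ : 0 < β) {R : Set (Site L)} {A : Set (Config L)}
    (hA : ind R ∈ A) (hexit : ∀ y ∈ A, ∀ ζ ∉ A, Below y (ind R) → Below ζ (ind R) →
      pairQ h y ζ ≤ pairQ h (ind R) (ind R) - Γ) (n : ℕ) :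
    1 - n * ((Fintype.card (Config L) : ℝ) ^ 2 * Real.exp (-β * Γ)) ≤
      stay (lowerK β h R) A n (ind R) := by
  have hS := isStoch_lowerK β h R
  have h1 := sum_mul_one_sub_stay_le hS.nonneg hS.sum_one (lowerMu_nonneg β h R)
    (lowerMu_reversible β h R) A n
  set E := Real.exp (β * pairQ h (ind R) (ind R)) with hE
  have h2 : lowerMu β h R (ind R) * (1 - stay (lowerK β h R) A n (ind R)) ≤
      ∑ σ, (if σ ∈ A then lowerMu β h R σ * (1 - stay (lowerK β h R) A n σ) else 0) := by
    have := Finset.single_le_sum (f := fun σ => if σ ∈ A then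
      lowerMu β h R σ * (1 - stay (lowerK β h R) A n σ) else 0) (fun σ _ => ?_)
      (Finset.mem_univ (ind R))
    · simpa [hA] using this
    · split_ifs
      · exact mul_nonneg (lowerMu_nonneg ..) (by linarith [stay_le_one hS A n σ])
      · exact le_rfl
  have h3 : E ≤ lowerMu β h R (ind R) := by
    have e := lowerMu_mul_lowerK (β := β) (h := h) (R := R) (y := ind R) (ζ := ind R)
    rw [if_pos ⟨fun _ => id, fun _ => id⟩] at e
    rw [hE, ← e]
    exact mul_le_of_le_one_right (lowerMu_nonneg ..) (lowerK_le_one ..)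
  have h4 : ∑ σ, ∑ ζ, (if σ ∈ A ∧ ζ ∉ A then lowerMu β h R σ * lowerK β h R σ ζ else 0) ≤
      (Fintype.card (Config L) : ℝ) ^ 2 * (E * Real.exp (-β * Γ)) := by
    calc _ ≤ ∑ _σ : Config L, ∑ _ζ : Config L, E * Real.exp (-β * Γ) := by
          refine Finset.sum_le_sum fun σ _ => Finset.sum_le_sum fun ζ _ => ?_
          rw [hE, ← Real.exp_add]
          split_ifs with hc
          · rw [lowerMu_mul_lowerK]
            split_ifs with hb
            · have := hexit σ hc.1 ζ hc.2 hb.1 hb.2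
              exact Real.exp_le_exp.2 (by nlinarith)
            · positivity
          · positivity
      _ = _ := by simp only [Finset.sum_const, Finset.card_univ, nsmul_eq_mul]; ring
  have h5 := mul_le_mul_of_nonneg_left h4 (Nat.cast_nonneg (α := ℝ) n)
  have h6 := mul_le_mul_of_nonneg_right h3
    (show 0 ≤ 1 - stay (lowerK β h R) A n (ind R) by linarith [stay_le_one hS A n (ind R)])
  have hE0 : 0 < E := Real.exp_pos _
  have h7 : E * (1 - stay (lowerK β h R) A n (ind R)) ≤
      E * (n * ((Fintype.card (Config L) : ℝ) ^ 2 * Real.exp (-β * Γ))) := by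
    refine h6.trans (h2.trans (h1.trans (h5.trans (le_of_eq ?_))))
    ring
  linarith [le_of_mul_le_mul_left h7 hE0]

end Reversible

section Lines

variable {L : ℕ} [NeZero L]

/-- Energy of a cyclic row of spins. -/
noncomputable def lineE (s : ZMod L → Bool) : ℝ := ∑ t, spin (s t) * spin (s (t + 1))

lemma spin_mul_spin (a b : Bool) : spin a * spin b = if a = b then 1 else -1 := by
  cases a <;> cases b <;> simp

lemma ZMod.forall_of_succ {p : ZMod L → Prop} (hp : ∀ t, p t → p (t + 1)) {t₀ : ZMod L}
    (h0 : p t₀) (t : ZMod L) : p t := by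
  have key : ∀ n : ℕ, p (t₀ + n) := by
    intro n
    induction n with
    | zero => simpa using h0
    | succ n ih => simpa [add_assoc] using hp _ ih
  simpa using key (t - t₀).val

lemma lineE_eq (s : ZMod L → Bool) :
    lineE s = L - ∑ t, (if s t = s (t + 1) then (0 : ℝ) else 2) := by
  have : (L : ℝ) = ∑ _t : ZMod L, (1 : ℝ) := by simp [ZMod.card]
  rw [this, ← Finset.sum_sub_distrib, lineE]
  refine Finset.sum_congr rfl fun t _ => ?_
  rw [spin_mul_spin]
  split_ifs <;> norm_num

lemma lineE_le {s : ZMod L → Bool} {t₀ t₁ : ZMod L} (h0 : s t₀ = true) (h1 : s t₁ = false) :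
    lineE s ≤ L - 4 := by
  obtain ⟨p, hp, hp'⟩ : ∃ p, s p = true ∧ s (p + 1) = false := by
    by_contra! h
    have := ZMod.forall_of_succ (p := fun t => s t = true) (fun t ht => by simpa using h t ht) h0 t₁
    simp [h1] at this
  obtain ⟨q, hq, hq'⟩ : ∃ q, s q = false ∧ s (q + 1) = true := by
    by_contra! h
    have := ZMod.forall_of_succ (p := fun t => s t = false) (fun t ht => by simpa using h t ht)
      h1 t₀
    simp [h0] at this
  have hpq : p ≠ q := by rintro rfl; simp [hp] at hq
  rw [lineE_eq]
  have := Finset.sum_le_sum_of_subset_of_nonneg (Finset.subset_univ ({p, q} : Finset (ZMod L)))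
    (f := fun t => if s t = s (t + 1) then (0 : ℝ) else 2) (fun t _ _ => by split_ifs <;> norm_num)
  rw [Finset.sum_pair hpq, hp, hp', hq, hq'] at this
  norm_num at this
  linarith

lemma le_lineE_interval {p : ZMod L} {n : ℕ} {s : ZMod L → Bool}
    (hs : ∀ t, s t = true ↔ (t - p).val < n) : (L : ℝ) - 4 ≤ lineE s := by
  have key : ∀ t, (if s t = s (t + 1) then (0 : ℝ) else 2) ≤
      (if t = p + ((n : ℕ) - 1 : ZMod L) then 2 else 0) + (if t = p - 1 then 2 else 0) := by
    intro t
    by_cases h2 : t = p - 1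
    · rw [if_pos h2]; split_ifs <;> norm_num
    by_cases h1 : t = p + ((n : ℕ) - 1 : ZMod L)
    · rw [if_pos h1]; split_ifs <;> norm_num
    rw [if_neg h1, if_neg h2, if_pos]
    · norm_num
    have e : (t + 1 - p).val = (t - p).val + 1 := by
      have e1 : t + 1 - p = ((((t - p).val + 1 : ℕ)) : ZMod L) := by simp; ring
      have hlt := ZMod.val_lt (t - p)
      rw [e1, ZMod.val_cast_of_lt]
      by_contra hc
      have : (((t - p).val + 1 : ℕ) : ZMod L) = 0 := by
        rw [show (t - p).val + 1 = L by omega]; simp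
      rw [← e1] at this
      exact h2 (by linear_combination this)
    have h3 : (t - p).val + 1 ≠ n := by
      intro h
      apply h1
      rw [← h]
      simp
    rw [Bool.eq_iff_iff, hs, hs, e]
    omega
  have := Finset.sum_le_sum fun t (_ : t ∈ Finset.univ) => key t
  rw [Finset.sum_add_distrib, Finset.sum_ite_eq' , Finset.sum_ite_eq'] at this
  rw [lineE_eq]
  simp only [Finset.mem_univ, if_true] at this
  linarith

/-- Number of sites of `R` where `u` is minus. -/
noncomputable def miss (R : Set (Site L)) (u : Config L) : ℕ :=
  (Finset.univ.filter fun x => x ∈ R ∧ u x = false).card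

lemma exists_plus_of_miss_lt {R : Set (Site L)} {u : Config L} {f : ZMod L → Site L}
    (hf : Function.Injective f) {p : ZMod L} {n : ℕ} (hn : n ≤ L)
    (hR : ∀ t, (t - p).val < n → f t ∈ R) (hm : miss R u < n) : ∃ t, u (f t) = true := by
  by_contra! h
  refine absurd hm (not_lt.2 ?_)
  have h1 : ((Finset.range n).image fun i : ℕ => f (p + i)).card = n := by
    rw [Finset.card_image_of_injOn, Finset.card_range]
    intro i hi j hj hij
    have hi' := Finset.mem_range.1 hi
    have hj' := Finset.mem_range.1 hj
    have := congrArg ZMod.val (add_left_cancel (hf hij))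
    rwa [ZMod.val_cast_of_lt (by omega), ZMod.val_cast_of_lt (by omega)] at this
  rw [← h1, miss]
  refine Finset.card_le_card fun x hx => ?_
  obtain ⟨i, hi, rfl⟩ := Finset.mem_image.1 hx
  have hi' := Finset.mem_range.1 hi
  refine Finset.mem_filter.2 ⟨Finset.mem_univ _, hR _ ?_, by simpa using h (p + i)⟩
  rw [add_sub_cancel_left, ZMod.val_cast_of_lt (by omega)]
  exact hi'

lemma lineE_le_ind {R : Set (Site L)} {u : Config L} (hu : Below u (ind R)) {f : ZMod L → Site L}
    (hf : Function.Injective f) {p : ZMod L} {n : ℕ} (hn : n < L)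
    (hR : (∀ t, f t ∈ R ↔ (t - p).val < n) ∨ ∀ t, f t ∉ R) (hm : miss R u < n) :
    lineE (fun t => u (f t)) ≤ lineE fun t => ind R (f t) := by
  rcases hR with hR | hR
  · obtain ⟨t, ht⟩ := exists_plus_of_miss_lt hf hn.le (fun t => (hR t).2) hm
    have h1 : f (p + n) ∉ R := by
      rw [hR, add_sub_cancel_left, ZMod.val_cast_of_lt hn]
      exact lt_irrefl n
    refine (lineE_le ht (hu.eq_false h1)).trans (le_lineE_interval (p := p) (n := n) fun t => ?_)
    rw [← hR]
    simp [ind]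
  · refine le_of_eq (congrArg lineE (funext fun t => ?_))
    rw [hu.eq_false (hR t), ind_apply_false (hR t)]

lemma sum_spin_mul_nnS_eq_lineE (u : Config L) : ∑ x, spin (u x) * nnS u x =
    2 * (∑ j, lineE (fun i => u (i, j)) + ∑ i, lineE fun j => u (i, j)) := by
  have key : ∀ v : Site L, ∑ x, spin (u x) * spin (u (x - v)) =
      ∑ x, spin (u x) * spin (u (x + v)) := by
    intro v
    rw [← Equiv.sum_comp (Equiv.addRight v)]
    exact Finset.sum_congr rfl fun x _ => by simp [mul_comm]
  simp only [nnS, mul_add, Finset.sum_add_distrib, key]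
  have e1 : ∑ x, spin (u x) * spin (u (x + east L)) = ∑ j, lineE fun i => u (i, j) := by
    rw [Fintype.sum_prod_type_right]
    simp [lineE, east]
  have e2 : ∑ x, spin (u x) * spin (u (x + north L)) = ∑ i, lineE fun j => u (i, j) := by
    rw [Fintype.sum_prod_type]
    simp [lineE, north]
  rw [e1, e2]
  ring

/-- Isoperimetry: removing few sites from a rectangle does not lower its boundary. -/
lemma sum_spin_mul_nnS_le {c : Site L} {a b : ℕ} (ha : a < L) (hb : b < L) {u : Config L}
    (hu : Below u (ind (rect c a b))) (hm : miss (rect c a b) u < min a b) :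
    ∑ x, spin (u x) * nnS u x ≤
      ∑ x, spin (ind (rect c a b) x) * nnS (ind (rect c a b)) x := by
  rw [sum_spin_mul_nnS_eq_lineE, sum_spin_mul_nnS_eq_lineE]
  rw [lt_min_iff] at hm
  gcongr with j _ i _
  · refine lineE_le_ind hu (f := fun i => (i, j)) (fun i i' h => (Prod.ext_iff.1 h).1)
      (p := c.1) ha ?_ hm.1
    simp only [mem_rect_iff ha.le hb.le, Prod.fst_sub, Prod.snd_sub]
    by_cases h : (j - c.2).val < b
    · left; simp [h]
    · right; simp [h]
  · refine lineE_le_ind hu (f := fun j => (i, j)) (fun i i' h => (Prod.ext_iff.1 h).2)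
      (p := c.2) hb ?_ hm.2
    simp only [mem_rect_iff ha.le hb.le, Prod.fst_sub, Prod.snd_sub]
    by_cases h : (i - c.1).val < a
    · left; simp [h]
    · right; simp [h]

end Lines

section TwoTime

variable {L : ℕ}

/-- `y` on the odd sublattice and `ζ` on the even one. -/
def weave (y ζ : Config L) : Config L := fun x => if chessE L x then ζ x else y x

lemma weave_below {R : Set (Site L)} {y ζ : Config L} (hy : Below y (ind R))
    (hζ : Below ζ (ind R)) : Below (weave y ζ) (ind R) := by
  intro x hx
  unfold weave at hx
  split_ifs at hx
  exacts [hζ x hx, hy x hx]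

lemma nnS_congr {σ τ : Config L} {x : Site L} (hx : ∀ y, Adj x y → σ y = τ y) :
    nnS σ x = nnS τ x := by
  obtain ⟨h1, h2, h3, h4⟩ := isAxes_en.adj x
  rw [isAxes_en.nnS_eq, isAxes_en.nnS_eq, hx _ h1, hx _ h2, hx _ h3, hx _ h4]

lemma spin_mul_le_of_lowerT {h : ℝ} {R : Set (Site L)} {y : Config L} {x : Site L} (hx : x ∈ R)
    (t : Bool) : spin t * (nnS y x + h) ≤ spin (lowerT h R y x) * (nnS y x + h) := by
  have := spin_T_mul_nonneg h y x
  simp only [lowerT, hx, if_true]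
  cases hT : T h y x <;> rw [hT] at this <;> cases t <;> simp at * <;> linarith

lemma nnS_add_ne_zero {h : ℝ} (h0 : 0 < h) (h2 : h < 2) (σ : Config L) (x : Site L) :
    nnS σ x + h ≠ 0 := by
  unfold nnS
  cases σ (x + east L) <;> cases σ (x - east L) <;> cases σ (x + north L) <;>
    cases σ (x - north L) <;> norm_num <;> intro hc <;> linarith

lemma lowerT_ind {h : ℝ} (h0 : 0 < h) {c : Site L} {a b : ℕ} (ha : 2 ≤ a) (hb : 2 ≤ b) :
    lowerT h (rect c a b) (ind (rect c a b)) = ind (rect c a b) := by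
  funext x
  by_cases hx : x ∈ rect c a b
  · rw [ind_apply_true hx]
    simp only [lowerT, hx, if_true]
    obtain ⟨i, j, hi, hj, rfl⟩ := hx
    refine T_eq_true h0 (isAxes_en.nnS_nonneg ?_ ?_)
    · rcases Nat.eq_zero_or_pos i with rfl | h
      · exact Or.inl (ind_apply_true ⟨1, j, by omega, hj, by ext <;> simp [east]⟩)
      · exact Or.inr (ind_apply_true ⟨i - 1, j, by omega, hj, by
          ext <;> simp [east, Nat.cast_sub h, add_sub_assoc]⟩)
    · rcases Nat.eq_zero_or_pos j with rfl | h
      · exact Or.inl (ind_apply_true ⟨i, 1, hi, by omega, by ext <;> simp [north]⟩)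
      · exact Or.inr (ind_apply_true ⟨i, j - 1, hi, by omega, by
          ext <;> simp [north, Nat.cast_sub h, add_sub_assoc]⟩)
  · rw [ind_apply_false hx]
    simp [lowerT, hx]

variable [NeZero L]

lemma two_mul_sum_spin_mul_nnS (hL : Even L) (y ζ : Config L) :
    2 * ∑ x, spin (ζ x) * nnS y x =
      ∑ x, spin (weave y ζ x) * nnS (weave y ζ) x +
        ∑ x, spin (weave ζ y x) * nnS (weave ζ y) x := by
  rw [two_mul]
  nth_rw 2 [sum_spin_mul_nnS_comm]
  rw [← Finset.sum_add_distrib, ← Finset.sum_add_distrib]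
  refine Finset.sum_congr rfl fun x _ => ?_
  cases hx : chessE L x
  · rw [nnS_congr (σ := weave y ζ) (τ := ζ), nnS_congr (σ := weave ζ y) (τ := y)]
    · simp [weave, hx, add_comm]
    all_goals
      intro z hz
      simp [weave, chessE_of_adj hL hz, hx]
  · rw [nnS_congr (σ := weave y ζ) (τ := y), nnS_congr (σ := weave ζ y) (τ := ζ)]
    · simp [weave, hx]
    all_goals
      intro z hz
      simp [weave, chessE_of_adj hL hz, hx]

lemma miss_weave (R : Set (Site L)) (y ζ : Config L) :
    miss R (weave y ζ) + miss R (weave ζ y) = miss R y + miss R ζ := by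
  simp only [miss, Finset.card_filter]
  rw [← Finset.sum_add_distrib, ← Finset.sum_add_distrib]
  refine Finset.sum_congr rfl fun x _ => ?_
  cases hx : chessE L x <;> simp [weave, hx, add_comm]

lemma sum_spin_of_below {R : Set (Site L)} {y : Config L} (hy : Below y (ind R)) :
    ∑ x, spin (y x) = ∑ x, spin (ind R x) - 2 * miss R y := by
  rw [miss, Finset.card_filter]
  push_cast
  rw [Finset.mul_sum, ← Finset.sum_sub_distrib]
  refine Finset.sum_congr rfl fun x _ => ?_
  by_cases hx : x ∈ R
  · rw [ind_apply_true hx]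
    cases y x <;> simp [hx]
    norm_num
  · rw [ind_apply_false hx, hy.eq_false hx]
    simp [hx]

lemma pairQ_eq (h : ℝ) (y ζ : Config L) :
    pairQ h y ζ = h * (∑ x, spin (y x) + ∑ x, spin (ζ x)) + ∑ x, spin (ζ x) * nnS y x := by
  simp only [pairQ, mul_add, Finset.sum_add_distrib, ← Finset.sum_mul]
  ring

/-- The barrier for shrinking a rectangle of pluses. -/
lemma pairQ_le_of_miss (hL : Even L) (h : ℝ) {c : Site L} {a b : ℕ} (ha : a < L) (hb : b < L)
    {y ζ : Config L} (hy : Below y (ind (rect c a b))) (hζ : Below ζ (ind (rect c a b)))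
    (hm : miss (rect c a b) y + miss (rect c a b) ζ < min a b) :
    pairQ h y ζ ≤ pairQ h (ind (rect c a b)) (ind (rect c a b)) -
      2 * h * ((miss (rect c a b) y + miss (rect c a b) ζ : ℕ) : ℝ) := by
  have hw := miss_weave (rect c a b) y ζ
  have h1 := sum_spin_mul_nnS_le ha hb (weave_below hy hζ) (by omega)
  have h2 := sum_spin_mul_nnS_le ha hb (weave_below hζ hy) (by omega)
  have h3 := two_mul_sum_spin_mul_nnS hL y ζ
  rw [pairQ_eq, pairQ_eq, sum_spin_of_below hy, sum_spin_of_below hζ]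
  push_cast
  nlinarith

end TwoTime

section Mix

variable {L : ℕ} [NeZero L]

lemma exists_mix {R : Set (Site L)} {p q : Config L} (hp : Below p (ind R))
    {k : ℕ} (hpk : miss R p ≤ k) (hkq : k ≤ miss R q) :
    ∃ ω : Config L, Below ω (ind R) ∧ miss R ω = k ∧ ∀ x, ω x = p x ∨ ω x = q x := by
  set P := Finset.univ.filter fun x => x ∈ R ∧ p x = false with hP
  set Q := Finset.univ.filter fun x => x ∈ R ∧ q x = false with hQ
  have mP : ∀ x, x ∈ P ↔ x ∈ R ∧ p x = false := by simp [hP]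
  have mQ : ∀ x, x ∈ Q ↔ x ∈ R ∧ q x = false := by simp [hQ]
  have cP : P.card ≤ k := hpk
  have cQ : k ≤ Q.card := hkq
  obtain ⟨U, hU1, hU2, hUk⟩ : ∃ U : Finset (Site L), P ∩ Q ⊆ U ∧ U ⊆ P ∪ Q ∧ U.card = k :=
    Finset.exists_subsuperset_card_eq (Finset.inter_subset_left.trans Finset.subset_union_left)
      ((Finset.card_le_card Finset.inter_subset_left).trans cP)
      (cQ.trans (Finset.card_le_card Finset.subset_union_right))
  have hUR : ∀ x ∈ U, x ∈ R := by
    intro x hx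
    rcases Finset.mem_union.1 (hU2 hx) with h | h
    exacts [((mP x).1 h).1, ((mQ x).1 h).1]
  refine ⟨fun x => decide (x ∈ R ∧ x ∉ U), fun x hx => ind_apply_true (of_decide_eq_true hx).1,
    ?_, fun x => ?_⟩
  · rw [← hUk, miss]
    congr 1
    ext x
    simp only [Finset.mem_filter, Finset.mem_univ, true_and, decide_eq_false_iff_not]
    have := hUR x
    tauto
  · by_cases hR : x ∈ R
    · by_cases hx : x ∈ U
      · have h1 := Finset.mem_union.1 (hU2 hx)
        rw [mP, mQ] at h1
        rcases h1 with h1 | h1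
        · left; simp [hx, h1]
        · right; simp [hx, h1]
      · have h1 : ¬ (x ∈ P ∧ x ∈ Q) := fun h => hx (hU1 (Finset.mem_inter.2 h))
        rw [mP, mQ] at h1
        simp only [hR, hx, not_false_eq_true, and_self, decide_true]
        cases hpx : p x
        · right
          rw [eq_comm, ← Bool.not_eq_false]
          exact fun hqx => h1 ⟨⟨hR, hpx⟩, hR, hqx⟩
        · exact Or.inl rfl
    · left; simp [hR, hp.eq_false hR]

/-- Moving the second argument towards the drift of the first one increases `pairQ`. -/
lemma pairQ_le_mix {h : ℝ} {R : Set (Site L)} {y ζ ω : Config L} (hζ : Below ζ (ind R))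
    (hω : ∀ x, ω x = lowerT h R y x ∨ ω x = ζ x) : pairQ h y ζ ≤ pairQ h y ω := by
  unfold pairQ
  gcongr h * _ + ?_
  refine Finset.sum_le_sum fun x _ => ?_
  rcases hω x with hx | hx
  · rw [hx]
    by_cases hR : x ∈ R
    · exact spin_mul_le_of_lowerT hR _
    · rw [hζ.eq_false hR]; simp [lowerT, hR]
  · rw [hx]

lemma pairQ_lt {h : ℝ} (h0 : 0 < h) (h2 : h < 2) {R : Set (Site L)} {y ζ : Config L}
    (hζ : Below ζ (ind R)) (hne : ζ ≠ lowerT h R y) : pairQ h y ζ < pairQ h y (lowerT h R y) := by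
  obtain ⟨x, hx⟩ := Function.ne_iff.1 hne
  have hR : x ∈ R := by
    by_contra hR
    exact hx (by rw [hζ.eq_false hR]; simp [lowerT, hR])
  unfold pairQ
  gcongr h * _ + ?_
  refine Finset.sum_lt_sum (fun z _ => ?_) ⟨x, Finset.mem_univ x, ?_⟩
  · by_cases hz : z ∈ R
    · exact spin_mul_le_of_lowerT hz _
    · rw [hζ.eq_false hz]; simp [lowerT, hz]
  · have h3 := spin_mul_le_of_lowerT (h := h) (y := y) hR (ζ x)
    have h4 := nnS_add_ne_zero h0 h2 y x
    refine lt_of_le_of_ne h3 fun he => hx ?_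
    have := mul_right_cancel₀ h4 he
    cases h5 : ζ x <;> cases h6 : lowerT h R y x <;> rw [h5, h6] at this <;> simp at * <;> linarith

end Mix

section Droplet

variable {L : ℕ} [NeZero L]

lemma exists_full_line {S : Finset (Site L)} (f : Site L → ZMod L) (p : ZMod L) {n : ℕ}
    (hn : n ≤ L) (hS : S.card < n) : ∃ i < n, ∀ x ∈ S, f x ≠ p + i := by
  by_contra! h
  refine absurd hS (not_lt.2 ?_)
  have h1 : ((Finset.range n).image fun i : ℕ => p + (i : ZMod L)).card = n := by
    rw [Finset.card_image_of_injOn, Finset.card_range]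
    intro i hi j hj hij
    have hi' := Finset.mem_range.1 hi
    have hj' := Finset.mem_range.1 hj
    have := congrArg ZMod.val (add_left_cancel hij)
    rwa [ZMod.val_cast_of_lt (by omega), ZMod.val_cast_of_lt (by omega)] at this
  rw [← h1]
  refine (Finset.card_le_card fun t ht => ?_).trans (Finset.card_image_le (s := S) (f := f))
  obtain ⟨i, hi, rfl⟩ := Finset.mem_image.1 ht
  obtain ⟨x, hx, hfx⟩ := h i (Finset.mem_range.1 hi)
  exact Finset.mem_image.2 ⟨x, hx, hfx⟩

/-- A pair exchanged by the dynamics in a rectangle with few minuses is the full rectangle. -/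
lemma eq_ind_of_lowerT {h : ℝ} (h0 : 0 < h) {c : Site L} {a b : ℕ} (ha : a ≤ L) (hb : b ≤ L)
    {y ζ : Config L} (hy : y = lowerT h (rect c a b) ζ) (hζ : ζ = lowerT h (rect c a b) y)
    (hm : miss (rect c a b) y + miss (rect c a b) ζ < min a b) : y = ind (rect c a b) := by
  set S := (Finset.univ.filter fun x => x ∈ rect c a b ∧ y x = false) ∪
    (Finset.univ.filter fun x => x ∈ rect c a b ∧ ζ x = false) with hS
  have hc : S.card < min a b := (Finset.card_union_le _ _).trans_lt hm
  rw [lt_min_iff] at hc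
  obtain ⟨i₀, hi₀, hcol⟩ := exists_full_line Prod.fst c.1 ha hc.1
  obtain ⟨j₀, hj₀, hrow⟩ := exists_full_line Prod.snd c.2 hb hc.2
  have good : ∀ x, x ∈ rect c a b → x ∉ S → y x = true ∧ ζ x = true := by
    intro x hx hxS
    simpa [hS, hx] using hxS
  have mem : ∀ i j : ℕ, i < a → j < b → c + ((i : ZMod L), (j : ZMod L)) ∈ rect c a b :=
    fun i j hi hj => ⟨i, j, hi, hj, rfl⟩
  have step : ∀ u w : Config L, w = lowerT h (rect c a b) u → ∀ i j : ℕ, i < a → j < b →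
      ((0 < i ∧ u (c + (((i - 1 : ℕ) : ZMod L), (j : ZMod L))) = true) ∨
        u (c + (((i + 1 : ℕ) : ZMod L), (j : ZMod L))) = true) →
      ((0 < j ∧ u (c + ((i : ZMod L), ((j - 1 : ℕ) : ZMod L))) = true) ∨
        u (c + ((i : ZMod L), ((j + 1 : ℕ) : ZMod L))) = true) →
      w (c + ((i : ZMod L), (j : ZMod L))) = true := by
    rintro u w rfl i j hi hj h1 h2
    simp only [lowerT, mem i j hi hj, if_true]
    refine T_eq_true h0 (isAxes_en.nnS_nonneg (h1.symm.imp ?_ ?_) (h2.symm.imp ?_ ?_))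
    · intro h; rw [← h]; congr 1; ext <;> simp [east, add_assoc]
    · rintro ⟨h, h'⟩; rw [← h']; congr 1; ext <;> simp [east, Nat.cast_sub h, add_sub_assoc]
    · intro h; rw [← h]; congr 1; ext <;> simp [north, add_assoc]
    · rintro ⟨h, h'⟩; rw [← h']; congr 1; ext <;> simp [north, Nat.cast_sub h, add_sub_assoc]
  have main : ∀ n i j : ℕ, i < a → j < b → (i - i₀ + (i₀ - i)) + (j - j₀ + (j₀ - j)) ≤ n →
      y (c + ((i : ZMod L), (j : ZMod L))) = true ∧
        ζ (c + ((i : ZMod L), (j : ZMod L))) = true := by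
    intro n
    induction n with
    | zero =>
      intro i j hi hj hn
      exact good _ (mem i j hi hj) fun hxS => hcol _ hxS (by simp [show i = i₀ by omega])
    | succ n ih =>
      intro i j hi hj hn
      by_cases hii : i = i₀
      · exact good _ (mem i j hi hj) fun hxS => hcol _ hxS (by simp [hii])
      by_cases hjj : j = j₀
      · exact good _ (mem i j hi hj) fun hxS => hrow _ hxS (by simp [hjj])
      have H : ∀ u : Config L, (∀ i j : ℕ, i < a → j < b →
          (i - i₀ + (i₀ - i)) + (j - j₀ + (j₀ - j)) ≤ n →
          u (c + ((i : ZMod L), (j : ZMod L))) = true) →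
          ((0 < i ∧ u (c + (((i - 1 : ℕ) : ZMod L), (j : ZMod L))) = true) ∨
            u (c + (((i + 1 : ℕ) : ZMod L), (j : ZMod L))) = true) ∧
          ((0 < j ∧ u (c + ((i : ZMod L), ((j - 1 : ℕ) : ZMod L))) = true) ∨
            u (c + ((i : ZMod L), ((j + 1 : ℕ) : ZMod L))) = true) := by
        intro u hu
        constructor
        · rcases lt_or_gt_of_ne hii with hlt | hgt
          · exact Or.inr (hu _ _ (by omega) hj (by omega))
          · exact Or.inl ⟨by omega, hu _ _ (by omega) hj (by omega)⟩
        · rcases lt_or_gt_of_ne hjj with hlt | hgt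
          · exact Or.inr (hu _ _ hi (by omega) (by omega))
          · exact Or.inl ⟨by omega, hu _ _ hi (by omega) (by omega)⟩
      obtain ⟨h1, h2⟩ := H ζ fun i j hi hj hn => (ih i j hi hj hn).2
      obtain ⟨h3, h4⟩ := H y fun i j hi hj hn => (ih i j hi hj hn).1
      exact ⟨step ζ y hy i j hi hj h1 h2, step y ζ hζ i j hi hj h3 h4⟩
  funext x
  by_cases hx : x ∈ rect c a b
  · rw [ind_apply_true hx]
    obtain ⟨i, j, hi, hj, rfl⟩ := hx
    exact (main _ i j hi hj le_rfl).1
  · rw [ind_apply_false hx, hy]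
    simp [lowerT, hx]

end Droplet

section Basin

variable {L : ℕ} [NeZero L]

/-- The cycle of the rectangle under the dynamics with minuses outside it: the configurations
whose pair interaction with their drift stays within `2h(n-1)` of the maximum and which miss
less than `n-1` sites. -/
def cycle (h : ℝ) (n : ℕ) (R : Set (Site L)) : Set (Config L) :=
  {y | Below y (ind R) ∧
    pairQ h (ind R) (ind R) - 2 * h * ((n : ℝ) - 1) < pairQ h y (lowerT h R y) ∧
    miss R y + miss R (lowerT h R y) + 1 < n}

lemma miss_ind (R : Set (Site L)) : miss R (ind R) = 0 := by
  rw [miss, Finset.card_eq_zero, Finset.filter_eq_empty_iff]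
  rintro x - ⟨hx, hx'⟩
  rw [ind_apply_true hx] at hx'
  exact absurd hx' (by simp)

variable {h : ℝ} {c : Site L} {a b n : ℕ}

lemma ind_mem_cycle (h0 : 0 < h) (ha : 2 ≤ a) (hb : 2 ≤ b) (hn : 2 ≤ n) :
    ind (rect c a b) ∈ cycle h n (rect c a b) := by
  have hn' : (2 : ℝ) ≤ n := by exact_mod_cast hn
  refine ⟨fun _ => id, ?_, ?_⟩
  · rw [lowerT_ind h0 ha hb]
    nlinarith
  · rw [lowerT_ind h0 ha hb, miss_ind]
    omega

lemma cycle_exit (hL : Even L) (ha : a < L) (hb : b < L) (hn : n ≤ min a b)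
    {y ζ : Config L} (hy : y ∈ cycle h n (rect c a b)) (hζ : ζ ∉ cycle h n (rect c a b))
    (hζR : Below ζ (ind (rect c a b))) :
    pairQ h y ζ ≤ pairQ h (ind (rect c a b)) (ind (rect c a b)) - 2 * h * ((n : ℝ) - 1) := by
  set R := rect c a b
  obtain ⟨hyR, -, hym⟩ := hy
  have hn1 : ((n - 1 : ℕ) : ℝ) = (n : ℝ) - 1 := by rw [Nat.cast_sub (by omega)]; simp
  have key : ∀ p ω : Config L, Below p (ind R) → Below ω (ind R) → miss R p + miss R ω = n - 1 →
      pairQ h p ω ≤ pairQ h (ind R) (ind R) - 2 * h * ((n : ℝ) - 1) := by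
    intro p ω hp hω hm
    have := pairQ_le_of_miss hL h ha hb hp hω (by rw [hm]; omega)
    rwa [hm, hn1] at this
  by_cases hm : n ≤ miss R y + miss R ζ + 1
  · obtain ⟨ω, hωR, hωm, hω⟩ := exists_mix (lowerT_below h R y) (q := ζ)
      (k := n - 1 - miss R y) (by omega) (by omega)
    exact (pairQ_le_mix hζR hω).trans (key y ω hyR hωR (by omega))
  by_cases hm' : n ≤ miss R ζ + miss R (lowerT h R ζ) + 1
  · obtain ⟨ω, hωR, hωm, hω⟩ := exists_mix hyR (q := lowerT h R ζ)
      (k := n - 1 - miss R ζ) (by omega) (by omega)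
    rw [pairQ_comm]
    exact (pairQ_le_mix hyR fun x => (hω x).symm).trans (key ζ ω hζR hωR (by omega))
  · rw [pairQ_comm]
    refine (pairQ_le_mix (R := R) hyR (ω := lowerT h R ζ) fun x => Or.inl rfl).trans ?_
    by_contra hlt
    exact hζ ⟨hζR, not_le.1 hlt, by omega⟩

lemma lowerT_mem_cycle (hL : Even L) (ha : a < L) (hb : b < L) (hn : n ≤ min a b)
    {y : Config L} (hy : y ∈ cycle h n (rect c a b)) :
    lowerT h (rect c a b) y ∈ cycle h n (rect c a b) := by
  by_contra hζ
  exact absurd hy.2.1 (not_lt.2 (cycle_exit hL ha hb hn hy hζ (lowerT_below _ _ _)))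

lemma exists_iterate_lowerT_eq (hL : Even L) (h0 : 0 < h) (h2 : h < 2) (ha : a < L) (hb : b < L)
    (hn : n ≤ min a b) {y : Config L} (hy : y ∈ cycle h n (rect c a b)) :
    ∃ m, (lowerT h (rect c a b))^[m] y = ind (rect c a b) := by
  set R := rect c a b
  by_contra! hne
  have hmem : ∀ m, (lowerT h R)^[m] y ∈ cycle h n R := by
    intro m
    induction m with
    | zero => exact hy
    | succ m ih => rw [Function.iterate_succ_apply']; exact lowerT_mem_cycle hL ha hb hn ih
  have hmono : StrictMono fun m => pairQ h ((lowerT h R)^[m] y) ((lowerT h R)^[m + 1] y) := by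
    refine strictMono_nat_of_lt_succ fun m => ?_
    simp only [Function.iterate_succ_apply']
    rw [pairQ_comm]
    refine pairQ_lt h0 h2 (hmem m).1 fun he => hne m ?_
    have hm := (hmem m).2.2
    exact eq_ind_of_lowerT h0 ha.le hb.le he rfl (by
      change miss R _ + miss R _ < _
      omega)
  refine not_injective_infinite_finite (fun m => (lowerT h R)^[m] y) fun m m' hmm => ?_
  refine hmono.injective ?_
  simp only [Function.iterate_succ_apply']
  exact congrArg (fun z => pairQ h z (lowerT h R z)) hmm

lemma exists_iterate_T_above (hL : Even L) (h0 : 0 < h) (h2 : h < 2) (ha2 : 2 ≤ a) (hb2 : 2 ≤ b)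
    (ha : a < L) (hb : b < L) (hn : n ≤ min a b) :
    ∃ N, ∀ σ ∈ Above (cycle h n (rect c a b)), Below (ind (rect c a b)) ((T h)^[N] σ) := by
  set R := rect c a b
  have hex : ∀ y : Config L, ∃ m, y ∈ cycle h n R → (lowerT h R)^[m] y = ind R := by
    intro y
    by_cases hy : y ∈ cycle h n R
    · exact (exists_iterate_lowerT_eq hL h0 h2 ha hb hn hy).imp fun m hm _ => hm
    · exact ⟨0, fun h => absurd h hy⟩
  choose m hm using hex
  refine ⟨Finset.univ.sup m, ?_⟩
  rintro σ ⟨y, hy, hyσ⟩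
  have h1 : m y ≤ Finset.univ.sup m := Finset.le_sup (Finset.mem_univ y)
  have h3 := lowerT_iterate_below_T (h := h) (R := R) hyσ (Finset.univ.sup m)
  rwa [← Nat.sub_add_cancel h1, Function.iterate_add_apply, hm y hy,
    Function.iterate_fixed (lowerT_ind h0 ha2 hb2), Nat.sub_add_cancel h1] at h3

lemma disjoint_Above_cycle_chessSet (hL : Even L) (ha : 2 ≤ a) (hb : b ≤ L)
    (hn : n ≤ min a b) : Disjoint (Above (cycle h n (rect c a b))) (chessSet L) := by
  rw [Set.disjoint_left]
  rintro D ⟨y, ⟨-, -, hym⟩, hyD⟩ hD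
  rw [← isChessCfg_iff] at hD
  obtain ⟨j, hj, hrow⟩ := exists_full_line
    (S := Finset.univ.filter fun x => x ∈ rect c a b ∧ y x = false)
    Prod.snd c.2 hb (show miss (rect c a b) y < b by omega)
  have key : ∀ i : ℕ, i < a → y (c + ((i : ZMod L), (j : ZMod L))) = true := by
    intro i hi
    by_contra hne
    refine hrow _ (Finset.mem_filter.2 ⟨Finset.mem_univ _, ⟨i, j, hi, hj, rfl⟩,
      by simpa using hne⟩) ?_
    simp
  have h1 := hyD _ (key 0 (by omega))
  have h2 := hyD _ (key 1 (by omega))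
  rw [hD.of_adj hL (x := c + (((0 : ℕ) : ZMod L), (j : ZMod L)))
    (Or.inl (by ext <;> simp [east])), h1] at h2
  simp at h2

lemma one_sub_le_stay_Above (hL : Even L) (h0 : 0 < h) (ha2 : 2 ≤ a) (hb2 : 2 ≤ b)
    (ha : a < L) (hb : b < L) (hn2 : 2 ≤ n) (hn : n ≤ min a b) {θ : ℝ}
    (hθ : θ < 2 * h * ((n : ℝ) - 1)) (m : ℕ) {κ : ℝ} (hκ : 0 < κ) :
    ∀ᶠ β : ℝ in atTop, ∀ σ : Config L, Below (ind (rect c a b)) σ →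
      1 - κ ≤ stay (Pmat β h) (Above (cycle h n (rect c a b))) (m * ⌊Real.exp (β * θ)⌋₊) σ := by
  filter_upwards [eventually_exit_small hθ
    (show (0 : ℝ) ≤ (Fintype.card (Config L) : ℝ) ^ 2 by positivity) m hκ,
    eventually_gt_atTop 0] with β h1 hβ σ hσ
  refine le_trans ?_ (stay_lowerK_le hβ (rect c a b) _ _ hσ)
  refine le_trans ?_ (one_sub_le_stay_lowerK hβ (ind_mem_cycle h0 ha2 hb2 hn2)
    (fun y hy ζ hζ _ hζR => cycle_exit hL ha hb hn hy hζ hζR) _)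
  linarith

end Basin

section Growth

variable {L : ℕ} {h : ℝ}

/-- Configurations dominating a chessboard and equal to plus on `R`. -/
def PlusOn (R : Set (Site L)) : Set (Config L) := {σ | σ ∈ Upper Set.univ ∧ Below (ind R) σ}

lemma nnS_nonneg_of_pair {v w : Site L} (hvw : IsAxes v w) {σ : Config L} {x : Site L}
    (h1 : σ (x + v) = true) (h2 : σ (x - v) = true) : 0 ≤ nnS σ x := by
  rw [hvw.nnS_eq, h1, h2, spin_true]
  linarith [neg_one_le_spin (σ (x + w)), neg_one_le_spin (σ (x - w))]

lemma neg_two_le_nnS {σ : Config L} {x y : Site L} (hxy : Adj x y) (hy : σ y = true) :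
    -2 ≤ nnS σ x := by
  have h1 := neg_one_le_spin (σ (x + east L))
  have h2 := neg_one_le_spin (σ (x - east L))
  have h3 := neg_one_le_spin (σ (x + north L))
  have h4 := neg_one_le_spin (σ (x - north L))
  unfold nnS
  rcases hxy with rfl | rfl | rfl | rfl <;> rw [hy, spin_true] at * <;> linarith

/-- `σ` is plus on `R` and on the first `s + 1` sites of the side, and dominates the chessboard
`D`, which is minus at the last one of them. -/
def Growing (R : Set (Site L)) (p v : Site L) (s : ℕ) (D σ : Config L) : Prop :=
  IsChessCfg D ∧ UpperAt Set.univ D σ ∧ Below (ind R) σ ∧ D (p + s • v) = false ∧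
    ∀ i ≤ s, σ (p + i • v) = true

variable {R R' : Set (Site L)} {p v w : Site L} {n : ℕ}

lemma Growing.plusOn {D σ : Config L} (hR' : ∀ x ∈ R', x ∈ R ∨ ∃ i < n + 1, x = p + i • v)
    (hσ : Growing R p v n D σ) : σ ∈ PlusOn R' := by
  obtain ⟨hD, hU, hB, -, hp⟩ := hσ
  refine ⟨⟨D, hD, hU⟩, fun x hx => ?_⟩
  rcases hR' x (by simpa [ind] using hx) with hx | ⟨i, hi, rfl⟩
  · exact hB x (ind_apply_true hx)
  · exact hp i (by omega)

variable [NeZero L]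

lemma UpperAt.drift_univ (hL : Even L) (h0 : 0 < h) {D σ : Config L} (hD : IsChessCfg D)
    (hσ : UpperAt Set.univ D σ) : UpperAt Set.univ (fun x => !D x) (T h σ) := by
  intro x hx
  have hDx : D x = false := by simpa using hx
  rw [T_eq_true h0 (by rw [hσ.nnS_eq_four hL hD hDx]; norm_num)]
  exact (congrArg not hDx).symm

lemma pow_mul_reach_iterate_le {β : ℝ} (hβ : 0 < β) {G E : Set (Config L)}
    (hG : ∀ σ ∈ G, T h σ ∈ G) (m n : ℕ) {σ : Config L} (hσ : σ ∈ G) :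
    ((1 / 2 : ℝ) ^ Fintype.card (Site L)) ^ m * reach (Pmat β h) G E n ((T h)^[m] σ) ≤
      reach (Pmat β h) G E (m + n) σ := by
  induction m generalizing σ with
  | zero => simp
  | succ m ih =>
    have h1 := mul_reach_le_reach_succ (isStoch_Pmat β h) (G := G) (D := E) hσ (T h σ) (m + n)
      (Pmat_le_one ..)
    have h2 := mul_le_mul (le_Pmat_T (h := h) hβ σ) (ih (hG σ hσ))
      (mul_nonneg (by positivity) (reach_nonneg (isStoch_Pmat β h) ..))
      ((isStoch_Pmat β h).nonneg _ _)
    rw [Function.iterate_succ_apply, pow_succ', mul_assoc, show m + 1 + n = m + n + 1 by ring]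
    exact h2.trans h1

lemma Growing.drift (hL : Even L) (h0 : 0 < h) (hvw : IsAxes v w)
    (hR : Below (ind R) (T h (ind R)))
    (hside : ∀ i < n, p + i • v - w ∈ R) {D σ : Config L} {s : ℕ} (hs : s + 1 < n)
    (hσ : Growing R p v s D σ) : Growing R p v (s + 1) (fun x => !D x) (T h σ) := by
  obtain ⟨hD, hU, hB, hDs, hp⟩ := hσ
  have hw : ∀ i < n, σ (p + i • v - w) = true := fun i hi => hB _ (ind_apply_true (hside i hi))
  refine ⟨hD.not, hU.drift_univ hL h0 hD, hR.trans hB.drift, ?_, fun i hi => ?_⟩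
  · rw [succ_nsmul, ← add_assoc]
    change (!D (p + s • v + v)) = false
    rw [hD.of_adj hL (hvw.adj _).1, hDs]; rfl
  rcases lt_trichotomy i s with hlt | rfl | hgt
  · refine T_eq_true h0 (hvw.nnS_nonneg (Or.inl ?_) (Or.inr (hw i (by omega))))
    rw [add_assoc, ← succ_nsmul]
    exact hp _ (by omega)
  · exact T_eq_true h0 (by rw [hU.nnS_eq_four hL hD hDs]; norm_num)
  · obtain rfl : i = s + 1 := by omega
    refine T_eq_true h0 (hvw.nnS_nonneg (Or.inr ?_) (Or.inr (hw _ (by omega))))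
    rw [succ_nsmul, ← add_assoc, add_sub_cancel_right]
    exact hp s le_rfl

lemma Growing.iterate (hL : Even L) (h0 : 0 < h) (hvw : IsAxes v w)
    (hR : Below (ind R) (T h (ind R)))
    (hside : ∀ i < n, p + i • v - w ∈ R) {s : ℕ} (hs : s < n) {D σ : Config L}
    (hσ : Growing R p v 0 D σ) : ∃ D', Growing R p v s D' ((T h)^[s] σ) := by
  induction s with
  | zero => exact ⟨D, hσ⟩
  | succ s ih =>
    obtain ⟨D', hD'⟩ := ih (by omega)
    rw [Function.iterate_succ_apply']
    exact ⟨_, hD'.drift hL h0 hvw hR hside hs⟩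

/-- Attaching a side to the droplet costs one unfavourable flip. -/
lemma le_reach_grow {β : ℝ} (hL : Even L) (h0 : 0 < h) (h2 : h < 2) (hβ : 0 < β)
    {G : Set (Config L)} {N : ℕ} (hG : ∀ σ ∈ G, σ ∈ Upper Set.univ) (hT : ∀ σ ∈ G, T h σ ∈ G)
    (hRG : PlusOn R ⊆ G) (hR : Below (ind R) (T h (ind R)))
    (hN : ∀ σ ∈ G, Below (ind R) ((T h)^[N] σ)) (hvw : IsAxes v w)
    (hside : ∀ i < n + 1, p + i • v - w ∈ R)
    (hR' : ∀ x ∈ R', x ∈ R ∨ ∃ i < n + 1, x = p + i • v) {σ : Config L} (hσ : σ ∈ G) :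
    ((1 / 2 : ℝ) ^ Fintype.card (Site L)) ^ (N + 1 + (n + 1)) * Real.exp (-β * (2 * (2 - h))) ≤
      reach (Pmat β h) G (PlusOn R') (N + 1 + (n + 1)) σ := by
  set q : ℝ := (1 / 2 : ℝ) ^ Fintype.card (Site L) with hq
  have q0 : 0 < q := by positivity
  have q1 : q ≤ 1 := pow_le_one₀ (by norm_num) (by norm_num)
  have start : ∀ (σ D : Config L), IsChessCfg D → UpperAt Set.univ D σ → Below (ind R) σ →
      D p = true → q ^ (n + 1) * Real.exp (-β * (2 * (2 - h))) ≤
        reach (Pmat β h) G (PlusOn R') (n + 1) σ := by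
    intro σ D hD hU hB hDp
    set ζ := Function.update (T h σ) p true with hζ
    have hTζ : Below (T h σ) ζ := by
      intro x hx
      by_cases hxp : x = p
      · rw [hxp, hζ, Function.update_self]
      · rwa [hζ, Function.update_of_ne hxp]
    have hgrow : Growing R p v 0 (fun x => !D x) ζ := by
      refine ⟨hD.not, fun x hx => ?_, (hR.trans hB.drift).trans hTζ, by simp [hDp], fun i hi => ?_⟩
      · have h1 : (!D x) = true := by simpa using hx
        have h3 := hTζ x ((hU.drift_univ hL h0 hD x hx).trans h1)
        exact h3.trans h1.symm
      · obtain rfl : i = 0 := by omega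
        simp [hζ]
    obtain ⟨D', hD'⟩ := hgrow.iterate hL h0 hvw hR hside (Nat.lt_succ_self n)
    have hσG : σ ∈ G := hRG ⟨⟨D, hD, hU⟩, hB⟩
    have hζG : ζ ∈ G := hRG ⟨⟨_, hgrow.1, hgrow.2.1⟩, hgrow.2.2.1⟩
    have h3 := pow_mul_reach_iterate_le (h := h) hβ (E := PlusOn R') hT n 0 hζG
    rw [reach_of_mem (hD'.plusOn hR'), mul_one, add_zero] at h3
    have h4 := le_Pmat_update (h := h) (a := true) (x := p) (σ := σ) hβ
      (show 0 ≤ 2 - h by linarith) (by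
        have hw := hB _ (ind_apply_true (hside 0 (Nat.succ_pos n)))
        rw [zero_smul, add_zero] at hw
        have := neg_two_le_nnS (hvw.adj p).2.2.2 hw
        rw [spin_true]; linarith)
    refine le_trans (le_of_eq ?_) ((mul_le_mul h4 h3 (by positivity)
      ((isStoch_Pmat β h).nonneg _ _)).trans (mul_reach_le_reach_succ (isStoch_Pmat β h)
        (G := G) hσG ζ n (Pmat_le_one ..)))
    rw [← hq]; ring
  have hTm : ∀ m, (T h)^[m] σ ∈ G := by
    intro m
    induction m with
    | zero => exact hσ
    | succ m ih => rw [Function.iterate_succ_apply']; exact hT _ ih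
  obtain ⟨D, hD, hU⟩ := hG _ (hTm N)
  cases hDp : D p
  · have h3 := start _ _ hD.not (hU.drift_univ (h := h) hL h0 hD) (hR.trans (hN σ hσ).drift)
      (by simp [hDp])
    rw [← Function.iterate_succ_apply' (T h)] at h3
    refine le_trans (le_of_eq ?_) ((mul_le_mul_of_nonneg_left h3 (by positivity)).trans
      (pow_mul_reach_iterate_le (h := h) hβ hT (N + 1) (n + 1) hσ))
    rw [← hq]; ring
  · have h3 := start _ _ hD hU (hN σ hσ) hDp
    have h4 := (mul_le_mul_of_nonneg_left h3 (by positivity)).trans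
      (pow_mul_reach_iterate_le (h := h) hβ hT N (n + 1) hσ)
    refine le_trans ?_ (h4.trans (reach_mono_time (isStoch_Pmat β h) _ _ σ
      (show N + (n + 1) ≤ N + 1 + (n + 1) by omega)))
    rw [← hq, ← mul_assoc (q ^ N), ← pow_add]
    exact mul_le_mul_of_nonneg_right (pow_le_pow_of_le_one q0.le q1 (by omega)) (Real.exp_pos _).le

end Growth

section Nucleation

variable {L : ℕ} {h θ : ℝ} {c : Site L} {a b n : ℕ}

lemma ind_below_T_ind (h0 : 0 < h) (ha : 2 ≤ a) (hb : 2 ≤ b) :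
    Below (ind (rect c a b)) (T h (ind (rect c a b))) := by
  have := lowerT_below_T (h := h) (R := rect c a b) fun x (hx : ind (rect c a b) x = true) => hx
  rwa [lowerT_ind h0 ha hb] at this

variable [NeZero L]

/-- The metastable set in which a plus droplet occupying `rect c a b` waits for its growth. -/
def growthSet (h : ℝ) (n : ℕ) (R : Set (Site L)) : Set (Config L) :=
  Above (cycle h n R) ∩ Upper Set.univ

lemma plusOn_subset_growthSet (h0 : 0 < h) (ha : 2 ≤ a) (hb : 2 ≤ b) (hn : 2 ≤ n) :
    PlusOn (rect c a b) ⊆ growthSet h n (rect c a b) :=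
  fun _ hσ => ⟨⟨_, ind_mem_cycle h0 ha hb hn, hσ.2⟩, hσ.1⟩

lemma T_mem_growthSet (hL : Even L) (h0 : 0 < h) (ha : a < L) (hb : b < L) (hn : n ≤ min a b)
    {σ : Config L} (hσ : σ ∈ growthSet h n (rect c a b)) :
    T h σ ∈ growthSet h n (rect c a b) := by
  obtain ⟨⟨y, hy, hyσ⟩, D, hD, hU⟩ := hσ
  exact ⟨⟨_, lowerT_mem_cycle hL ha hb hn hy, lowerT_below_T hyσ⟩,
    _, hD.not, hU.drift_univ hL h0 hD⟩

lemma one_sub_le_stay_growthSet (hL : Even L) (h0 : 0 < h) (ha2 : 2 ≤ a) (hb2 : 2 ≤ b)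
    (ha : a < L) (hb : b < L) (hn2 : 2 ≤ n) (hn : n ≤ min a b)
    (hθ : θ < 2 * h * ((n : ℝ) - 1)) (hθ' : θ < 2 * (4 + h)) (m : ℕ) {κ : ℝ} (hκ : 0 < κ) :
    ∀ᶠ β : ℝ in atTop, ∀ σ ∈ PlusOn (rect c a b),
      1 - κ ≤ stay (Pmat β h) (growthSet h n (rect c a b)) (m * ⌊Real.exp (β * θ)⌋₊) σ := by
  filter_upwards [one_sub_le_stay_Above hL h0 ha2 hb2 ha hb hn2 hn hθ m (half_pos hκ),
    one_sub_le_stay_Upper_univ hL hθ' m (half_pos hκ)] with β h1 h2 σ hσ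
  have := stay_inter (isStoch_Pmat β h) (Above (cycle h n (rect c a b))) (Upper Set.univ)
    (m * ⌊Real.exp (β * θ)⌋₊) σ
  unfold growthSet
  linarith [h1 σ hσ.2, h2 σ hσ.1]

lemma growthSet_subset (hL : Even L) (ha2 : 2 ≤ a) (hb : b < L) (hn : n ≤ min a b) :
    growthSet h n (rect c a b) ⊆ (chessSet L)ᶜ :=
  fun _ hσ => Set.disjoint_left.1 (disjoint_Above_cycle_chessSet hL ha2 hb.le hn) hσ.1

lemma reaches_grow {R' : Set (Site L)} {p v w : Site L} {s : ℕ} (hL : Even L) (h0 : 0 < h)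
    (h2 : h < 2) (ha2 : 2 ≤ a) (hb2 : 2 ≤ b)
    (ha : a < L) (hb : b < L) (hn2 : 2 ≤ n) (hn : n ≤ min a b) (hθ₀ : 2 * (2 - h) < θ)
    (hθ : θ < 2 * h * ((n : ℝ) - 1)) (hθ' : θ < 2 * (4 + h)) (hvw : IsAxes v w)
    (hside : ∀ i < s + 1, p + i • v - w ∈ rect c a b)
    (hR' : ∀ x ∈ R', x ∈ rect c a b ∨ ∃ i < s + 1, x = p + i • v) :
    Reaches (fun β => Pmat β h) (chessSet L)ᶜ (PlusOn (rect c a b)) (PlusOn R') θ := by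
  obtain ⟨N, hN⟩ := exists_iterate_T_above (c := c) hL h0 h2 ha2 hb2 ha hb hn
  refine Reaches.mono (fun β => isStoch_Pmat β h) (G := growthSet h n (rect c a b)) ?_
    ((growthSet_subset hL ha2 hb hn).trans Set.subset_union_left) subset_rfl
  refine Reaches.of_trial (fun β => isStoch_Pmat β h)
    (c := ((1 / 2 : ℝ) ^ Fintype.card (Site L)) ^ (N + 1 + (s + 1)))
    (r := 2 * (2 - h)) (m := N + 1 + (s + 1)) (by positivity)
    (pow_le_one₀ (by positivity) (pow_le_one₀ (by norm_num) (by norm_num))) (by linarith) hθ₀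
    (fun β hβ σ hσ => ?_) fun κ hκ =>
      one_sub_le_stay_growthSet hL h0 ha2 hb2 ha hb hn2 hn hθ hθ' _ hκ
  exact le_reach_grow hL h0 h2 hβ (fun σ hσ => hσ.2)
    (fun σ hσ => T_mem_growthSet hL h0 ha hb hn hσ) (plusOn_subset_growthSet h0 ha2 hb2 hn2)
    (ind_below_T_ind h0 ha2 hb2) (fun σ hσ => hN σ hσ.1) hvw hside hR' hσ

lemma val_lt_pred_iff {t : ZMod L} : t.val < L - 1 ↔ t ≠ -1 := by
  obtain ⟨L, rfl⟩ := Nat.exists_eq_succ_of_ne_zero (NeZero.ne L)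
  have h1 := ZMod.val_lt t
  rw [← (ZMod.val_injective _).ne_iff, ZMod.val_neg_one]
  omega

lemma T_eq_true_of_ne_corner (h0 : 0 < h) (hL : 3 ≤ L) {σ : Config L}
    (hσ : Below (ind (rect c (L - 1) (L - 1))) σ) {x : Site L}
    (hx : (x - c).1 ≠ -1 ∨ (x - c).2 ≠ -1) : T h σ x = true := by
  have : Fact (1 < L) := ⟨by omega⟩
  have hmem : ∀ x : Site L, (x - c).1 ≠ -1 → (x - c).2 ≠ -1 →
      ind (rect c (L - 1) (L - 1)) x = true := fun x h1 h2 =>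
    ind_apply_true ((mem_rect_iff (by omega) (by omega)).2
      ⟨val_lt_pred_iff.2 h1, val_lt_pred_iff.2 h2⟩)
  have hadd : ∀ t u : ZMod L, t - u = -1 → t + 1 - u ≠ -1 ∧ t - 1 - u ≠ -1 := by
    intro t u htu
    rw [show t + 1 - u = t - u + 1 by ring, show t - 1 - u = t - u - 1 by ring, htu]
    simp
  by_cases h1 : (x - c).1 = -1
  · have h2 := hx.resolve_left (not_not.2 h1)
    obtain ⟨h3, h4⟩ := hadd _ _ h1
    refine T_eq_true h0 (nnS_nonneg_of_pair isAxes_en (hσ _ (hmem _ h3 ?_)) (hσ _ (hmem _ h4 ?_)))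
      <;> simpa [east] using h2
  · by_cases h2 : (x - c).2 = -1
    · obtain ⟨h3, h4⟩ := hadd _ _ h2
      refine T_eq_true h0 (nnS_nonneg_of_pair isAxes_ne (hσ _ (hmem _ ?_ h3))
        (hσ _ (hmem _ ?_ h4))) <;> simpa [north] using h1
    · exact hσ.drift x (ind_below_T_ind h0 (by omega) (by omega) x (hmem x h1 h2))

lemma T_T_eq_plusC (h0 : 0 < h) (hL : 3 ≤ L) {σ : Config L}
    (hσ : Below (ind (rect c (L - 1) (L - 1))) σ) : T h (T h σ) = plusC L := by
  have : Fact (1 < L) := ⟨by omega⟩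
  funext x
  by_cases hx : (x - c).1 ≠ -1 ∨ (x - c).2 ≠ -1
  · exact T_eq_true_of_ne_corner h0 hL
      ((ind_below_T_ind h0 (by omega) (by omega)).trans hσ.drift) hx
  · push Not at hx
    obtain ⟨h1, h2⟩ := hx
    simp only [Prod.fst_sub, Prod.snd_sub] at h1 h2
    refine T_eq_true h0 ?_
    rw [nnS_eq_four]
    · norm_num
    · intro y hy
      refine T_eq_true_of_ne_corner h0 hL hσ ?_
      rcases hy with rfl | rfl | rfl | rfl <;>
        simp [east, north, h1, h2, add_sub_right_comm, sub_right_comm _ (1 : ZMod L)]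

lemma reaches_plusC_of_rect (hL : Even L) (hL3 : 3 ≤ L) (h0 : 0 < h) (h2 : h < 2)
    (hn2 : 2 ≤ n) (hn : n ≤ L - 1) (hθ₀ : 0 < θ) (hθ : θ < 2 * h * ((n : ℝ) - 1))
    (hθ' : θ < 2 * (4 + h)) :
    Reaches (fun β => Pmat β h) (chessSet L)ᶜ (PlusOn (rect c (L - 1) (L - 1))) {plusC L} θ := by
  have ha2 : 2 ≤ L - 1 := by omega
  have ha : L - 1 < L := by omega
  have hn' : n ≤ min (L - 1) (L - 1) := by omega
  obtain ⟨N, hN⟩ := exists_iterate_T_above (c := c) hL h0 h2 ha2 ha2 ha ha hn'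
  refine Reaches.mono (fun β => isStoch_Pmat β h)
    (G := growthSet h n (rect c (L - 1) (L - 1))) ?_
    ((growthSet_subset hL ha2 ha hn').trans Set.subset_union_left) subset_rfl
  refine Reaches.of_trial (fun β => isStoch_Pmat β h)
    (c := ((1 / 2 : ℝ) ^ Fintype.card (Site L)) ^ (N + 2))
    (r := 0) (m := N + 2) (by positivity)
    (pow_le_one₀ (by positivity) (pow_le_one₀ (by norm_num) (by norm_num))) le_rfl hθ₀
    (fun β hβ σ hσ => ?_) fun κ hκ =>
      one_sub_le_stay_growthSet hL h0 ha2 ha2 ha ha hn2 hn' hθ hθ' _ hκ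
  have h3 := pow_mul_reach_iterate_le (h := h) hβ (E := {plusC L})
    (fun σ hσ => T_mem_growthSet hL h0 ha ha hn' hσ) (N + 2) 0 hσ
  have h4 : (T h)^[N + 2] σ = plusC L := by
    rw [Function.iterate_succ_apply', Function.iterate_succ_apply']
    exact T_T_eq_plusC h0 hL3 (hN σ hσ.1)
  rw [reach_of_mem (by simp [h4])] at h3
  simpa using h3

/-- A droplet that is large enough grows until it fills the torus. -/
lemma reaches_plusC (hL : Even L) (hL3 : 3 ≤ L) (h0 : 0 < h) (h2 : h < 2)
    (hn2 : 2 ≤ n) (hθ₀ : 2 * (2 - h) < θ) (hθ : θ < 2 * h * ((n : ℝ) - 1))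
    (hθ' : θ < 2 * (4 + h)) (ha : a < L) (hb : b < L) (hn : n ≤ min a b) :
    Reaches (fun β => Pmat β h) (chessSet L)ᶜ (PlusOn (rect c a b)) {plusC L} θ := by
  induction hN : (L - 1 - a) + (L - 1 - b) generalizing a b with
  | zero =>
    obtain rfl : a = L - 1 := by omega
    obtain rfl : b = L - 1 := by omega
    exact reaches_plusC_of_rect hL hL3 h0 h2 hn2 (by omega) (by linarith) hθ hθ'
  | succ N ih =>
    by_cases haL : a + 1 < L
    · refine Reaches.trans (fun β => isStoch_Pmat β h) ?_
        (ih (a := a + 1) (b := b) haL hb (by omega) (by omega))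
      refine reaches_grow (p := c + ((a : ZMod L), 0)) (s := b - 1) hL h0 h2 (by omega) (by omega)
        ha hb hn2 hn hθ₀ hθ hθ' isAxes_ne ?_ ?_
      · refine fun i hi => ⟨a - 1, i, by omega, by omega, ?_⟩
        rw [Nat.cast_sub (by omega)]
        ext <;> simp [north, east]; ring
      · rintro x ⟨i, j, hi, hj, rfl⟩
        rcases Nat.lt_succ_iff_lt_or_eq.1 hi with hi | rfl
        · exact Or.inl ⟨i, j, hi, hj, rfl⟩
        · exact Or.inr ⟨j, by omega, by ext <;> simp [north]⟩
    · refine Reaches.trans (fun β => isStoch_Pmat β h) ?_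
        (ih (a := a) (b := b + 1) ha (by omega) (by omega) (by omega))
      refine reaches_grow (p := c + (0, (b : ZMod L))) (s := a - 1) hL h0 h2 (by omega) (by omega)
        ha hb hn2 hn hθ₀ hθ hθ' isAxes_en ?_ ?_
      · refine fun i hi => ⟨i, b - 1, by omega, by omega, ?_⟩
        rw [Nat.cast_sub (by omega)]
        ext <;> simp [north, east]; ring
      · rintro x ⟨i, j, hi, hj, rfl⟩
        rcases Nat.lt_succ_iff_lt_or_eq.1 hj with hj | rfl
        · exact Or.inl ⟨i, j, hi, hj, rfl⟩
        · exact Or.inr ⟨i, by omega, by ext <;> simp [east]⟩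

end Nucleation

section Main

variable {L : ℕ} [NeZero L] {h : ℝ} {C η : Config L} {k ℓ : ℕ} {c : Fin k → Site L}
  {a b : Fin k → ℕ}

lemma disjoint_chessSet_plusC (hL : Even L) :
    Disjoint (chessSet L) {plusC L} := by
  rw [Set.disjoint_singleton_right, ← isChessCfg_iff]
  intro hC
  have := hC.of_adj hL (isAxes_en.adj (0 : Site L)).1
  simp [plusC] at this

lemma exists_notMem_iUnion_rect (hab2 : ∀ i, 2 ≤ a i ∧ 2 ≤ b i)
    (hab : ∀ i, a i + 2 ≤ L ∧ b i + 2 ≤ L)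
    (hNI : ∀ i j, i ≠ j → NonInteracting (rect (c i) (a i) (b i)) (rect (c j) (a j) (b j)))
    (i : Fin k) : ∃ x, x ∉ ⋃ i, rect (c i) (a i) (b i) := by
  have := hab2 i
  have := hab i
  have hy : c i + (((a i - 1 : ℕ) : ZMod L), ((0 : ℕ) : ZMod L)) ∈ rect (c i) (a i) (b i) :=
    ⟨a i - 1, 0, by omega, by omega, rfl⟩
  set y := c i + (((a i - 1 : ℕ) : ZMod L), ((0 : ℕ) : ZMod L)) with hydef
  refine ⟨y + east L, fun hx => ?_⟩
  obtain ⟨j, hj⟩ := Set.mem_iUnion.1 hx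
  rcases eq_or_ne i j with rfl | hij
  · rw [mem_rect_iff (by omega) (by omega), hydef, Nat.cast_sub (by omega)] at hj
    simp only [east, Prod.fst_sub, Prod.fst_add, Nat.cast_one,
      show (c i).1 + ((a i : ZMod L) - 1) + 1 - (c i).1 = a i by ring] at hj
    rw [ZMod.val_cast_of_lt (by omega)] at hj
    exact lt_irrefl _ hj.1
  · exact hNI i j hij y hy _ hj (isAxes_en.adj y).1.closeDiff

/-- Plus droplets shorter than the critical length shrink. -/
lemma tendsto_of_subcritical (hL : Even L) (h0 : 0 < h) (h2 : h < 2)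
    (hab2 : ∀ i, 2 ≤ a i ∧ 2 ≤ b i) (hab : ∀ i, a i + 2 ≤ L ∧ b i + 2 ≤ L)
    (hNI : ∀ i j, i ≠ j → NonInteracting (rect (c i) (a i) (b i)) (rect (c j) (a j) (b j)))
    (hU : η ∈ Upper (⋃ i, rect (c i) (a i) (b i)))
    (hP : ∀ i, ∀ x ∈ rect (c i) (a i) (b i), η x = true)
    (hx : ∃ x, x ∉ ⋃ i, rect (c i) (a i) (b i))
    (hℓ : ∀ i, min (a i) (b i) ≤ ℓ) {j : Fin k} (hj : min (a j) (b j) = ℓ) (hhℓ : h * ℓ < 2) :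
    Tendsto (fun β => probHitBefore β h η (chessSet L) {plusC L}) atTop (nhds 1) ∧
      ∀ ε : ℝ, 0 < ε → Tendsto (fun β : ℝ => probTauIn β h η (chessSet L)
        (Set.Ioo (Real.exp (β * (2 * h * ((ℓ : ℝ) - 1) - ε)))
          (Real.exp (β * (2 * h * ((ℓ : ℝ) - 1) + ε))))) atTop (nhds 1) := by
  have hL2 : 2 < L := by have := hab j; have := hab2 j; omega
  have hS := sparse_iUnion_rect (a' := a) (b' := b) hNI (fun _ => le_rfl) (fun _ => le_rfl) hab
  have hP' : ∀ β, IsStoch (Pmat (L := L) β h) := fun β => isStoch_Pmat β h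
  refine ⟨?_, fun ε hε => tendsto_probTauIn (fun ε hε => ?_) (fun ε hε κ hκ => ?_) hε⟩
  · obtain ⟨θ, hθ, hθ'⟩ := exists_between (show 2 * h * ((ℓ : ℝ) - 1) < 2 * (2 - h) by linarith)
    refine tendsto_probHitBefore (disjoint_chessSet_plusC hL)
      ((reaches_chessSet hL hL2 h0 h2 hNI hab hℓ hθ hθ').mono hP' ?_
        (Set.singleton_subset_iff.2 hU))
    refine Set.Subset.trans (fun σ hσ => ?_) Set.subset_union_left
    rintro rfl
    exact plusC_notMem_Upper hL hL2 hS hx hσ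
  · obtain ⟨θ, hθ, hθ'⟩ := exists_between (show 2 * h * ((ℓ : ℝ) - 1) <
      min (2 * (2 - h)) (2 * h * ((ℓ : ℝ) - 1) + ε) from lt_min (by linarith) (by linarith))
    refine ⟨θ, hθ'.trans_le (min_le_right _ _),
      (reaches_chessSet hL hL2 h0 h2 hNI hab hℓ hθ (hθ'.trans_le (min_le_left _ _))).mono hP' ?_
        (Set.singleton_subset_iff.2 hU)⟩
    rw [Set.compl_union_self]
    exact Set.subset_univ _
  · have hℓ2 : 2 ≤ ℓ := by have := hab2 j; omega
    have haL : a j < L := by have := hab j; omega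
    have hbL : b j < L := by have := hab j; omega
    have hB : Below (ind (rect (c j) (a j) (b j))) η :=
      fun x hx => hP j x (by simpa [ind] using hx)
    filter_upwards [one_sub_le_stay_Above hL h0 (hab2 j).1 (hab2 j).2 haL hbL hℓ2 hj.ge
      (show 2 * h * ((ℓ : ℝ) - 1) - ε < 2 * h * ((ℓ : ℝ) - 1) by linarith) 1 hκ] with β h1
    have h3 := h1 η hB
    rw [one_mul] at h3
    have h4 := reach_le_one_sub_stay (G := (chessSet L)ᶜ) (hP' β)
      (disjoint_Above_cycle_chessSet (h := h) (c := c j) hL (hab2 j).1 hbL.le hj.ge)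
      ⌊Real.exp (β * (2 * h * ((ℓ : ℝ) - 1) - ε))⌋₊ η
    linarith

/-- Plus droplets not shorter than the critical length grow. -/
lemma tendsto_of_supercritical (hL : Even L) (h0 : 0 < h) (h2 : h < 2)
    (hab : ∀ i, a i + 2 ≤ L ∧ b i + 2 ≤ L)
    (hNI : ∀ i j, i ≠ j → NonInteracting (rect (c i) (a i) (b i)) (rect (c j) (a j) (b j)))
    (hU : η ∈ Upper (⋃ i, rect (c i) (a i) (b i)))
    (hP : ∀ i, ∀ x ∈ rect (c i) (a i) (b i), η x = true)
    (hx : ∃ x, x ∉ ⋃ i, rect (c i) (a i) (b i))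
    {j : Fin k} {n : ℕ} (hn2 : 2 ≤ n) (hn : n ≤ min (a j) (b j)) (hhn : 2 < h * n) :
    Tendsto (fun β => probHitBefore β h η {plusC L} (chessSet L)) atTop (nhds 1) ∧
      ∀ ε : ℝ, 0 < ε → Tendsto (fun β : ℝ => probTauIn β h η {plusC L}
        (Set.Ioo (Real.exp (β * (2 * (2 - h) - ε)))
          (Real.exp (β * (2 * (2 - h) + ε))))) atTop (nhds 1) := by
  have hL2 : 2 < L := by have := hab j; omega
  have haL : a j < L := by have := hab j; omega
  have hbL : b j < L := by have := hab j; omega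
  have hS := sparse_iUnion_rect (a' := a) (b' := b) hNI (fun _ => le_rfl) (fun _ => le_rfl) hab
  have hP' : ∀ β, IsStoch (Pmat (L := L) β h) := fun β => isStoch_Pmat β h
  have hdisj : Disjoint (chessSet L) {plusC L} := disjoint_chessSet_plusC hL
  have hηP : η ∈ PlusOn (rect (c j) (a j) (b j)) :=
    ⟨Upper_mono (Set.subset_univ _) hU, fun x hx => hP j x (by simpa [ind] using hx)⟩
  have key : ∀ ε, 0 < ε → ∃ θ, θ < 2 * (2 - h) + ε ∧
      Reaches (fun β => Pmat β h) (chessSet L)ᶜ {η} {plusC L} θ := by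
    intro ε hε
    obtain ⟨θ, hθ, hθ'⟩ := exists_between (show 2 * (2 - h) <
      min (2 * (2 - h) + ε) (min (2 * h * ((n : ℝ) - 1)) (2 * (4 + h))) from
      lt_min (by linarith) (lt_min (by linarith) (by linarith)))
    rw [lt_min_iff, lt_min_iff] at hθ'
    exact ⟨θ, hθ'.1, (reaches_plusC hL (by omega) h0 h2 hn2 hθ hθ'.2.1 hθ'.2.2 haL hbL hn).mono
      hP' Set.subset_union_left (Set.singleton_subset_iff.2 hηP)⟩
  refine ⟨?_, fun ε hε => tendsto_probTauIn (fun ε hε => ?_) (fun ε hε κ hκ => ?_) hε⟩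
  · obtain ⟨θ, -, hθ⟩ := key 1 one_pos
    exact tendsto_probHitBefore hdisj.symm hθ
  · obtain ⟨θ, hθ, h3⟩ := key ε hε
    refine ⟨θ, hθ, h3.mono hP' ?_ subset_rfl⟩
    rw [Set.compl_union_self]
    exact Set.subset_univ _
  · filter_upwards [one_sub_le_stay_Upper hL hL2 h0 hS
      (show 2 * (2 - h) - ε < 2 * (2 - h) by linarith) 1 hκ] with β h1
    have h3 := h1 η hU
    rw [one_mul] at h3
    have h4 := reach_le_one_sub_stay (G := {plusC L}ᶜ) (D := {plusC L}) (hP' β)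
      (Set.disjoint_singleton_right.2 (plusC_notMem_Upper hL hL2 hS hx))
      ⌊Real.exp (β * (2 * (2 - h) - ε))⌋₊ η
    linarith

end Main

/-- Proposition 3.8, part i: behaviour of a trap made of
several non-interacting rectangles of pluses in a sea of chessboard `C`. -/
theorem multi_plus_droplets_in_chess_sea :
    ∃ h₀ : ℝ, 0 < h₀ ∧ h₀ ≤ 2 ∧
    ∀ h : ℝ, 0 < h → h < h₀ → (∀ z : ℤ, (z : ℝ) ≠ 2 / h) →
    ∃ L₀ : ℕ, ∀ (L : ℕ) [NeZero L], Even L → L₀ ≤ L →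
      ∀ C : Config L, IsChessCfg C →
      ∀ (k : ℕ), 1 ≤ k → ∀ (c : Fin k → Site L) (a b : Fin k → ℕ),
        (∀ i, 2 ≤ min (a i) (b i) ∧ max (a i) (b i) ≤ L - 2) →
        (∀ i j, i ≠ j →
          NonInteracting (rect (c i) (a i) (b i)) (rect (c j) (a j) (b j))) →
      ∀ η : Config L, IsTrap h η →
        (∀ i, ∀ x ∈ rect (c i) (a i) (b i), η x = true) →
        (∀ x : Site L, (∀ i, x ∉ rect (c i) (a i) (b i)) → η x = C x) →
      ∀ ℓ : ℕ, ℓ = Finset.univ.sup (fun i => min (a i) (b i)) →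
        ((∀ i, min (a i) (b i) < lam h) →
          Tendsto (fun β : ℝ => probHitBefore β h η (chessSet L) {plusC L})
            atTop (nhds 1) ∧
          ∀ ε : ℝ, 0 < ε →
            Tendsto (fun β : ℝ => probTauIn β h η (chessSet L)
                (Set.Ioo (Real.exp (2 * β * h * ((ℓ : ℝ) - 1) - β * ε))
                  (Real.exp (2 * β * h * ((ℓ : ℝ) - 1) + β * ε))))
              atTop (nhds 1)) ∧
        ((∃ j, lam h ≤ min (a j) (b j)) →
          Tendsto (fun β : ℝ => probHitBefore β h η {plusC L} (chessSet L))
            atTop (nhds 1) ∧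
          ∀ ε : ℝ, 0 < ε →
            Tendsto (fun β : ℝ => probTauIn β h η {plusC L}
                (Set.Ioo (Real.exp (2 * β * (2 - h) - β * ε))
                  (Real.exp (2 * β * (2 - h) + β * ε))))
              atTop (nhds 1)) := by
  refine ⟨2, two_pos, le_rfl, fun h h0 h2 hz => ⟨0, fun L _ hL _ C hC k hk c a b hab hNI η _ hP
    hηC ℓ hℓ => ?_⟩⟩
  have hab2 : ∀ i, 2 ≤ a i ∧ 2 ≤ b i := fun i => by have := (hab i).1; omega
  have habL : ∀ i, a i + 2 ≤ L ∧ b i + 2 ≤ L := fun i => by have := hab i; omega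
  have hU : η ∈ Upper (⋃ i, rect (c i) (a i) (b i)) := by
    refine ⟨C, hC, fun x hx => ?_⟩
    by_cases hxR : ∃ i, x ∈ rect (c i) (a i) (b i)
    · obtain ⟨i, hi⟩ := hxR
      rw [hP i x hi, hx.resolve_right (not_not.2 (Set.mem_iUnion.2 ⟨i, hi⟩))]
    · exact hηC x (not_exists.1 hxR)
  have hx := exists_notMem_iUnion_rect hab2 habL hNI ⟨0, hk⟩
  have hfl := Nat.floor_le (show 0 ≤ 2 / h by positivity)
  have hfl' := Nat.lt_floor_add_one (2 / h)
  refine ⟨fun hlt => ?_, fun ⟨j, hj⟩ => ?_⟩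
  · have : Nonempty (Fin k) := ⟨⟨0, hk⟩⟩
    obtain ⟨j, -, hj⟩ := Finset.exists_mem_eq_sup Finset.univ Finset.univ_nonempty
      fun i => min (a i) (b i)
    have hle : ∀ i, min (a i) (b i) ≤ ℓ := fun i =>
      hℓ ▸ Finset.le_sup (f := fun i => min (a i) (b i)) (Finset.mem_univ i)
    rw [← hℓ] at hj
    have hhℓ : h * ℓ < 2 := by
      have h3 : ℓ ≤ ⌊2 / h⌋₊ := by have := hlt j; unfold lam at this; omega
      have h4 : (ℓ : ℝ) < 2 / h :=
        lt_of_le_of_ne ((Nat.cast_le.2 h3).trans hfl) (by exact_mod_cast hz ℓ)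
      rwa [lt_div_iff₀' h0] at h4
    obtain ⟨h3, h4⟩ := tendsto_of_subcritical hL h0 h2 hab2 habL hNI hU hP hx hle hj.symm hhℓ
    refine ⟨h3, fun ε hε => ?_⟩
    convert h4 ε hε using 5 <;> ring_nf
  · have hn2 : 2 ≤ lam h := by
      have : 1 ≤ ⌊2 / h⌋₊ := Nat.le_floor (by rw [Nat.cast_one, one_le_div h0]; exact h2.le)
      unfold lam; omega
    have hhn : 2 < h * lam h := by
      rw [div_lt_iff₀' h0] at hfl'
      unfold lam; push_cast; exact hfl'
    obtain ⟨h3, h4⟩ := tendsto_of_supercritical hL h0 h2 habL hNI hU hP hx hn2 hj hhn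
    refine ⟨h3, fun ε hε => ?_⟩
    convert h4 ε hε using 5 <;> ring_nf

end PCA
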